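/- arXiv:2004.12364 — 3 statements merged into one kernel-verified Lean document; each statement's English description precedes it below -/
import Mathlib

section
/- (Theorem A.1) Under Assumption A, as m,n → ∞ with m/(m+n) → τ ∈ (0,1), there exists a centered Gaussian random element Z of C([0,1]) with covariance kernel k(s,t) = τ^{-1}·Cov(X_{11}(s), X_{11}(t)) + (1−τ)^{-1}·Cov(X_{21}(s), X_{21}(t)) (i.e. every finite-dimensional vector (Z(t₁),…,Z(t_k)) is centered multivariate normal with these covariances) such that √(m+n)·(T̂^θ_{m,n} − T^θ) converges in distribution to Z_{E,θ} = max{ sup_{t ∈ E^l_θ}(−Z(t)), sup_{t ∈ E^u_θ} Z(t) }, where the supremum over an empty set is interpreted as −∞. -/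
open MeasureTheory ProbabilityTheory Filter Topology

noncomputable section

/-- The unit interval `[0,1]` as a type. -/
abbrev I01 : Type := Set.Icc (0:ℝ) 1

/-- The Banach space `C([0,1])` of continuous real-valued functions with the sup-norm. -/
abbrev CI : Type := C(I01, ℝ)

/-- `Z` is a centered Gaussian random element of `C([0,1])` with covariance kernel `k`:
every finite linear combination of evaluations is centered normal with the variance
induced by `k`. -/
def IsCenteredGaussianWithKernel {Ω' : Type*} [MeasurableSpace Ω'] (P' : Measure Ω')
    (Z : Ω' → CI) (k : I01 → I01 → ℝ) : Prop :=
  ∀ (q : ℕ) (ts : Fin q → I01) (c : Fin q → ℝ),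
    Measure.map (fun ω => ∑ i, c i * Z ω (ts i)) P'
      = gaussianReal 0 (∑ i, ∑ j, c i * c j * k (ts i) (ts j)).toNNReal

/-- The two-sample mean-difference estimator `θ̂_{m,n}(t)`. -/
noncomputable def thetaHat2 {Ω : Type*} (X1 X2 : ℕ → Ω → CI) (m n : ℕ) (ω : Ω)
    (t : I01) : ℝ :=
  (m : ℝ)⁻¹ * ∑ j ∈ Finset.range m, X1 j ω t - (n : ℝ)⁻¹ * ∑ j ∈ Finset.range n, X2 j ω t

/-- The maximum-deviation functional `T^g = max{sup_t(−g(t)+κ_l(t)), sup_t(g(t)−κ_u(t))}`. -/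
noncomputable def Tmax (g κl κu : I01 → ℝ) : ℝ :=
  max (⨆ t : I01, (-g t + κl t)) (⨆ t : I01, (g t - κu t))


/-- extension of `w` to the line -/
def ext0 (w : CI) (x : ℝ) : ℝ := w (Set.projIcc 0 1 zero_le_one x)

lemma ext0_cont (w : CI) : Continuous (ext0 w) := w.continuous.comp continuous_projIcc

lemma ext0_coe (w : CI) (s : I01) : ext0 w s = w s := by simp [ext0]

/-- dyadic floor -/
def dy (M : ℕ) (x : ℝ) : ℝ := (⌊x * 2 ^ M⌋₊ : ℝ) / 2 ^ M

lemma dy_tendsto (x : ℝ) (hx : 0 ≤ x) : Tendsto (fun M => dy M x) atTop (𝓝 x) := by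
  have := (tendsto_nat_floor_mul_div_atTop (R := ℝ) hx).comp
    (tendsto_pow_atTop_atTop_of_one_lt (one_lt_two : (1:ℝ) < 2))
  exact this

/-- the compact sets -/
def KS (r A : ℝ) : Set CI := {w | |ext0 w 0| ≤ A ∧ ∀ M j : ℕ, j < 2 ^ M →
  |ext0 w (((j:ℝ) + 1) / 2 ^ M) - ext0 w ((j:ℝ) / 2 ^ M)| ≤ A * r ^ M}

lemma KS_all {r A : ℝ} (hr : 0 ≤ r) {w : CI} (hw : w ∈ KS r A) (M j : ℕ) :
    |ext0 w (((j:ℝ) + 1) / 2 ^ M) - ext0 w ((j:ℝ) / 2 ^ M)| ≤ A * r ^ M := by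
  by_cases h : j < 2 ^ M
  · exact hw.2 M j h
  · have hA : 0 ≤ A := le_trans (abs_nonneg _) hw.1
    have h1 : (1:ℝ) ≤ (j:ℝ) / 2 ^ M := by
      rw [le_div_iff₀ (by positivity)]; push Not at h; simpa using (by exact_mod_cast h : ((2:ℝ)^M) ≤ j)
    have h2 : (1:ℝ) ≤ ((j:ℝ) + 1) / 2 ^ M := by
      refine h1.trans ?_; gcongr; linarith
    have : ext0 w (((j:ℝ) + 1) / 2 ^ M) = ext0 w ((j:ℝ) / 2 ^ M) := by
      simp [ext0, Set.projIcc_of_right_le _ h1, Set.projIcc_of_right_le _ h2]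
    rw [this]; simp; positivity

lemma KS_adj {r A : ℝ} (hr : 0 ≤ r) {w : CI} (hw : w ∈ KS r A) (M : ℕ) (x y : ℝ) (hx : 0 ≤ x)
    (hxy : x ≤ y) (h : (y - x) * 2 ^ M ≤ 1) : |ext0 w (dy M y) - ext0 w (dy M x)| ≤ A * r ^ M := by
  have hA : 0 ≤ A := le_trans (abs_nonneg _) hw.1
  have h1 : ⌊x * 2 ^ M⌋₊ ≤ ⌊y * 2 ^ M⌋₊ := Nat.floor_mono (by gcongr)
  have h2 : ⌊y * 2 ^ M⌋₊ ≤ ⌊x * 2 ^ M⌋₊ + 1 := by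
    rw [← Nat.floor_add_one (by positivity)]
    exact Nat.floor_mono (by linarith)
  rcases (by omega : ⌊y * 2 ^ M⌋₊ = ⌊x * 2 ^ M⌋₊ ∨ ⌊y * 2 ^ M⌋₊ = ⌊x * 2 ^ M⌋₊ + 1) with h3 | h3
  · simp only [dy, h3]; simp; positivity
  · simp only [dy, h3]; push_cast; exact KS_all hr hw M _

lemma KS_step {r A : ℝ} (hr : 0 ≤ r) {w : CI} (hw : w ∈ KS r A) (M : ℕ) (x : ℝ) (hx : 0 ≤ x) :
    |ext0 w (dy (M+1) x) - ext0 w (dy M x)| ≤ A * r ^ (M+1) := by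
  have hf : ((⌊x * 2 ^ M⌋₊ : ℕ) : ℝ) ≤ x * 2 ^ M := Nat.floor_le (by positivity)
  have hf2 := Nat.lt_floor_add_one (x * 2 ^ M)
  -- dy (M+1) x is dy M x or one adjacent
  have hA : 0 ≤ A := le_trans (abs_nonneg _) hw.1
  have e1 : 2 * ⌊x * 2 ^ M⌋₊ ≤ ⌊x * 2 ^ (M+1)⌋₊ := by
    apply Nat.le_floor; push_cast; rw [pow_succ]; linarith
  have e2 : ⌊x * 2 ^ (M+1)⌋₊ < 2 * ⌊x * 2 ^ M⌋₊ + 2 := by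
    rw [Nat.floor_lt (by positivity)]; push_cast; rw [pow_succ]; linarith
  have e3 : dy M x = ((2 * ⌊x * 2 ^ M⌋₊ : ℕ) : ℝ) / 2 ^ (M+1) := by
    unfold dy; push_cast; rw [pow_succ]; field_simp
  rw [e3]
  rcases (by omega : ⌊x * 2 ^ (M+1)⌋₊ = 2 * ⌊x * 2 ^ M⌋₊ ∨
    ⌊x * 2 ^ (M+1)⌋₊ = 2 * ⌊x * 2 ^ M⌋₊ + 1) with h3 | h3
  · simp only [dy, h3]; simp; positivity
  · simp only [dy, h3]; rw [Nat.cast_add, Nat.cast_one]; exact KS_all hr hw _ _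

lemma KS_tail {r A : ℝ} (hr : 0 < r) (hr1 : r < 1) {w : CI} (hw : w ∈ KS r A) (N : ℕ) (x : ℝ)
    (hx : 0 ≤ x) : |ext0 w x - ext0 w (dy N x)| ≤ A * r ^ N / (1 - r) := by
  have hA : 0 ≤ A := le_trans (abs_nonneg _) hw.1
  have h1r : 0 < 1 - r := by linarith
  have key : ∀ k, |ext0 w (dy (N+k) x) - ext0 w (dy N x)| ≤ A * r ^ N * (1 - r ^ k) / (1 - r) := by
    intro k
    induction k with
    | zero => simp
    | succ k ih =>
      have h1 := KS_step hr.le hw (N+k) x hx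
      have h2 : |ext0 w (dy (N+(k+1)) x) - ext0 w (dy N x)| ≤
        A * r ^ (N+k+1) + A * r ^ N * (1 - r ^ k) / (1 - r) := by
        refine (abs_sub_le _ (ext0 w (dy (N+k) x)) _).trans (add_le_add h1 ih)
      refine h2.trans ?_
      have h3 : A * r ^ (N+k+1) ≤ A * r ^ (N+k) := by
        gcongr _ * ?_
        exact pow_le_pow_of_le_one hr.le hr1.le (by omega)
      rw [show A * r ^ N * (1 - r ^ (k+1)) / (1 - r)
        = A * r ^ (N+k) + A * r ^ N * (1 - r ^ k) / (1 - r) by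
          rw [pow_add, pow_succ]; field_simp; ring]
      linarith
  have lim : Tendsto (fun k => |ext0 w (dy (N+k) x) - ext0 w (dy N x)|) atTop
      (𝓝 |ext0 w x - ext0 w (dy N x)|) := by
    have h1 : Tendsto (fun k => dy (N+k) x) atTop (𝓝 x) := by
      have := (tendsto_add_atTop_iff_nat N).2 (dy_tendsto x hx)
      simpa [add_comm] using this
    exact ((((ext0_cont w).tendsto x).comp h1).sub_const _).abs
  refine le_of_tendsto' lim fun k => (key k).trans ?_
  have : 0 ≤ r ^ k := by positivity
  have h3 : A * r ^ N * (1 - r ^ k) ≤ A * r ^ N :=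
    mul_le_of_le_one_right (by positivity) (by linarith)
  exact div_le_div_of_nonneg_right h3 h1r.le

lemma KS_mod {r A : ℝ} (hr : 0 < r) (hr1 : r < 1) {w : CI} (hw : w ∈ KS r A) (N : ℕ) (s t : I01)
    (h : |(s:ℝ) - t| * 2 ^ N ≤ 1) : |w s - w t| ≤ A * r ^ N * (1 + 2 / (1 - r)) := by
  wlog hst : (s:ℝ) ≤ t generalizing s t
  · rw [abs_sub_comm]; exact this t s (by rwa [abs_sub_comm]) (le_of_not_ge hst)
  have h1 := KS_tail hr hr1 hw N s s.2.1
  have h2 := KS_tail hr hr1 hw N t t.2.1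
  have h3 := KS_adj hr.le hw N s t s.2.1 hst (by
    rw [abs_sub_comm, abs_of_nonneg (by linarith)] at h; exact h)
  rw [ext0_coe] at h1 h2
  rw [abs_le] at h1 h2 h3 ⊢
  have : A * r ^ N * (1 + 2 / (1 - r)) = A * r ^ N + 2 * (A * r ^ N / (1 - r)) := by ring
  rw [this]
  constructor <;> linarith [h1.1, h1.2, h2.1, h2.2, h3.1, h3.2]

lemma KS_compact {r A : ℝ} (hr : 0 < r) (hr1 : r < 1) : IsCompact (KS r A) := by
  have hcl : IsClosed (KS r A) := by
    have he : ∀ x, Continuous fun w : CI => ext0 w x := fun x => by unfold ext0; fun_prop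
    have : KS r A = {w | |ext0 w 0| ≤ A} ∩ ⋂ (M : ℕ), ⋂ (j : ℕ), ⋂ (_ : j < 2 ^ M), {w : CI |
        |ext0 w (((j:ℝ) + 1) / 2 ^ M) - ext0 w ((j:ℝ) / 2 ^ M)| ≤ A * r ^ M} := by
      ext w; simp [KS]
    rw [this]
    refine (isClosed_le (he 0).abs continuous_const).inter (isClosed_iInter fun M => isClosed_iInter
      fun j => isClosed_iInter fun _ => isClosed_le ((he _).sub (he _)).abs continuous_const)
  set B := A + A * (1 + 2 / (1 - r)) with hB
  let e := BoundedContinuousFunction.mkOfCompact (α := I01) (β := ℝ)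
  let E := ContinuousMap.equivBoundedOfCompact I01 ℝ
  have hiso : Isometry E := (ContinuousMap.isometryEquivBoundedOfCompact I01 ℝ).isometry
  have hhom : IsClosed (E '' KS r A) :=
    (ContinuousMap.isometryEquivBoundedOfCompact I01 ℝ).toHomeomorph.isClosedMap _ hcl
  have hc : IsCompact (E '' KS r A) := by
    refine BoundedContinuousFunction.arzela_ascoli₂ (Set.Icc (-B) B) isCompact_Icc _ hhom ?_ ?_
    · rintro _ t ⟨w, hw, rfl⟩
      have h1 := KS_mod hr hr1 hw 0 t 0 (by simpa using abs_le.2 ⟨by linarith [t.2.1], t.2.2⟩)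
      have h2 := hw.1
      rw [show ext0 w 0 = w 0 from ext0_coe w 0] at h2
      rw [abs_le] at h1 h2
      simp only [pow_zero, mul_one] at h1
      change w t ∈ _
      constructor <;> linarith [h1.1, h1.2, h2.1, h2.2]
    · intro x₀
      rw [Metric.equicontinuousAt_iff_right]
      intro ε hε
      have hlim : Tendsto (fun N : ℕ => A * r ^ N * (1 + 2 / (1 - r))) atTop (𝓝 0) := by
        simpa using ((tendsto_pow_atTop_nhds_zero_of_lt_one hr.le hr1).const_mul A).mul_const
          (1 + 2 / (1 - r))
      obtain ⟨N, hN⟩ := (hlim.eventually (gt_mem_nhds hε)).exists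
      filter_upwards [Metric.ball_mem_nhds x₀ (show (0:ℝ) < (2 ^ N)⁻¹ by positivity)] with x hx
      rintro ⟨_, w, hw, rfl⟩
      change dist (w x₀) (w x) < ε
      rw [Real.dist_eq]
      refine lt_of_le_of_lt (KS_mod hr hr1 hw N x₀ x ?_) hN
      rw [Metric.mem_ball, dist_comm, Subtype.dist_eq, Real.dist_eq] at hx
      have : (0:ℝ) < 2 ^ N := by positivity
      calc _ ≤ (2 ^ N)⁻¹ * (2:ℝ) ^ N := by gcongr
        _ = 1 := by field_simp
  exact hiso.isEmbedding.isCompact_iff.2 hc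


section delta
set_option linter.unusedSectionVars false
variable {S : Type*} [TopologicalSpace S] [CompactSpace S] [Nonempty S]

/-- sup of `h + v` -/
def TT (h v : S → ℝ) : ℝ := sSup ((fun s => h s + v s) '' Set.univ)

lemma TT_le {h v : S → ℝ} {c : ℝ} (H : ∀ s, h s + v s ≤ c) : TT h v ≤ c := by
  apply csSup_le (Set.univ_nonempty.image _)
  rintro _ ⟨s, -, rfl⟩; exact H s

lemma le_TT {h v : S → ℝ} (hh : Continuous h) (hv : Continuous v) (s : S) : h s + v s ≤ TT h v :=
  le_csSup (isCompact_univ.image (hh.add hv)).bddAbove ⟨s, trivial, rfl⟩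

lemma le_TT0 {h : S → ℝ} (hh : Continuous h) (s : S) : h s ≤ TT h 0 := by
  have := le_TT hh (v := 0) continuous_zero s
  simpa using this

/-- argmax set -/
def EE (h : S → ℝ) : Set S := {s | h s = TT h 0}

lemma EE_compact {h : S → ℝ} (hh : Continuous h) : IsCompact (EE h) :=
  (isClosed_eq hh continuous_const).isCompact

lemma EE_nonempty {h : S → ℝ} (hh : Continuous h) : (EE h).Nonempty := by
  obtain ⟨s, -, hs⟩ := isCompact_univ.exists_isMaxOn Set.univ_nonempty hh.continuousOn
  refine ⟨s, le_antisymm ?_ (TT_le fun t => by simpa using hs (Set.mem_univ t))⟩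
  exact le_TT0 hh s

/-- directional derivative -/
def PhiE (h v : S → ℝ) : ℝ := sSup (v '' EE h)

lemma le_PhiE {h v : S → ℝ} (hh : Continuous h) (hv : Continuous v) {s : S} (hs : s ∈ EE h) :
    v s ≤ PhiE h v := le_csSup ((EE_compact hh).image hv).bddAbove ⟨s, hs, rfl⟩

/-- difference quotient -/
def DD (h : S → ℝ) (a : ℝ) (v : S → ℝ) : ℝ := a * (TT h (fun s => v s / a) - TT h 0)

lemma Phi_le_DD {h v : S → ℝ} (hh : Continuous h) (hv : Continuous v) {a : ℝ} (ha : 0 < a) :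
    PhiE h v ≤ DD h a v := by
  apply csSup_le ((EE_nonempty hh).image _)
  rintro _ ⟨s, hs, rfl⟩
  have h1 := le_TT hh (hv.div_const a) s
  have h2 : h s = TT h 0 := hs
  unfold DD
  calc v s = a * (v s / a) := by field_simp
    _ ≤ _ := by gcongr; linarith

lemma DD_anti {h v : S → ℝ} (hh : Continuous h) (hv : Continuous v) {a A : ℝ} (hA : 0 < A)
    (hAa : A ≤ a) : DD h a v ≤ DD h A v := by
  have ha : 0 < a := hA.trans_le hAa
  have : TT h (fun s => v s / a) ≤ (1 - A / a) * TT h 0 + A / a * TT h (fun s => v s / A) := by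
    apply TT_le
    intro s
    have h1 := le_TT hh (hv.div_const A) s
    have h3 := le_TT0 hh s
    have h4 : A / a ≤ 1 := by rw [div_le_one ha]; exact hAa
    have h5 : 0 ≤ A / a := by positivity
    calc h s + v s / a = (1 - A / a) * h s + A / a * (h s + v s / A) := by field_simp; ring
      _ ≤ _ := by gcongr
  unfold DD
  calc a * (TT h (fun s => v s / a) - TT h 0) ≤
     a * ((1 - A / a) * TT h 0 + A / a * TT h (fun s => v s / A) - TT h 0) := by gcongr
    _ = _ := by field_simp; ring

lemma DD_tendsto {h v : S → ℝ} (hh : Continuous h) (hv : Continuous v) :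
    Tendsto (fun a => DD h a v) atTop (𝓝 (PhiE h v)) := by
  rw [tendsto_order]
  constructor
  · intro b hb
    filter_upwards [eventually_gt_atTop 0] with a ha
    exact hb.trans_le (Phi_le_DD hh hv ha)
  · intro b hb
    obtain ⟨c, hc1, hc2⟩ := exists_between hb
    have hT : ∀ s, h s ≤ TT h 0 := fun s => le_TT0 hh s
    suffices H : ∀ᶠ a in atTop, ∀ s, a * (h s - TT h 0) + v s ≤ c by
      filter_upwards [H, eventually_gt_atTop 0] with a ha ha0
      refine lt_of_le_of_lt ?_ hc2
      unfold DD
      have : TT h (fun s => v s / a) ≤ TT h 0 + c / a := by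
        apply TT_le
        intro s
        have := ha s
        have h2 : (a * (h s - TT h 0) + v s) / a ≤ c / a := by gcongr
        have h3 : (a * (h s - TT h 0) + v s) / a = h s - TT h 0 + v s / a := by field_simp
        linarith
      calc _ ≤ a * (TT h 0 + c / a - TT h 0) := by gcongr
        _ = c := by field_simp; ring
    have hB : IsCompact {s | c ≤ v s} := (isClosed_le continuous_const hv).isCompact
    rcases Set.eq_empty_or_nonempty {s | c ≤ v s} with hBe | hBn
    · filter_upwards [eventually_gt_atTop 0] with a ha s
      have : v s < c := by
        by_contra hcon; push Not at hcon
        exact Set.eq_empty_iff_forall_notMem.1 hBe s hcon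
      nlinarith [hT s]
    · obtain ⟨s0, hs0, hmax⟩ := hB.exists_isMaxOn hBn hh.continuousOn
      obtain ⟨s1, hs1, hmax1⟩ := hB.exists_isMaxOn hBn hv.continuousOn
      have hlt : h s0 - TT h 0 < 0 := by
        rcases (hT s0).lt_or_eq with h1 | h1
        · linarith
        · have := le_PhiE hh hv (s := s0) h1
          have h2 : c ≤ v s0 := hs0
          linarith
      have hl : Tendsto (fun a : ℝ => a * (h s0 - TT h 0) + v s1) atTop atBot :=
        tendsto_atBot_add_const_right _ _ (tendsto_id.atTop_mul_const_of_neg hlt)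
      filter_upwards [hl.eventually_le_atBot c, eventually_gt_atTop 0] with a ha ha0 s
      by_cases hs : c ≤ v s
      · have h1 : h s ≤ h s0 := hmax hs
        have h2 : v s ≤ v s1 := hmax1 hs
        refine le_trans ?_ ha
        gcongr
      · push Not at hs
        nlinarith [hT s]
end delta

/-- signed double of `w` -/
def JJ (w : CI) : I01 ⊕ I01 → ℝ := Sum.elim (fun t => - w t) (fun t => w t)
/-- band functions -/
def hh0 (θ κl κu : I01 → ℝ) : I01 ⊕ I01 → ℝ := Sum.elim (fun t => - θ t + κl t) (fun t => θ t - κu t)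

lemma JJ_cont (w : CI) : Continuous (JJ w) := by
  unfold JJ; exact Continuous.sumElim (by fun_prop) (by fun_prop)

lemma hh0_cont {θ κl κu : I01 → ℝ} (hθ : Continuous θ) (hκl : Continuous κl) (hκu : Continuous κu) :
    Continuous (hh0 θ κl κu) := by
  unfold hh0; exact Continuous.sumElim (by fun_prop) (by fun_prop)

lemma Tmax_eq {θ κl κu : I01 → ℝ} (hθ : Continuous θ) (hκl : Continuous κl) (hκu : Continuous κu)
    (w : CI) (a : ℝ) :
    Tmax (fun t => θ t + w t / a) κl κu = TT (hh0 θ κl κu) (fun s => JJ w s / a) := by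
  unfold Tmax TT
  have c1 : Continuous (fun t : I01 => -(θ t + w t / a) + κl t) := by fun_prop
  have c2 : Continuous (fun t : I01 => (θ t + w t / a) - κu t) := by fun_prop
  rw [iSup, iSup, ← csSup_union (isCompact_range c1).bddAbove (Set.range_nonempty _)
    (isCompact_range c2).bddAbove (Set.range_nonempty _)]
  congr 1
  ext x
  simp [hh0, JJ]
  apply or_congr
  · refine exists_congr fun y => exists_congr fun h => ?_
    ring_nf
  · refine exists_congr fun y => exists_congr fun h => ?_
    ring_nf

lemma Tmax_eq0 {θ κl κu : I01 → ℝ} (hθ : Continuous θ) (hκl : Continuous κl) (hκu : Continuous κu) :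
    Tmax θ κl κu = TT (hh0 θ κl κu) 0 := by
  have := Tmax_eq hθ hκl hκu 0 1
  simp only [ContinuousMap.zero_apply, zero_div, add_zero] at this
  rw [this]
  congr 1; ext s; cases s <;> simp [JJ]

lemma Phi_eq {θ κl κu : I01 → ℝ} (hθ : Continuous θ) (hκl : Continuous κl) (hκu : Continuous κu)
    (w : CI) : sSup
            ((fun t => -(w t)) '' {t : I01 | -θ t + κl t = Tmax θ κl κu} ∪
             (fun t => w t) '' {t : I01 | θ t - κu t = Tmax θ κl κu}) =
      PhiE (hh0 θ κl κu) (JJ w) := by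
  unfold PhiE EE
  rw [← Tmax_eq0 hθ hκl hκu]
  congr 1
  ext x
  simp [hh0, JJ]

lemma JJ_unc : Continuous (fun p : CI × (I01 ⊕ I01) => JJ p.1 p.2) := by
  have e : (fun p : CI × (I01 ⊕ I01) => JJ p.1 p.2) =
     (Sum.elim (fun q : CI × I01 => - q.1 q.2) (fun q : CI × I01 => q.1 q.2)) ∘
      (Homeomorph.prodSumDistrib (X := CI) (Y := I01) (Z := I01)) := by
    ext ⟨w, s⟩; cases s <;> rfl
  rw [e]
  exact Continuous.comp (Continuous.sumElim (by fun_prop) (by fun_prop)) (Homeomorph.continuous _)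

lemma Phi_cont {h : I01 ⊕ I01 → ℝ} (hh : Continuous h) : Continuous fun w : CI => PhiE h (JJ w) :=
  IsCompact.continuous_sSup (EE_compact hh) (f := fun w s => JJ w s) JJ_unc

lemma DD_cont {h : I01 ⊕ I01 → ℝ} (hh : Continuous h) (a : ℝ) :
    Continuous fun w : CI => DD h a (JJ w) := by
  unfold DD TT
  refine continuous_const.mul (Continuous.sub ?_ continuous_const)
  refine IsCompact.continuous_sSup isCompact_univ (f := fun w s => h s + JJ w s / a) ?_
  exact (hh.comp continuous_snd).add (JJ_unc.div_const a)


section fourth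
set_option linter.unusedSectionVars false
variable {Ω : Type*} [MeasurableSpace Ω] {P : Measure Ω} [IsProbabilityMeasure P]

lemma Iadd {f g : Ω → ℝ} (hf : Integrable f P) (hg : Integrable g P) :
    Integrable (fun ω => f ω + g ω) P := hf.add hg

lemma Isub {f g : Ω → ℝ} (hf : Integrable f P) (hg : Integrable g P) :
    Integrable (fun ω => f ω - g ω) P := hf.sub hg

lemma int_pow_of_four {Y : Ω → ℝ} (hY : Measurable Y) (h4 : Integrable (fun ω => Y ω ^ 4) P)
    (k : ℕ) (hk : k ≤ 4) : Integrable (fun ω => Y ω ^ k) P := by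
  refine Integrable.mono' (h4.add (integrable_const 1)) (by fun_prop) (ae_of_all _ fun ω => ?_)
  simp only [Real.norm_eq_abs, abs_pow, Pi.add_apply]
  have e : Y ω ^ 4 = |Y ω| ^ 4 := by rw [← abs_pow, abs_of_nonneg (by positivity)]
  rw [e]
  rcases le_total |Y ω| 1 with h | h
  · have := pow_le_one₀ (n := k) (abs_nonneg _) h
    have : 0 ≤ |Y ω| ^ 4 := by positivity
    linarith
  · have := pow_le_pow_right₀ h hk
    linarith

lemma sq_le_four {Y : Ω → ℝ} (hY : Measurable Y) (h4 : Integrable (fun ω => Y ω ^ 4) P) :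
    (∫ ω, Y ω ^ 2 ∂P) ^ 2 ≤ ∫ ω, Y ω ^ 4 ∂P := by
  set v := ∫ ω, Y ω ^ 2 ∂P
  have h2 := int_pow_of_four hY h4 2 (by norm_num)
  have : 0 ≤ ∫ ω, (Y ω ^ 2 - v) ^ 2 ∂P := integral_nonneg fun ω => by positivity
  have e : ∀ ω, (Y ω ^ 2 - v) ^ 2 = Y ω ^ 4 - 2 * v * Y ω ^ 2 + v ^ 2 := fun ω => by ring
  simp_rw [e] at this
  rw [integral_add (Isub h4 (h2.const_mul _)) (integrable_const _), integral_sub h4 (h2.const_mul _),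
    integral_const_mul] at this
  simp at this
  change 0 ≤ _ - 2 * v * v + v ^ 2 at this
  nlinarith

lemma mean_pow_four_le {Y : Ω → ℝ} (hY : Measurable Y) (h4 : Integrable (fun ω => Y ω ^ 4) P) :
    (∫ ω, Y ω ∂P) ^ 4 ≤ ∫ ω, Y ω ^ 4 ∂P := by
  set v := ∫ ω, Y ω ∂P
  have h2 := int_pow_of_four hY h4 2 (by norm_num)
  have h1 : Integrable Y P := by simpa using int_pow_of_four hY h4 1 (by norm_num)
  have : 0 ≤ ∫ ω, (Y ω - v) ^ 2 ∂P := integral_nonneg fun ω => by positivity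
  have e : ∀ ω, (Y ω - v) ^ 2 = Y ω ^ 2 - 2 * v * Y ω + v ^ 2 := fun ω => by ring
  simp_rw [e] at this
  rw [integral_add (Isub h2 (h1.const_mul _)) (integrable_const _), integral_sub h2 (h1.const_mul _),
    integral_const_mul] at this
  simp at this
  change 0 ≤ _ - 2 * v * v + v ^ 2 at this
  have h3 := sq_le_four hY h4
  calc v ^ 4 = (v ^ 2) ^ 2 := by ring
    _ ≤ (∫ ω, Y ω ^ 2 ∂P) ^ 2 := by
      apply pow_le_pow_left₀ (by positivity); linarith
    _ ≤ _ := h3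

lemma sub_pow_four_le (a b : ℝ) : (a - b) ^ 4 ≤ 8 * (a ^ 4 + b ^ 4) := by
  nlinarith [sq_nonneg (a - b), sq_nonneg (a + b), sq_nonneg (a^2-b^2), mul_nonneg (sq_nonneg (a - b)) (sq_nonneg (a + b)), sq_nonneg ((a+b)^2), sq_nonneg (a*b), mul_nonneg (sq_nonneg (a + b)) (add_nonneg (sq_nonneg a) (sq_nonneg b))]

lemma cent_four {Y : Ω → ℝ} (hY : Measurable Y) (h4 : Integrable (fun ω => Y ω ^ 4) P) :
    Integrable (fun ω => (Y ω - ∫ ω, Y ω ∂P) ^ 4) P ∧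
    ∫ ω, (Y ω - ∫ ω, Y ω ∂P) ^ 4 ∂P ≤ 16 * ∫ ω, Y ω ^ 4 ∂P := by
  set v := ∫ ω, Y ω ∂P with hv
  have hi : Integrable (fun ω => 8 * (Y ω ^ 4 + v ^ 4)) P := (h4.add (integrable_const _)).const_mul _
  have h1 : Integrable (fun ω => (Y ω - v) ^ 4) P := by
    refine Integrable.mono' hi (by fun_prop) (ae_of_all _ fun ω => ?_)
    rw [Real.norm_eq_abs, abs_of_nonneg (by positivity)]
    exact sub_pow_four_le _ _
  refine ⟨h1, (integral_mono h1 hi fun ω => sub_pow_four_le _ _).trans ?_⟩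
  rw [integral_const_mul, integral_add h4 (integrable_const _)]
  simp
  have := mean_pow_four_le hY h4
  rw [← hv] at this
  linarith

lemma sum_four {Y : ℕ → Ω → ℝ} (hY : ∀ j, Measurable (Y j)) (hind : iIndepFun Y P)
    {B : ℝ} (h4 : ∀ j, Integrable (fun ω => Y j ω ^ 4) P) (h0 : ∀ j, ∫ ω, Y j ω ∂P = 0)
    (hB : ∀ j, ∫ ω, Y j ω ^ 4 ∂P ≤ B) (m : ℕ) :
    Integrable (fun ω => (∑ j ∈ Finset.range m, Y j ω) ^ 4) P ∧
    ∫ ω, (∑ j ∈ Finset.range m, Y j ω) ∂P = 0 ∧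
    ∫ ω, (∑ j ∈ Finset.range m, Y j ω) ^ 2 ∂P ≤ m * √B ∧
    ∫ ω, (∑ j ∈ Finset.range m, Y j ω) ^ 4 ∂P ≤ 3 * m ^ 2 * B := by
  have hB0 : 0 ≤ B := le_trans (integral_nonneg fun ω => by positivity) (hB 0)
  have hv : ∀ j, ∫ ω, Y j ω ^ 2 ∂P ≤ √B := fun j =>
    Real.le_sqrt_of_sq_le ((sq_le_four (hY j) (h4 j)).trans (hB j))
  induction m with
  | zero => simp
  | succ m ih =>
    obtain ⟨i4, i0, i2, ib⟩ := ih
    set S : Ω → ℝ := fun ω => ∑ j ∈ Finset.range m, Y j ω with hS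
    have hSm : Measurable S := by fun_prop
    have hi : IndepFun S (Y m) P := by
      have := hind.indepFun_finsetSum_of_notMem hY (s := Finset.range m) (i := m) (by simp)
      convert this using 1
      ext ω; simp [hS]
    have hip : ∀ a b : ℕ, IndepFun (fun ω => S ω ^ a) (fun ω => Y m ω ^ b) P := fun a b =>
      hi.comp (φ := fun x => x ^ a) (ψ := fun x => x ^ b) (by fun_prop) (by fun_prop)
    have hSk := fun k hk => int_pow_of_four hSm i4 k hk
    have hYk := fun k hk => int_pow_of_four (hY m) (h4 m) k hk
    have hint : ∀ a b : ℕ, a ≤ 4 → b ≤ 4 → Integrable (fun ω => S ω ^ a * Y m ω ^ b) P :=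
      fun a b ha hb => (hip a b).integrable_mul (hSk a ha) (hYk b hb)
    have hprod : ∀ a b : ℕ, ∫ ω, S ω ^ a * Y m ω ^ b ∂P = (∫ ω, S ω ^ a ∂P) * ∫ ω, Y m ω ^ b ∂P :=
      fun a b => (hip a b).integral_fun_mul_eq_mul_integral (by fun_prop) (by fun_prop)
    have e4 : ∀ ω, (∑ j ∈ Finset.range (m+1), Y j ω) ^ 4 = S ω ^ 4 + 4 * (S ω ^ 3 * Y m ω ^ 1)
      + 6 * (S ω ^ 2 * Y m ω ^ 2) + 4 * (S ω ^ 1 * Y m ω ^ 3) + Y m ω ^ 4 := fun ω => by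
      rw [Finset.sum_range_succ]; simp only [hS]; ring
    have e2 : ∀ ω, (∑ j ∈ Finset.range (m+1), Y j ω) ^ 2 = S ω ^ 2 + 2 * (S ω ^ 1 * Y m ω ^ 1)
      + Y m ω ^ 2 := fun ω => by
      rw [Finset.sum_range_succ]; simp only [hS]; ring
    have j1 : Integrable (fun ω => S ω ^ 4) P := i4
    have j2 := (hint 3 1 (by norm_num) (by norm_num)).const_mul 4
    have j3 := (hint 2 2 (by norm_num) (by norm_num)).const_mul 6
    have j4 := (hint 1 3 (by norm_num) (by norm_num)).const_mul 4
    have j5 := h4 m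
    have k2 := (hint 1 1 (by norm_num) (by norm_num)).const_mul 2
    have v0 := h0 m
    simp_rw [e4, e2]
    refine ⟨(((j1.add j2).add j3).add j4).add j5, ?_, ?_, ?_⟩
    · simp_rw [Finset.sum_range_succ]
      rw [integral_add (by simpa using hSk 1 (by norm_num)) (by simpa using hYk 1 (by norm_num))]
      rw [v0]; simpa using i0
    · rw [integral_add (Iadd (hSk 2 (by norm_num)) k2) (hYk 2 (by norm_num)),
        integral_add (hSk 2 (by norm_num)) k2, integral_const_mul, hprod]
      have := hv m
      simp only [pow_one, v0]
      push_cast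
      linarith
    · rw [integral_add (Iadd (Iadd (Iadd j1 j2) j3) j4) j5, integral_add (Iadd (Iadd j1 j2) j3) j4,
        integral_add (Iadd j1 j2) j3, integral_add j1 j2]
      simp only [integral_const_mul, hprod]
      simp only [pow_one, v0]
      have i0' : ∫ ω, S ω ∂P = 0 := i0
      rw [i0']
      have a1 : (∫ ω, S ω ^ 2 ∂P) * ∫ ω, Y m ω ^ 2 ∂P ≤ (m * √B) * √B := by
        apply mul_le_mul i2 (hv m) (integral_nonneg fun ω => by positivity) (by positivity)
      have a2 : (m * √B) * √B = m * B := by rw [mul_assoc, Real.mul_self_sqrt hB0]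
      have a3 := hB m
      push_cast
      nlinarith
end fourth


section clt
set_option linter.unusedSectionVars false
variable {Ω : Type*} [MeasurableSpace Ω] {P : Measure Ω} [IsProbabilityMeasure P]

lemma clt_half {Y : ℕ → Ω → ℝ} (hL : MemLp (Y 0) 2 P) (hind : iIndepFun Y P)
    (hid : ∀ i, IdentDistrib (Y i) (Y 0) P P) {m : ℕ → ℕ} (hm : Tendsto m atTop atTop)
    {a : ℕ → ℝ} {α : ℝ} (ha : Tendsto a atTop (𝓝 α)) :
    Tendsto (fun k => charFun (P.map (fun ω =>
      ((√(m k))⁻¹ * (∑ j ∈ Finset.range (m k), Y j ω - m k * ∫ ω, Y 0 ω ∂P)) * a k)) 1) atTop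
      (𝓝 (Complex.exp (-((α ^ 2 * Var[Y 0; P] : ℝ) : ℂ) / 2))) := by
  have h1 := tendstoInDistribution_inv_sqrt_mul_sum_sub (P := P) (X := Y)
    (Y := (id : ℝ → ℝ)) (P' := gaussianReal 0 Var[Y 0; P].toNNReal)
    ⟨aemeasurable_id, Measure.map_id⟩ hL hind hid
  have h2 : TendstoInDistribution (fun k ω => (√(m k))⁻¹ *
      (∑ j ∈ Finset.range (m k), Y j ω - m k * ∫ ω, Y 0 ω ∂P)) atTop (id : ℝ → ℝ) (fun _ => P)
      (gaussianReal 0 Var[Y 0; P].toNNReal) :=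
    ⟨fun k => h1.forall_aemeasurable (m k), h1.aemeasurable_limit, h1.tendsto.comp hm⟩
  have h3 : TendstoInMeasure P (fun k (_ : Ω) => a k) atTop (fun _ => α) :=
    tendstoInMeasure_of_tendsto_ae (fun _ => aestronglyMeasurable_const) (ae_of_all _ fun _ => ha)
  have h4 := h2.continuous_comp_prodMk_of_tendstoInMeasure_const
    (g := fun p : ℝ × ℝ => p.1 * p.2) (by fun_prop) h3 (fun _ => aemeasurable_const)
  have h5 := ProbabilityMeasure.tendsto_iff_tendsto_charFun.1 h4.tendsto 1
  have this : (gaussianReal 0 Var[Y 0; P].toNNReal).map (fun ω : ℝ => id ω * α) =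
      gaussianReal (α * 0) (NNReal.mk (α ^ 2) (sq_nonneg α) * Var[Y 0; P].toNNReal) := by
    simpa using gaussianReal_map_mul_const (μ := 0) (v := Var[Y 0; P].toNNReal) α
  have e : charFun ((gaussianReal 0 Var[Y 0; P].toNNReal).map (fun ω : ℝ => id ω * α)) 1 =
      Complex.exp (-((α ^ 2 * Var[Y 0; P] : ℝ) : ℂ) / 2) := by
    rw [this, charFun_gaussianReal]
    have hv := variance_nonneg (Y 0) P
    simp [Real.coe_toNNReal _ hv]
    ring_nf
  rw [← e]
  exact h5

lemma indep_halves {Y1 Y2 : ℕ → Ω → ℝ} (h1 : ∀ j, Measurable (Y1 j)) (h2 : ∀ j, Measurable (Y2 j))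
    (hind : iIndepFun (Sum.elim Y1 Y2) P) (m n : ℕ) (φ ψ : ℝ → ℝ) (hφ : Measurable φ)
    (hψ : Measurable ψ) :
    IndepFun (fun ω => φ (∑ j ∈ Finset.range m, Y1 j ω)) (fun ω => ψ (∑ j ∈ Finset.range n, Y2 j ω)) P := by
  have := hind.indepFun_finset ((Finset.range m).map ⟨Sum.inl, Sum.inl_injective⟩)
    ((Finset.range n).map ⟨Sum.inr, Sum.inr_injective⟩) (by
      rw [Finset.disjoint_left]; simp) (by rintro (j | j) <;> simp [h1, h2])
  have h3 := this.comp (φ := fun x => φ (∑ i, x i)) (ψ := fun x => ψ (∑ i, x i)) (by fun_prop) (by fun_prop)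
  convert h3 using 1
  · ext ω
    simp only [Function.comp]
    rw [Finset.sum_coe_sort ((Finset.range m).map ⟨Sum.inl, Sum.inl_injective⟩)
      (fun i => Sum.elim Y1 Y2 i ω)]
    simp
  · ext ω
    simp only [Function.comp]
    rw [Finset.sum_coe_sort ((Finset.range n).map ⟨Sum.inr, Sum.inr_injective⟩)
      (fun i => Sum.elim Y1 Y2 i ω)]
    simp

lemma clt_two {Y1 Y2 : ℕ → Ω → ℝ} (h1 : ∀ j, Measurable (Y1 j)) (h2 : ∀ j, Measurable (Y2 j))
    (hind : iIndepFun (Sum.elim Y1 Y2) P) (hL1 : MemLp (Y1 0) 2 P) (hL2 : MemLp (Y2 0) 2 P)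
    (hid1 : ∀ i, IdentDistrib (Y1 i) (Y1 0) P P) (hid2 : ∀ i, IdentDistrib (Y2 i) (Y2 0) P P)
    {m n : ℕ → ℕ} (hm : Tendsto m atTop atTop) (hn : Tendsto n atTop atTop)
    {τ : ℝ} (hτ : τ ∈ Set.Ioo (0:ℝ) 1)
    (hratio : Tendsto (fun k => (m k : ℝ) / ((m k : ℝ) + (n k : ℝ))) atTop (𝓝 τ)) :
    Tendsto (fun k => charFun (P.map (fun ω => √((m k : ℝ) + n k) *
      ((m k : ℝ)⁻¹ * ∑ j ∈ Finset.range (m k), Y1 j ω - (n k : ℝ)⁻¹ * ∑ j ∈ Finset.range (n k), Y2 j ω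
        - (∫ ω, Y1 0 ω ∂P - ∫ ω, Y2 0 ω ∂P)))) 1) atTop
      (𝓝 (Complex.exp (-((τ⁻¹ * Var[Y1 0; P] + (1 - τ)⁻¹ * Var[Y2 0; P] : ℝ) : ℂ) / 2))) := by
  have hi1 : iIndepFun Y1 P := hind.precomp (g := Sum.inl) Sum.inl_injective
  have hi2 : iIndepFun Y2 P := hind.precomp (g := Sum.inr) Sum.inr_injective
  have hm0 : ∀ᶠ k in atTop, 0 < m k := hm.eventually_gt_atTop 0
  have hn0 : ∀ᶠ k in atTop, 0 < n k := hn.eventually_gt_atTop 0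
  have hτ0 := hτ.1
  have hτ1 : 0 < 1 - τ := by linarith [hτ.2]
  have ha : Tendsto (fun k => √(((m k : ℝ) / ((m k : ℝ) + (n k : ℝ)))⁻¹)) atTop (𝓝 √(τ⁻¹)) :=
    (Real.continuous_sqrt.tendsto _).comp (hratio.inv₀ hτ0.ne')
  have hratio2 : Tendsto (fun k => (n k : ℝ) / ((m k : ℝ) + (n k : ℝ))) atTop (𝓝 (1 - τ)) := by
    refine (hratio.const_sub 1).congr' ?_
    filter_upwards [hm0] with k hk
    have : (0:ℝ) < m k := by exact_mod_cast hk
    field_simp; ring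
  have hb : Tendsto (fun k => - √(((n k : ℝ) / ((m k : ℝ) + (n k : ℝ)))⁻¹)) atTop (𝓝 (-√((1-τ)⁻¹))) :=
    ((Real.continuous_sqrt.tendsto _).comp (hratio2.inv₀ hτ1.ne')).neg
  have c1 := clt_half hL1 hi1 hid1 hm ha
  have c2 := clt_half hL2 hi2 hid2 hn hb
  have c := c1.mul c2
  rw [← Complex.exp_add] at c
  convert c.congr' ?_ using 2
  · rw [neg_sq, Real.sq_sqrt (by positivity), Real.sq_sqrt (by positivity)]
    push_cast; ring_nf
  · filter_upwards [hm0, hn0] with k hmk hnk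
    rw [← Pi.mul_apply, ← IndepFun.charFun_map_fun_add_eq_mul (by fun_prop) (by fun_prop)
      (indep_halves h1 h2 hind (m k) (n k) (fun x => (√(m k))⁻¹ * (x - m k * ∫ ω, Y1 0 ω ∂P) *
        √(((m k : ℝ) / ((m k : ℝ) + (n k : ℝ)))⁻¹)) (fun x => (√(n k))⁻¹ * (x - n k * ∫ ω, Y2 0 ω ∂P) *
        - √(((n k : ℝ) / ((m k : ℝ) + (n k : ℝ)))⁻¹)) (by fun_prop) (by fun_prop))]
    congr 3
    ext ω
    have p1 : (0:ℝ) < m k := by exact_mod_cast hmk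
    have p2 : (0:ℝ) < n k := by exact_mod_cast hnk
    have q1 : (√(m k : ℝ))⁻¹ * √(((m k : ℝ) / ((m k : ℝ) + (n k : ℝ)))⁻¹) =
        √((m k : ℝ) + n k) * (m k : ℝ)⁻¹ := by
      rw [inv_div, Real.sqrt_div (by positivity)]
      have := Real.mul_self_sqrt p1.le
      have s1 : 0 < √(m k : ℝ) := Real.sqrt_pos.2 p1
      field_simp
      rw [pow_two, this]
    have q2 : (√(n k : ℝ))⁻¹ * √(((n k : ℝ) / ((m k : ℝ) + (n k : ℝ)))⁻¹) =
        √((m k : ℝ) + n k) * (n k : ℝ)⁻¹ := by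
      rw [inv_div, Real.sqrt_div (by positivity)]
      have := Real.mul_self_sqrt p2.le
      have s1 : 0 < √(n k : ℝ) := Real.sqrt_pos.2 p2
      field_simp
      rw [pow_two, this]
    set s1 := ∑ j ∈ Finset.range (m k), Y1 j ω
    set s2 := ∑ j ∈ Finset.range (n k), Y2 j ω
    set e1 := ∫ ω, Y1 0 ω ∂P
    set e2 := ∫ ω, Y2 0 ω ∂P
    have r1 : (m k : ℝ)⁻¹ * m k = 1 := inv_mul_cancel₀ p1.ne'
    have r2 : (n k : ℝ)⁻¹ * n k = 1 := inv_mul_cancel₀ p2.ne'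
    linear_combination (s1 - m k * e1) * q1 - (s2 - n k * e2) * q2 - √((m k : ℝ) + n k) * e1 * r1
      + √((m k : ℝ) + n k) * e2 * r2
end clt


section weak
set_option linter.unusedSectionVars false
variable [MeasurableSpace CI] [BorelSpace CI]

lemma weak_lim (μ : ℕ → ProbabilityMeasure CI)
    (ht : IsTightMeasureSet {((μ n : ProbabilityMeasure CI) : Measure CI) | n})
    (φ : StrongDual ℝ CI → ℂ)
    (h : ∀ L, Tendsto (fun k => charFunDual (μ k : Measure CI) L) atTop (𝓝 (φ L))) :
    ∃ μ₀ : ProbabilityMeasure CI, (∀ L, charFunDual (μ₀ : Measure CI) L = φ L) ∧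
      Tendsto μ atTop (𝓝 μ₀) := by
  have hc : IsCompact (closure {μ n | n}) :=
    isCompact_closure_of_isTightMeasureSet (by simpa using ht)
  have key : ∀ U : Ultrafilter ℕ, (U : Filter ℕ) ≤ atTop → ∃ μ₀ : ProbabilityMeasure CI,
      (∀ L, charFunDual (μ₀ : Measure CI) L = φ L) ∧ Tendsto μ U (𝓝 μ₀) := by
    intro U hU
    obtain ⟨μ', -, hμ' : Tendsto _ _ _⟩ := hc.ultrafilter_le_nhds (U.map μ)
      (.trans (by simp) (monotone_principal subset_closure))
    refine ⟨μ', fun L => ?_, hμ'⟩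
    have h2 := (ProbabilityMeasure.tendsto_iff_forall_integral_rclike_tendsto ℂ).1 hμ'
      (BoundedContinuousFunction.probCharDual L)
    exact tendsto_nhds_unique h2 ((h L).mono_left hU)
  obtain ⟨μ₀, h1, -⟩ := key (Ultrafilter.of atTop) (Ultrafilter.of_le _)
  refine ⟨μ₀, h1, ?_⟩
  rw [tendsto_iff_ultrafilter]
  intro U hU
  obtain ⟨μ₁, h2, h3⟩ := key U hU
  have : μ₁ = μ₀ := by
    apply Subtype.ext
    have i0 : IsProbabilityMeasure (μ₀ : Measure CI) := μ₀.2
    have i1 : IsProbabilityMeasure (μ₁ : Measure CI) := μ₁.2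
    change (μ₁ : Measure CI) = (μ₀ : Measure CI)
    apply Measure.ext_of_charFunDual
    ext L
    exact (h2 L).trans (h1 L).symm
  rwa [← this]

variable {Ω : Type*} [MeasurableSpace Ω] {P : Measure Ω} [IsProbabilityMeasure P]

/-- truncated gap -/
def GA (h : I01 ⊕ I01 → ℝ) (ε A : ℝ) (w : CI) : ℝ :=
  max 0 (min 1 (ε⁻¹ * (DD h A (JJ w) - PhiE h (JJ w))))

lemma GA_cont {h : I01 ⊕ I01 → ℝ} (hh : Continuous h) (ε A : ℝ) : Continuous (GA h ε A) :=
  continuous_const.max (continuous_const.min (continuous_const.mul ((DD_cont hh A).sub (Phi_cont hh))))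

lemma GA_bd (h : I01 ⊕ I01 → ℝ) (ε A : ℝ) (w : CI) : ‖GA h ε A w‖ ≤ 1 := by
  unfold GA
  rw [Real.norm_eq_abs, abs_of_nonneg (le_max_left _ _)]
  exact max_le zero_le_one (min_le_left _ _)

lemma delta {W : ℕ → Ω → CI} {μ₀ : Measure CI} [IsProbabilityMeasure μ₀]
    (hWm : ∀ k, Measurable (W k))
    (hW : TendstoInDistribution W atTop id (fun _ => P) μ₀)
    {h : I01 ⊕ I01 → ℝ} (hh : Continuous h) {a : ℕ → ℝ} (ha : Tendsto a atTop atTop) :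
    TendstoInDistribution (fun k ω => DD h (a k) (JJ (W k ω))) atTop (fun w => PhiE h (JJ w))
      (fun _ => P) μ₀ := by
  have h1 := hW.continuous_comp (Phi_cont hh)
  refine tendstoInDistribution_of_tendstoInMeasure_sub _ _ h1 ?_
    (fun k => ((DD_cont hh (a k)).measurable.comp (hWm k)).aemeasurable)
  rw [tendstoInMeasure_iff_norm]
  intro ε hε
  -- the integral goes to zero
  have hlim : Tendsto (fun A : ℝ => ∫ w, GA h ε A w ∂μ₀) atTop (𝓝 (∫ w, (0:ℝ) ∂μ₀)) := by
    refine tendsto_integral_filter_of_dominated_convergence (fun _ => 1)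
      (Eventually.of_forall fun A => (GA_cont hh ε A).aestronglyMeasurable)
      (Eventually.of_forall fun A => ae_of_all _ fun w => GA_bd h ε A w)
      (integrable_const _) (ae_of_all _ fun w => ?_)
    have := (((DD_tendsto hh (JJ_cont w)).sub_const (PhiE h (JJ w))).const_mul ε⁻¹)
    have := (tendsto_const_nhds (x := (0:ℝ))).max ((tendsto_const_nhds (x := (1:ℝ))).min this)
    simpa [GA] using this
  simp only [integral_zero] at hlim
  rw [ENNReal.tendsto_nhds_zero]
  intro δ hδ
  obtain ⟨d, hd0, hdδ⟩ : ∃ d : ℝ, 0 < d ∧ ENNReal.ofReal d ≤ δ := by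
    rcases eq_or_ne δ ⊤ with rfl | ht
    · exact ⟨1, one_pos, le_top⟩
    · exact ⟨δ.toReal, ENNReal.toReal_pos hδ.ne' ht, ENNReal.ofReal_toReal_le⟩
  obtain ⟨A, hA0, hA⟩ := ((eventually_gt_atTop (0:ℝ)).and (hlim.eventually_lt_const hd0)).exists
  let G : BoundedContinuousFunction CI ℝ :=
    BoundedContinuousFunction.ofNormedAddCommGroup (GA h ε A) (GA_cont hh ε A) 1 (GA_bd h ε A)
  have h2 := (ProbabilityMeasure.tendsto_iff_forall_integral_tendsto.1 hW.tendsto) G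
  have h3 : Tendsto (fun k => ∫ ω, GA h ε A (W k ω) ∂P) atTop (𝓝 (∫ w, GA h ε A w ∂μ₀)) := by
    convert h2 using 2
    · simp only [ProbabilityMeasure.coe_mk]
      rw [integral_map (hWm _).aemeasurable (G.continuous.aestronglyMeasurable)]
      rfl
    · simp only [ProbabilityMeasure.coe_mk, Measure.map_id]
      rfl
  filter_upwards [h3.eventually_lt_const hA, ha.eventually_ge_atTop A] with k hk hak
  refine le_trans ?_ hdδ
  have hint : Integrable (fun ω => GA h ε A (W k ω)) P :=
    Integrable.mono' (integrable_const 1) ((GA_cont hh ε A).measurable.comp (hWm k)).aestronglyMeasurable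
      (ae_of_all _ fun ω => GA_bd h ε A _)
  have hmk := mul_meas_ge_le_integral_of_nonneg (ae_of_all P fun ω => le_max_left 0 _) hint 1
  rw [one_mul] at hmk
  have : P {ω | 1 ≤ GA h ε A (W k ω)} ≤ ENNReal.ofReal d := by
    rw [← ENNReal.ofReal_toReal (measure_ne_top P {ω | 1 ≤ GA h ε A (W k ω)})]
    exact ENNReal.ofReal_le_ofReal (hmk.trans hk.le)
  refine (measure_mono ?_).trans this
  intro ω hω
  have hak0 := hA0.trans_le hak
  simp only [Set.mem_ofPred_eq, Pi.sub_apply, Pi.zero_apply, sub_zero, Function.comp] at hω ⊢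
  have p1 := Phi_le_DD hh (JJ_cont (W k ω)) hak0
  have p2 := DD_anti hh (JJ_cont (W k ω)) hA0 hak
  rw [Real.norm_eq_abs, abs_of_nonneg (by linarith)] at hω
  unfold GA
  refine le_trans ?_ (le_max_right _ _)
  refine le_min le_rfl ?_
  rw [inv_mul_eq_div, le_div_iff₀ hε]
  linarith
end weak


section tight
set_option linter.unusedSectionVars false
variable {Ω : Type*} [MeasurableSpace Ω] {P : Measure Ω} [IsProbabilityMeasure P]

lemma markov4 {T : Ω → ℝ} (hi : Integrable (fun ω => T ω ^ 4) P) {B x : ℝ}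
    (hB : ∫ ω, T ω ^ 4 ∂P ≤ B) (hx : 0 < x) : P {ω | x < |T ω|} ≤ ENNReal.ofReal (B / x ^ 4) := by
  have hmk := mul_meas_ge_le_integral_of_nonneg (μ := P)
    (ae_of_all P fun ω => (by positivity : 0 ≤ T ω ^ 4)) hi (x ^ 4)
  have : P {ω | x ^ 4 ≤ T ω ^ 4} ≤ ENNReal.ofReal (B / x ^ 4) := by
    rw [← ENNReal.ofReal_toReal (measure_ne_top P {ω | x ^ 4 ≤ T ω ^ 4})]
    apply ENNReal.ofReal_le_ofReal
    rw [le_div_iff₀ (by positivity), mul_comm]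
    exact hmk.trans hB
  refine (measure_mono fun ω hω => ?_).trans this
  simp only [Set.mem_ofPred_eq] at hω ⊢
  have := pow_le_pow_left₀ hx.le hω.le 4
  rwa [← abs_pow, abs_of_nonneg (by positivity : 0 ≤ T ω ^ 4)] at this

lemma tight_of_mom [MeasurableSpace CI] [BorelSpace CI] {W : ℕ → Ω → CI}
    (hW : ∀ k, Measurable (W k)) {C ϑ : ℝ} (hC : 0 ≤ C) (hϑ : 1 / 4 < ϑ)
    (h0i : ∀ k (t : I01), Integrable (fun ω => (W k ω t) ^ 4) P)
    (h0 : ∀ k (t : I01), ∫ ω, (W k ω t) ^ 4 ∂P ≤ C)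
    (h1i : ∀ k (s t : I01), Integrable (fun ω => (W k ω s - W k ω t) ^ 4) P)
    (h1 : ∀ k (s t : I01), ∫ ω, (W k ω s - W k ω t) ^ 4 ∂P ≤ C * |(s:ℝ) - t| ^ (4 * ϑ)) :
    IsTightMeasureSet {P.map (W k) | k} := by
  set q : ℝ := 2 * (2:ℝ)⁻¹ ^ (4 * ϑ) with hq
  have hq0 : 0 < q := by positivity
  have hq1 : q < 1 := by
    have : ((2:ℝ)⁻¹) ^ (4 * ϑ) < (2:ℝ)⁻¹ ^ (1:ℝ) :=
      Real.rpow_lt_rpow_of_exponent_gt (by norm_num) (by norm_num) (by linarith)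
    rw [Real.rpow_one] at this
    linarith
  obtain ⟨r, hr0, hr1, hr8⟩ : ∃ r : ℝ, 0 < r ∧ r < 1 ∧ r ^ 8 = q := by
    refine ⟨q ^ (((8:ℕ):ℝ)⁻¹), by positivity, Real.rpow_lt_one hq0.le hq1 (by positivity), ?_⟩
    exact Real.rpow_inv_natCast_pow hq0.le (by norm_num)
  have hr41 : r ^ 4 < 1 := pow_lt_one₀ hr0.le hr1 (by norm_num)
  rw [isTightMeasureSet_iff_exists_isCompact_measure_compl_le]
  intro ε hε
  set D : ℝ := C + C * (1 - r ^ 4)⁻¹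
  have bound : ∀ A : ℝ, 0 < A → ∀ k, P.map (W k) (KS r A)ᶜ ≤ ENNReal.ofReal (D / A ^ 4) := by
    intro A hA k
    rw [Measure.map_apply (hW k) (KS_compact hr0 hr1).isClosed.isOpen_compl.measurableSet]
    let p : ℝ → I01 := fun x => Set.projIcc 0 1 zero_le_one x
    have hsub : W k ⁻¹' (KS r A)ᶜ ⊆ {ω | A < |W k ω (p 0)|} ∪
        ⋃ M : ℕ, ⋃ j ∈ Finset.range (2 ^ M),
          {ω | A * r ^ M < |W k ω (p (((j:ℝ) + 1) / 2 ^ M)) - W k ω (p ((j:ℝ) / 2 ^ M))|} := by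
      intro ω hω
      simp only [Set.mem_preimage, Set.mem_compl_iff, KS, Set.mem_ofPred_eq, not_and_or, not_le,
        not_forall, ext0] at hω
      rcases hω with h | ⟨M, j, hj, h⟩
      · exact Or.inl h
      · refine Or.inr (Set.mem_iUnion.2 ⟨M, Set.mem_iUnion₂.2 ⟨j, Finset.mem_range.2 hj, h⟩⟩)
    refine (measure_mono hsub).trans ((measure_union_le _ _).trans ?_)
    have t1 := markov4 (h0i k (p 0)) (h0 k (p 0)) hA
    have t2 : ∀ M : ℕ, P (⋃ j ∈ Finset.range (2 ^ M),
          {ω | A * r ^ M < |W k ω (p (((j:ℝ) + 1) / 2 ^ M)) - W k ω (p ((j:ℝ) / 2 ^ M))|}) ≤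
        ENNReal.ofReal (C / A ^ 4 * (r ^ 4) ^ M) := by
      intro M
      have hj : ∀ j ∈ Finset.range (2 ^ M),
          P {ω | A * r ^ M < |W k ω (p (((j:ℝ) + 1) / 2 ^ M)) - W k ω (p ((j:ℝ) / 2 ^ M))|} ≤
          ENNReal.ofReal (C * (((2:ℝ)⁻¹) ^ (4 * ϑ)) ^ M / (A * r ^ M) ^ 4) := by
        intro j _
        refine markov4 (h1i k _ _) ((h1 k _ _).trans ?_) (by positivity)
        refine mul_le_mul_of_nonneg_left ?_ hC
        have e : |((p (((j:ℝ) + 1) / 2 ^ M) : I01) : ℝ) - (p ((j:ℝ) / 2 ^ M) : I01)| ≤ (2:ℝ)⁻¹ ^ M := by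
          refine (Set.abs_projIcc_sub_projIcc (c := ((j:ℝ) + 1) / 2 ^ M) (d := (j:ℝ) / 2 ^ M)
            zero_le_one).trans ?_
          rw [← sub_div, add_sub_cancel_left, abs_of_nonneg (by positivity), inv_pow, one_div]
        refine (Real.rpow_le_rpow (abs_nonneg _) e (by linarith)).trans ?_
        rw [← Real.rpow_natCast, ← Real.rpow_natCast, ← Real.rpow_mul (by norm_num),
          ← Real.rpow_mul (by norm_num), mul_comm]
      refine (measure_biUnion_finset_le _ _).trans ((Finset.sum_le_sum hj).trans ?_)
      rw [Finset.sum_const, Finset.card_range, nsmul_eq_mul, ← ENNReal.ofReal_natCast,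
        ← ENNReal.ofReal_mul (by positivity)]
      apply ENNReal.ofReal_le_ofReal
      apply le_of_eq
      have e2 : (2:ℝ) ^ M * (((2:ℝ)⁻¹) ^ (4 * ϑ)) ^ M = (r ^ 4) ^ M * (r ^ 4) ^ M := by
        rw [← mul_pow, ← hq, ← hr8, ← mul_pow]; ring
      push_cast
      have hrM : 0 < r ^ M := by positivity
      have e3 : (A * r ^ M) ^ 4 = A ^ 4 * (r ^ 4) ^ M := by ring
      rw [e3]
      have : 0 < (r ^ 4) ^ M := by positivity
      rw [div_mul_eq_mul_div, ← mul_div_assoc, div_eq_div_iff (by positivity) (by positivity)]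
      linear_combination C * A ^ 4 * e2
    have t3 : P (⋃ M : ℕ, ⋃ j ∈ Finset.range (2 ^ M),
          {ω | A * r ^ M < |W k ω (p (((j:ℝ) + 1) / 2 ^ M)) - W k ω (p ((j:ℝ) / 2 ^ M))|}) ≤
        ENNReal.ofReal (C / A ^ 4 * (1 - r ^ 4)⁻¹) := by
      refine (measure_iUnion_le _).trans ((ENNReal.tsum_le_tsum t2).trans ?_)
      rw [← ENNReal.ofReal_tsum_of_nonneg (fun M => by positivity)
        ((summable_geometric_of_lt_one (by positivity) hr41).mul_left _), tsum_mul_left,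
        tsum_geometric_of_lt_one (by positivity) hr41]
    refine (add_le_add t1 t3).trans ?_
    have : 0 < 1 - r ^ 4 := by linarith
    rw [← ENNReal.ofReal_add (by positivity) (by positivity)]
    apply ENNReal.ofReal_le_ofReal
    apply le_of_eq
    simp only [D]; ring
  have hlim : Tendsto (fun A : ℝ => ENNReal.ofReal (D / A ^ 4)) atTop (𝓝 0) := by
    rw [← ENNReal.ofReal_zero]
    exact ENNReal.tendsto_ofReal (Tendsto.const_div_atTop (tendsto_pow_atTop (by norm_num)) D)
  obtain ⟨A, hA0, hA⟩ := ((eventually_gt_atTop (0:ℝ)).and (hlim.eventually_le_const hε)).exists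
  refine ⟨KS r A, KS_compact hr0 hr1, ?_⟩
  rintro _ ⟨k, rfl⟩
  exact (bound A hA0 k).trans hA

lemma fourW {Y1 Y2 : ℕ → Ω → ℝ} (h1 : ∀ j, Measurable (Y1 j)) (h2 : ∀ j, Measurable (Y2 j))
    (hi1 : iIndepFun Y1 P) (hi2 : iIndepFun Y2 P)
    (f1 : ∀ j, Integrable (fun ω => Y1 j ω ^ 4) P) (f2 : ∀ j, Integrable (fun ω => Y2 j ω ^ 4) P)
    {B : ℝ} (b1 : ∀ j, ∫ ω, Y1 j ω ^ 4 ∂P ≤ B) (b2 : ∀ j, ∫ ω, Y2 j ω ^ 4 ∂P ≤ B)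
    (e1 : ∀ j, ∫ ω, Y1 j ω ∂P = ∫ ω, Y1 0 ω ∂P) (e2 : ∀ j, ∫ ω, Y2 j ω ∂P = ∫ ω, Y2 0 ω ∂P)
    {m n : ℕ} (hm : 0 < m) (hn : 0 < n) {c : ℝ} (hcm : (m:ℝ) + n ≤ c * m) (hcn : (m:ℝ) + n ≤ c * n) :
    Integrable (fun ω => (√((m : ℝ) + n) *
      ((m : ℝ)⁻¹ * ∑ j ∈ Finset.range m, Y1 j ω - (n : ℝ)⁻¹ * ∑ j ∈ Finset.range n, Y2 j ω
        - (∫ ω, Y1 0 ω ∂P - ∫ ω, Y2 0 ω ∂P))) ^ 4) P ∧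
    ∫ ω, (√((m : ℝ) + n) *
      ((m : ℝ)⁻¹ * ∑ j ∈ Finset.range m, Y1 j ω - (n : ℝ)⁻¹ * ∑ j ∈ Finset.range n, Y2 j ω
        - (∫ ω, Y1 0 ω ∂P - ∫ ω, Y2 0 ω ∂P))) ^ 4 ∂P ≤ 768 * c ^ 2 * B := by
  have hB : 0 ≤ B := le_trans (integral_nonneg fun ω => by positivity) (b1 0)
  have p1 : (0:ℝ) < m := by exact_mod_cast hm
  have p2 : (0:ℝ) < n := by exact_mod_cast hn
  have aux : ∀ {Y : ℕ → Ω → ℝ}, (∀ j, Measurable (Y j)) → iIndepFun Y P →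
      (∀ j, Integrable (fun ω => Y j ω ^ 4) P) → (∀ j, ∫ ω, Y j ω ^ 4 ∂P ≤ B) →
      (∀ j, ∫ ω, Y j ω ∂P = ∫ ω, Y 0 ω ∂P) → ∀ N : ℕ,
      Integrable (fun ω => (∑ j ∈ Finset.range N, (Y j ω - ∫ ω, Y 0 ω ∂P)) ^ 4) P ∧
      ∫ ω, (∑ j ∈ Finset.range N, (Y j ω - ∫ ω, Y 0 ω ∂P)) ^ 4 ∂P ≤ 48 * N ^ 2 * B := by
    intro Y hY hind hf hb he N
    have := sum_four (P := P) (Y := fun j ω => Y j ω - ∫ ω, Y 0 ω ∂P) (B := 16 * B)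
      (fun j => (hY j).sub_const _)
      (hind.comp (fun _ x => x - ∫ ω, Y 0 ω ∂P) (fun _ => by fun_prop))
      (fun j => by have := (cent_four (hY j) (hf j)).1; rwa [he j] at this)
      (fun j => by
        have : Integrable (Y j) P := by simpa using int_pow_of_four (hY j) (hf j) 1 (by norm_num)
        rw [integral_sub this (integrable_const _), he j]; simp)
      (fun j => by
        have := (cent_four (hY j) (hf j)).2
        rw [he j] at this
        linarith [hb j]) N
    exact ⟨this.1, this.2.2.2.trans (le_of_eq (by ring))⟩
  obtain ⟨i1, a1⟩ := aux h1 hi1 f1 b1 e1 m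
  obtain ⟨i2, a2⟩ := aux h2 hi2 f2 b2 e2 n
  set v1 := ∫ ω, Y1 0 ω ∂P
  set v2 := ∫ ω, Y2 0 ω ∂P
  set S1 : Ω → ℝ := fun ω => ∑ j ∈ Finset.range m, (Y1 j ω - v1) with hS1
  set S2 : Ω → ℝ := fun ω => ∑ j ∈ Finset.range n, (Y2 j ω - v2) with hS2
  have eq : ∀ ω, (√((m : ℝ) + n) *
      ((m : ℝ)⁻¹ * ∑ j ∈ Finset.range m, Y1 j ω - (n : ℝ)⁻¹ * ∑ j ∈ Finset.range n, Y2 j ω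
        - (v1 - v2))) ^ 4 = ((m:ℝ) + n) ^ 2 * ((m:ℝ)⁻¹ * S1 ω - (n:ℝ)⁻¹ * S2 ω) ^ 4 := by
    intro ω
    have q : √((m : ℝ) + n) ^ 4 = ((m:ℝ) + n) ^ 2 := by
      rw [show (4:ℕ) = 2 * 2 by norm_num, pow_mul, Real.sq_sqrt (by positivity)]
    rw [mul_pow, q]
    congr 2
    simp only [hS1, hS2, Finset.sum_sub_distrib, Finset.sum_const, Finset.card_range, nsmul_eq_mul]
    field_simp; ring
  simp_rw [eq]
  have hdom : Integrable (fun ω => ((m:ℝ) + n) ^ 2 * (8 * (((m:ℝ)⁻¹) ^ 4 * S1 ω ^ 4 +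
      ((n:ℝ)⁻¹) ^ 4 * S2 ω ^ 4))) P :=
    ((Iadd (i1.const_mul _) (i2.const_mul _)).const_mul _).const_mul _
  have hle : ∀ ω, ((m:ℝ) + n) ^ 2 * ((m:ℝ)⁻¹ * S1 ω - (n:ℝ)⁻¹ * S2 ω) ^ 4 ≤
      ((m:ℝ) + n) ^ 2 * (8 * (((m:ℝ)⁻¹) ^ 4 * S1 ω ^ 4 + ((n:ℝ)⁻¹) ^ 4 * S2 ω ^ 4)) := by
    intro ω
    have := sub_pow_four_le ((m:ℝ)⁻¹ * S1 ω) ((n:ℝ)⁻¹ * S2 ω)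
    rw [mul_pow, mul_pow] at this
    gcongr
  have hmS1 : Measurable S1 := by simp only [hS1]; fun_prop
  have hmS2 : Measurable S2 := by simp only [hS2]; fun_prop
  have hI : Integrable (fun ω => ((m:ℝ) + n) ^ 2 * ((m:ℝ)⁻¹ * S1 ω - (n:ℝ)⁻¹ * S2 ω) ^ 4) P := by
    refine Integrable.mono' hdom (by fun_prop) (ae_of_all _ fun ω => ?_)
    rw [Real.norm_eq_abs, abs_of_nonneg (by positivity)]
    exact hle ω
  refine ⟨hI, (integral_mono hI hdom hle).trans ?_⟩
  rw [integral_const_mul, integral_const_mul, integral_add (i1.const_mul _) (i2.const_mul _),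
    integral_const_mul, integral_const_mul]
  have g1 : ((m:ℝ)⁻¹) ^ 4 * ∫ ω, S1 ω ^ 4 ∂P ≤ ((m:ℝ)⁻¹) ^ 4 * (48 * m ^ 2 * B) := by gcongr
  have g2 : ((n:ℝ)⁻¹) ^ 4 * ∫ ω, S2 ω ^ 4 ∂P ≤ ((n:ℝ)⁻¹) ^ 4 * (48 * n ^ 2 * B) := by gcongr
  have k1 : ((m:ℝ) + n) ^ 2 * (((m:ℝ)⁻¹) ^ 4 * (48 * m ^ 2 * B)) ≤ 48 * c ^ 2 * B := by
    have : ((m:ℝ) + n) * (m:ℝ)⁻¹ ≤ c := by rwa [← div_eq_mul_inv, div_le_iff₀ p1]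
    have := pow_le_pow_left₀ (by positivity) this 2
    calc _ = 48 * (((m:ℝ) + n) * (m:ℝ)⁻¹) ^ 2 * B := by field_simp
      _ ≤ _ := by gcongr
  have k2 : ((m:ℝ) + n) ^ 2 * (((n:ℝ)⁻¹) ^ 4 * (48 * n ^ 2 * B)) ≤ 48 * c ^ 2 * B := by
    have : ((m:ℝ) + n) * (n:ℝ)⁻¹ ≤ c := by rwa [← div_eq_mul_inv, div_le_iff₀ p2]
    have := pow_le_pow_left₀ (by positivity) this 2
    calc _ = 48 * (((m:ℝ) + n) * (n:ℝ)⁻¹) ^ 2 * B := by field_simp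
      _ ≤ _ := by gcongr
  have l1 := mul_le_mul_of_nonneg_left g1 (by positivity : (0:ℝ) ≤ ((m:ℝ) + n) ^ 2)
  have l2 := mul_le_mul_of_nonneg_left g2 (by positivity : (0:ℝ) ≤ ((m:ℝ) + n) ^ 2)
  linarith
end tight


section main
set_option linter.unusedSectionVars false
variable {Ω : Type*} [MeasurableSpace Ω] {P : Measure Ω} [IsProbabilityMeasure P]
  [MeasurableSpace CI] [BorelSpace CI]

lemma X_int4 {X : Ω → CI} (hX : Measurable X)
    (h : ∫⁻ ω, ENNReal.ofReal (‖X ω‖ ^ ((4:ℝ))) ∂P < ⊤) : Integrable (fun ω => ‖X ω‖ ^ 4) P := by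
  refine ⟨(hX.norm.pow_const 4).aestronglyMeasurable, ?_⟩
  rw [hasFiniteIntegral_iff_ofReal (ae_of_all _ fun ω => by positivity)]
  convert h using 5
  norm_cast

lemma L_int4 {X : Ω → CI} (hX : Measurable X) (h : Integrable (fun ω => ‖X ω‖ ^ 4) P)
    (L : StrongDual ℝ CI) : Integrable (fun ω => L (X ω) ^ 4) P := by
  refine Integrable.mono' (h.const_mul (‖L‖ ^ 4))
    ((L.continuous.measurable.comp hX).pow_const 4).aestronglyMeasurable (ae_of_all _ fun ω => ?_)
  rw [norm_pow, ← mul_pow]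
  exact pow_le_pow_left₀ (norm_nonneg _) (L.le_opNorm _) 4

lemma X_int {X : Ω → CI} (hX : Measurable X) (h : Integrable (fun ω => ‖X ω‖ ^ 4) P) :
    Integrable X P := by
  have := int_pow_of_four hX.norm h 1 (by norm_num)
  simp only [pow_one] at this
  exact (integrable_norm_iff hX.aestronglyMeasurable).1 this

lemma eval4 {X : Ω → CI} (hX : Measurable X) (h : Integrable (fun ω => ‖X ω‖ ^ 4) P) (t : I01) :
    ∫ ω, (X ω t) ^ 4 ∂P ≤ ∫ ω, ‖X ω‖ ^ 4 ∂P := by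
  refine integral_mono (L_int4 hX h (ContinuousMap.evalCLM ℝ t)) h fun ω => ?_
  have : |X ω t| ≤ ‖X ω‖ := (X ω).norm_coe_le_norm t
  have := pow_le_pow_left₀ (abs_nonneg _) this 4
  rwa [← abs_pow, abs_of_nonneg (by positivity)] at this

lemma hold4 {X : Ω → CI} (hX : Measurable X) {M : Ω → ℝ} (hM0 : ∀ ω, 0 ≤ M ω)
    (hM : ∫⁻ ω, ENNReal.ofReal (M ω ^ ((4:ℝ))) ∂P < ⊤) {ϑ : ℝ}
    (hH : ∀ᵐ ω ∂P, ∀ s t : I01, |X ω s - X ω t| ≤ M ω * |(s : ℝ) - (t : ℝ)| ^ ϑ) (s t : I01) :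
    ∫ ω, (X ω s - X ω t) ^ 4 ∂P ≤
      (∫⁻ ω, ENNReal.ofReal (M ω ^ ((4:ℝ))) ∂P).toReal * |(s:ℝ) - t| ^ (4 * ϑ) := by
  have hm : Measurable (fun ω => X ω s - X ω t) :=
    (((ContinuousMap.evalCLM ℝ s : StrongDual ℝ CI)).continuous.measurable.comp hX).sub
      (((ContinuousMap.evalCLM ℝ t : StrongDual ℝ CI)).continuous.measurable.comp hX)
  have e0 : 0 ≤ |(s:ℝ) - t| ^ (4 * ϑ) := by positivity
  rw [integral_eq_lintegral_of_nonneg_ae (ae_of_all _ fun ω => by positivity)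
    (hm.pow_const 4).aestronglyMeasurable, ← ENNReal.toReal_ofReal e0, ← ENNReal.toReal_mul]
  refine ENNReal.toReal_mono (ENNReal.mul_ne_top hM.ne ENNReal.ofReal_ne_top) ?_
  rw [← lintegral_mul_const' _ _ ENNReal.ofReal_ne_top]
  refine lintegral_mono_ae ?_
  filter_upwards [hH] with ω hω
  rw [← ENNReal.ofReal_mul (Real.rpow_nonneg (hM0 ω) _)]
  apply ENNReal.ofReal_le_ofReal
  have := pow_le_pow_left₀ (abs_nonneg _) (hω s t) 4
  rw [← abs_pow, abs_of_nonneg (by positivity), mul_pow] at this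
  refine this.trans (le_of_eq ?_)
  rw [mul_comm 4 ϑ, Real.rpow_mul (abs_nonneg _)]
  norm_cast

/-- normalized process -/
def WW (P : Measure Ω) (X1 X2 : ℕ → Ω → CI) (m n : ℕ) (ω : Ω) : CI :=
  √((m:ℝ) + n) • ((m:ℝ)⁻¹ • ∑ j ∈ Finset.range m, X1 j ω - (n:ℝ)⁻¹ • ∑ j ∈ Finset.range n, X2 j ω
    - (∫ ω, X1 0 ω ∂P - ∫ ω, X2 0 ω ∂P))

lemma WW_meas {X1 X2 : ℕ → Ω → CI} (h1 : ∀ j, Measurable (X1 j)) (h2 : ∀ j, Measurable (X2 j))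
    (m n : ℕ) : Measurable (WW P X1 X2 m n) := by
  unfold WW; fun_prop

lemma L_WW {X1 X2 : ℕ → Ω → CI} (i1 : Integrable (X1 0) P) (i2 : Integrable (X2 0) P)
    (L : StrongDual ℝ CI) (m n : ℕ) (ω : Ω) : L (WW P X1 X2 m n ω) =
    √((m : ℝ) + n) * ((m : ℝ)⁻¹ * ∑ j ∈ Finset.range m, L (X1 j ω)
      - (n : ℝ)⁻¹ * ∑ j ∈ Finset.range n, L (X2 j ω)
        - (∫ ω, L (X1 0 ω) ∂P - ∫ ω, L (X2 0 ω) ∂P)) := by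
  rw [L.integral_comp_comm i1, L.integral_comp_comm i2]
  simp [WW]

lemma var_expand {X : Ω → CI} (hX : Measurable X) (h : Integrable (fun ω => ‖X ω‖ ^ 4) P)
    {q : ℕ} (ts : Fin q → I01) (c : Fin q → ℝ) :
    Var[fun ω => ∑ i, c i * X ω (ts i); P] = ∑ i, ∑ j, c i * c j *
      ∫ ω, (X ω (ts i) - ∫ ω, X ω (ts i) ∂P) * (X ω (ts j) - ∫ ω, X ω (ts j) ∂P) ∂P := by
  have hm : ∀ t, Measurable (fun ω => X ω t) := fun t =>
    ((ContinuousMap.evalCLM ℝ t : StrongDual ℝ CI)).continuous.measurable.comp hX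
  have h4 : ∀ t, Integrable (fun ω => X ω t ^ 4) P := fun t =>
    L_int4 hX h (ContinuousMap.evalCLM ℝ t)
  have h1 : ∀ t, Integrable (fun ω => X ω t) P := fun t => by
    simpa using int_pow_of_four (hm t) (h4 t) 1 (by norm_num)
  have h2 : ∀ t, MemLp (fun ω => X ω t) 2 P := fun t =>
    (memLp_two_iff_integrable_sq (hm t).aestronglyMeasurable).2
      (int_pow_of_four (hm t) (h4 t) 2 (by norm_num))
  have h3 : ∀ t, MemLp (fun ω => X ω t - ∫ ω, X ω t ∂P) 2 P := fun t =>
    (h2 t).sub (memLp_const _)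
  have hp : ∀ s t, Integrable (fun ω => (X ω s - ∫ ω, X ω s ∂P) * (X ω t - ∫ ω, X ω t ∂P)) P :=
    fun s t => (h3 s).integrable_mul (h3 t)
  rw [variance_eq_integral (Finset.measurable_sum _ fun i _ => (hm _).const_mul _).aemeasurable,
    integral_finsetSum _ (fun i _ => (h1 _).const_mul _)]
  simp_rw [integral_const_mul]
  have e : ∀ ω, (∑ i, c i * X ω (ts i) - ∑ i, c i * ∫ ω, X ω (ts i) ∂P) ^ 2 =
      ∑ i, ∑ j, c i * c j * ((X ω (ts i) - ∫ ω, X ω (ts i) ∂P) *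
        (X ω (ts j) - ∫ ω, X ω (ts j) ∂P)) := by
    intro ω
    rw [← Finset.sum_sub_distrib, sq, Finset.sum_mul_sum]
    refine Finset.sum_congr rfl fun i _ => Finset.sum_congr rfl fun j _ => ?_
    ring
  simp_rw [e]
  rw [integral_finsetSum _ (fun i _ => integrable_finsetSum _ fun j _ => (hp _ _).const_mul _)]
  refine Finset.sum_congr rfl fun i _ => ?_
  rw [integral_finsetSum _ (fun j _ => (hp _ _).const_mul _)]
  refine Finset.sum_congr rfl fun j _ => ?_
  rw [integral_const_mul]

lemma gauss_law {X1 X2 : Ω → CI} (hX1 : Measurable X1) (hX2 : Measurable X2)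
    (h1 : Integrable (fun ω => ‖X1 ω‖ ^ 4) P) (h2 : Integrable (fun ω => ‖X2 ω‖ ^ 4) P)
    {τ : ℝ} (hτ : τ ∈ Set.Ioo (0:ℝ) 1) (μ₀ : Measure CI) [IsProbabilityMeasure μ₀]
    (hμ : ∀ L : StrongDual ℝ CI, charFunDual μ₀ L = Complex.exp (-((τ⁻¹ * Var[fun ω => L (X1 ω); P]
      + (1 - τ)⁻¹ * Var[fun ω => L (X2 ω); P] : ℝ) : ℂ) / 2)) :
    IsCenteredGaussianWithKernel μ₀ (fun w => w)
        (fun s t => τ⁻¹ * ∫ ω, (X1 ω s - ∫ ω, X1 ω s ∂P) * (X1 ω t - ∫ ω, X1 ω t ∂P) ∂P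
          + (1 - τ)⁻¹ * ∫ ω, (X2 ω s - ∫ ω, X2 ω s ∂P) * (X2 ω t - ∫ ω, X2 ω t ∂P) ∂P) := by
  intro q ts c
  let L : StrongDual ℝ CI := ∑ i, c i • ContinuousMap.evalCLM ℝ (ts i)
  have hL : ∀ w : CI, L w = ∑ i, c i * w (ts i) := by
    intro w; simp [L]
  have hLf : (fun w : CI => ∑ i, c i * w (ts i)) = L := by ext w; exact (hL w).symm
  have hv : (∑ i, ∑ j, c i * c j * (τ⁻¹ * ∫ ω, (X1 ω (ts i) - ∫ ω, X1 ω (ts i) ∂P) * (X1 ω (ts j) - ∫ ω, X1 ω (ts j) ∂P) ∂P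
          + (1 - τ)⁻¹ * ∫ ω, (X2 ω (ts i) - ∫ ω, X2 ω (ts i) ∂P) * (X2 ω (ts j) - ∫ ω, X2 ω (ts j) ∂P) ∂P)) =
      τ⁻¹ * Var[fun ω => L (X1 ω); P] + (1 - τ)⁻¹ * Var[fun ω => L (X2 ω); P] := by
    simp_rw [hL]
    rw [var_expand hX1 h1, var_expand hX2 h2]
    simp only [Finset.mul_sum, ← Finset.sum_add_distrib]
    refine Finset.sum_congr rfl fun i _ => Finset.sum_congr rfl fun j _ => ?_
    ring
  rw [hv, hLf]
  have hτ1 : 0 < 1 - τ := by linarith [hτ.2]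
  have hτ0 := hτ.1
  have v1 := variance_nonneg (fun ω => L (X1 ω)) P
  have v2 := variance_nonneg (fun ω => L (X2 ω)) P
  have : IsProbabilityMeasure (μ₀.map L) :=
    Measure.isProbabilityMeasure_map L.continuous.measurable.aemeasurable
  apply Measure.ext_of_charFun
  ext u
  rw [charFun_map_eq_charFunDual_smul, hμ, charFun_gaussianReal, Real.coe_toNNReal _ (by positivity)]
  have w1 : Var[fun ω => (u • L) (X1 ω); P] = u ^ 2 * Var[fun ω => L (X1 ω); P] :=
    variance_const_mul u _ P
  have w2 : Var[fun ω => (u • L) (X2 ω); P] = u ^ 2 * Var[fun ω => L (X2 ω); P] :=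
    variance_const_mul u _ P
  rw [w1, w2]
  push_cast
  congr 1
  ring
end main


section core
variable {Ω : Type*} [MeasurableSpace Ω] {P : Measure Ω} [IsProbabilityMeasure P]
  [MeasurableSpace CI] [BorelSpace CI]

lemma core {X1 X2 : ℕ → Ω → CI}
    (hmeas1 : ∀ j, Measurable (X1 j)) (hmeas2 : ∀ j, Measurable (X2 j))
    (hindep : iIndepFun (m := fun _ : ℕ ⊕ ℕ => (inferInstance : MeasurableSpace CI))
      (Sum.elim X1 X2) P)
    (hid1 : ∀ j, Measure.map (X1 j) P = Measure.map (X1 0) P)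
    (hid2 : ∀ j, Measure.map (X2 j) P = Measure.map (X2 0) P)
    (h41 : ∀ j, Integrable (fun ω => ‖X1 j ω‖ ^ 4) P)
    (h42 : ∀ j, Integrable (fun ω => ‖X2 j ω‖ ^ 4) P)
    {ϑ D : ℝ} (hϑ : 1/4 < ϑ)
    (hD1 : ∀ s t : I01, ∫ ω, (X1 0 ω s - X1 0 ω t) ^ 4 ∂P ≤ D * |(s:ℝ) - t| ^ (4 * ϑ))
    (hD2 : ∀ s t : I01, ∫ ω, (X2 0 ω s - X2 0 ω t) ^ 4 ∂P ≤ D * |(s:ℝ) - t| ^ (4 * ϑ))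
    {τ : ℝ} (hτ : τ ∈ Set.Ioo (0:ℝ) 1)
    {m n : ℕ → ℕ} (hm : Tendsto m atTop atTop) (hn : Tendsto n atTop atTop)
    (hratio : Tendsto (fun k => (m k : ℝ) / ((m k : ℝ) + (n k : ℝ))) atTop (𝓝 τ))
    (hm0 : ∀ k, 0 < m k) (hn0 : ∀ k, 0 < n k) {c : ℝ}
    (hcm : ∀ k, (m k : ℝ) + n k ≤ c * m k) (hcn : ∀ k, (m k : ℝ) + n k ≤ c * n k) :
    ∃ μ₀ : ProbabilityMeasure CI,
      IsCenteredGaussianWithKernel (μ₀ : Measure CI) (fun w => w)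
        (fun s t => τ⁻¹ * ∫ ω, (X1 0 ω s - ∫ ω, X1 0 ω s ∂P) * (X1 0 ω t - ∫ ω, X1 0 ω t ∂P) ∂P
          + (1 - τ)⁻¹ * ∫ ω, (X2 0 ω s - ∫ ω, X2 0 ω s ∂P) * (X2 0 ω t - ∫ ω, X2 0 ω t ∂P) ∂P) ∧
      TendstoInDistribution (fun k => WW P X1 X2 (m k) (n k)) atTop id (fun _ => P)
        (μ₀ : Measure CI) := by
  have x1 := X_int (hmeas1 0) (h41 0)
  have x2 := X_int (hmeas2 0) (h42 0)
  have id1 : ∀ j, IdentDistrib (X1 j) (X1 0) P P := fun j =>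
    ⟨(hmeas1 j).aemeasurable, (hmeas1 0).aemeasurable, hid1 j⟩
  have id2 : ∀ j, IdentDistrib (X2 j) (X2 0) P P := fun j =>
    ⟨(hmeas2 j).aemeasurable, (hmeas2 0).aemeasurable, hid2 j⟩
  have mL1 : ∀ (L : StrongDual ℝ CI) j, Measurable (fun ω => L (X1 j ω)) := fun L j =>
    L.continuous.measurable.comp (hmeas1 j)
  have mL2 : ∀ (L : StrongDual ℝ CI) j, Measurable (fun ω => L (X2 j ω)) := fun L j =>
    L.continuous.measurable.comp (hmeas2 j)
  have idL1 : ∀ (L : StrongDual ℝ CI) j,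
      IdentDistrib (fun ω => L (X1 j ω)) (fun ω => L (X1 0 ω)) P P := fun L j =>
    (id1 j).comp L.continuous.measurable
  have idL2 : ∀ (L : StrongDual ℝ CI) j,
      IdentDistrib (fun ω => L (X2 j ω)) (fun ω => L (X2 0 ω)) P P := fun L j =>
    (id2 j).comp L.continuous.measurable
  have indL : ∀ L : StrongDual ℝ CI,
      iIndepFun (Sum.elim (fun j ω => L (X1 j ω)) (fun j ω => L (X2 j ω))) P := by
    intro L
    have := hindep.comp (fun _ w => L w) (fun _ => L.continuous.measurable)
    convert this using 1
    ext (j | j) ω <;> rfl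
  have fL1 : ∀ (L : StrongDual ℝ CI) j, Integrable (fun ω => L (X1 j ω) ^ 4) P := fun L j =>
    L_int4 (hmeas1 j) (h41 j) L
  have fL2 : ∀ (L : StrongDual ℝ CI) j, Integrable (fun ω => L (X2 j ω) ^ 4) P := fun L j =>
    L_int4 (hmeas2 j) (h42 j) L
  have WL : ∀ (L : StrongDual ℝ CI) (B : ℝ), ∫ ω, L (X1 0 ω) ^ 4 ∂P ≤ B →
      ∫ ω, L (X2 0 ω) ^ 4 ∂P ≤ B → ∀ k,
      Integrable (fun ω => L (WW P X1 X2 (m k) (n k) ω) ^ 4) P ∧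
      ∫ ω, L (WW P X1 X2 (m k) (n k) ω) ^ 4 ∂P ≤ 768 * c ^ 2 * B := by
    intro L B hB1 hB2 k
    simp_rw [L_WW x1 x2 L]
    refine fourW (mL1 L) (mL2 L) ((indL L).precomp (g := Sum.inl) Sum.inl_injective)
      ((indL L).precomp (g := Sum.inr) Sum.inr_injective) (fL1 L) (fL2 L) (fun j => ?_) (fun j => ?_)
      (fun j => (idL1 L j).integral_eq) (fun j => (idL2 L j).integral_eq) (hm0 k) (hn0 k)
      (hcm k) (hcn k)
    · have := ((idL1 L j).comp (u := fun x : ℝ => x ^ 4) (by fun_prop)).integral_eq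
      exact (le_of_eq this).trans hB1
    · have := ((idL2 L j).comp (u := fun x : ℝ => x ^ 4) (by fun_prop)).integral_eq
      exact (le_of_eq this).trans hB2
  have hWm : ∀ k, Measurable (WW P X1 X2 (m k) (n k)) := fun k => WW_meas hmeas1 hmeas2 _ _
  set B0 : ℝ := max (∫ ω, ‖X1 0 ω‖ ^ 4 ∂P) (∫ ω, ‖X2 0 ω‖ ^ 4 ∂P)
  have hev := fun (t : I01) => WL (ContinuousMap.evalCLM ℝ t) B0
    ((eval4 (hmeas1 0) (h41 0) t).trans (le_max_left _ _))
    ((eval4 (hmeas2 0) (h42 0) t).trans (le_max_right _ _))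
  have hinc := fun (s t : I01) => WL (ContinuousMap.evalCLM ℝ s - ContinuousMap.evalCLM ℝ t)
    (D * |(s:ℝ) - t| ^ (4 * ϑ)) (by simpa using hD1 s t) (by simpa using hD2 s t)
  have hB0 : 0 ≤ B0 := le_max_of_le_left (integral_nonneg fun ω => by positivity)
  have tight : IsTightMeasureSet {P.map (WW P X1 X2 (m k) (n k)) | k} := by
    refine tight_of_mom (C := 768 * c ^ 2 * max B0 D) (ϑ := ϑ) hWm
      (mul_nonneg (by positivity) (le_max_of_le_left hB0)) hϑ (fun k t => (hev t k).1)
      (fun k t => (hev t k).2.trans ?_) (fun k s t => by simpa using (hinc s t k).1)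
      (fun k s t => ?_)
    · gcongr; exact le_max_left _ _
    · have := (hinc s t k).2
      simp only [sub_apply, ContinuousMap.evalCLM_apply] at this
      refine this.trans ?_
      rw [← mul_assoc]
      gcongr; exact le_max_right _ _
  let μs : ℕ → ProbabilityMeasure CI := fun k =>
    ⟨P.map (WW P X1 X2 (m k) (n k)), Measure.isProbabilityMeasure_map (hWm k).aemeasurable⟩
  obtain ⟨μ₀, hφ, hlim⟩ := weak_lim μs tight (fun L => Complex.exp (-((τ⁻¹ *
      Var[fun ω => L (X1 0 ω); P] + (1 - τ)⁻¹ * Var[fun ω => L (X2 0 ω); P] : ℝ) : ℂ) / 2)) (by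
    intro L
    have := clt_two (mL1 L) (mL2 L) (indL L)
      ((memLp_two_iff_integrable_sq (mL1 L 0).aestronglyMeasurable).2
        (int_pow_of_four (mL1 L 0) (fL1 L 0) 2 (by norm_num)))
      ((memLp_two_iff_integrable_sq (mL2 L 0).aestronglyMeasurable).2
        (int_pow_of_four (mL2 L 0) (fL2 L 0) 2 (by norm_num)))
      (idL1 L) (idL2 L) hm hn hτ hratio
    refine this.congr fun k => ?_
    change _ = charFunDual (P.map (WW P X1 X2 (m k) (n k))) L
    rw [charFunDual_eq_charFun_map_one, Measure.map_map L.continuous.measurable (hWm k)]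
    congr 2
    ext ω
    exact (L_WW x1 x2 L _ _ ω).symm)
  have : IsProbabilityMeasure (μ₀ : Measure CI) := μ₀.2
  refine ⟨μ₀, gauss_law (hmeas1 0) (hmeas2 0) (h41 0) (h42 0) hτ _ hφ,
    fun k => (hWm k).aemeasurable, aemeasurable_id, ?_⟩
  convert hlim using 2
  congr 1
  apply Subtype.ext
  exact Measure.map_id
end core


/-- **Theorem A.1.** Under Assumption A, as `m,n → ∞` with `m/(m+n) → τ ∈ (0,1)`,
`√(m+n)(T̂^θ_{m,n} − T^θ)` converges in distribution to
`Z_{E,θ} = max{sup_{t∈E^l_θ}(−Z(t)), sup_{t∈E^u_θ} Z(t)}` for a centered Gaussian random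
element `Z` of `C([0,1])` with covariance kernel
`k(s,t) = τ^{-1}Cov(X_{11}(s),X_{11}(t)) + (1−τ)^{-1}Cov(X_{21}(s),X_{21}(t))`.
(The supremum of the union of the images below realises the convention `sup ∅ = −∞`,
since the union of the extremal sets is nonempty.) -/
theorem statement3 {Ω : Type*} [MeasurableSpace Ω] (P : Measure Ω) [IsProbabilityMeasure P]
    [MeasurableSpace CI] [BorelSpace CI]
    (X1 X2 : ℕ → Ω → CI)
    (hmeas1 : ∀ j, Measurable (X1 j)) (hmeas2 : ∀ j, Measurable (X2 j))
    (hindep : iIndepFun (m := fun _ : ℕ ⊕ ℕ => (inferInstance : MeasurableSpace CI))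
      (Sum.elim X1 X2) P)
    (hid1 : ∀ j, Measure.map (X1 j) P = Measure.map (X1 0) P)
    (hid2 : ∀ j, Measure.map (X2 j) P = Measure.map (X2 0) P)
    -- Assumption (A1)
    (ν1 ν2 K : ℝ) (hν1 : 0 < ν1) (hν2 : 0 < ν2)
    (hmom1 : ∀ j, ∫⁻ ω, ENNReal.ofReal (‖X1 j ω‖ ^ ((2:ℝ) + ν1)) ∂P ≤ ENNReal.ofReal K)
    (hmom2 : ∀ j, ∫⁻ ω, ENNReal.ofReal (‖X2 j ω‖ ^ ((2:ℝ) + ν2)) ∂P ≤ ENNReal.ofReal K)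
    (hmom14 : ∀ j, ∫⁻ ω, ENNReal.ofReal (‖X1 j ω‖ ^ ((4:ℝ))) ∂P < ⊤)
    (hmom24 : ∀ j, ∫⁻ ω, ENNReal.ofReal (‖X2 j ω‖ ^ ((4:ℝ))) ∂P < ⊤)
    -- Assumption (A2)
    (ϑ : ℝ) (hϑ : 1/4 < ϑ)
    (M1 M2 : Ω → ℝ) (hM10 : ∀ ω, 0 ≤ M1 ω) (hM20 : ∀ ω, 0 ≤ M2 ω)
    (hM14 : ∫⁻ ω, ENNReal.ofReal (M1 ω ^ ((4:ℝ))) ∂P < ⊤)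
    (hM24 : ∫⁻ ω, ENNReal.ofReal (M2 ω ^ ((4:ℝ))) ∂P < ⊤)
    (hHold1 : ∀ j, ∀ᵐ ω ∂P, ∀ s t : I01,
      |X1 j ω s - X1 j ω t| ≤ M1 ω * |(s : ℝ) - (t : ℝ)| ^ ϑ)
    (hHold2 : ∀ j, ∀ᵐ ω ∂P, ∀ s t : I01,
      |X2 j ω s - X2 j ω t| ≤ M2 ω * |(s : ℝ) - (t : ℝ)| ^ ϑ)
    -- mean functions and their difference
    (μ1 μ2 θ : I01 → ℝ)
    (hμ1 : ∀ t, μ1 t = ∫ ω, X1 0 ω t ∂P) (hμ2 : ∀ t, μ2 t = ∫ ω, X2 0 ω t ∂P)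
    (hθ : ∀ t, θ t = μ1 t - μ2 t)
    -- the equivalence bands
    (κl κu : I01 → ℝ) (hκl : Continuous κl) (hκu : Continuous κu)
    (hband : ∀ t, κl t < κu t)
    -- sample sizes `m,n → ∞` with `m/(m+n) → τ ∈ (0,1)`
    (τ : ℝ) (hτ : τ ∈ Set.Ioo (0:ℝ) 1)
    (m n : ℕ → ℕ) (hm : Tendsto m atTop atTop) (hn : Tendsto n atTop atTop)
    (hratio : Tendsto (fun k => (m k : ℝ) / ((m k : ℝ) + (n k : ℝ))) atTop (𝓝 τ)) :
    ∃ (Ω' : Type) (_ : MeasurableSpace Ω') (P' : Measure Ω') (Z : Ω' → CI),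
      IsProbabilityMeasure P' ∧ Measurable Z ∧
      IsCenteredGaussianWithKernel P' Z
        (fun s t => τ⁻¹ * ∫ ω, (X1 0 ω s - μ1 s) * (X1 0 ω t - μ1 t) ∂P
          + (1 - τ)⁻¹ * ∫ ω, (X2 0 ω s - μ2 s) * (X2 0 ω t - μ2 t) ∂P) ∧
      ∀ f : BoundedContinuousFunction ℝ ℝ,
        Tendsto (fun k => ∫ ω, f (Real.sqrt ((m k : ℝ) + (n k : ℝ)) *
            (Tmax (thetaHat2 X1 X2 (m k) (n k) ω) κl κu - Tmax θ κl κu)) ∂P)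
          atTop
          (𝓝 (∫ ω', f (sSup
            ((fun t => -(Z ω' t)) '' {t : I01 | -θ t + κl t = Tmax θ κl κu} ∪
             (fun t => Z ω' t) '' {t : I01 | θ t - κu t = Tmax θ κl κu})) ∂P')) := by
  have h41 := fun j => X_int4 (hmeas1 j) (hmom14 j)
  have h42 := fun j => X_int4 (hmeas2 j) (hmom24 j)
  have hτ0 := hτ.1
  have hτ1 : 0 < 1 - τ := by linarith [hτ.2]
  have hmn : ∀ᶠ k in atTop, 0 < m k ∧ 0 < n k ∧ τ / 2 < (m k : ℝ) / ((m k : ℝ) + (n k : ℝ)) ∧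
      (m k : ℝ) / ((m k : ℝ) + (n k : ℝ)) < (1 + τ) / 2 := by
    filter_upwards [hm.eventually_gt_atTop 0, hn.eventually_gt_atTop 0,
      hratio.eventually_const_lt (show τ / 2 < τ by linarith),
      hratio.eventually_lt_const (show τ < (1 + τ) / 2 by linarith)] with k a b c d
    exact ⟨a, b, c, d⟩
  obtain ⟨N, hN⟩ := eventually_atTop.1 hmn
  set D1 := (∫⁻ ω, ENNReal.ofReal (M1 ω ^ ((4:ℝ))) ∂P).toReal
  set D2 := (∫⁻ ω, ENNReal.ofReal (M2 ω ^ ((4:ℝ))) ∂P).toReal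
  set c : ℝ := max (2 / τ) (2 / (1 - τ))
  have hshift : Tendsto (fun k : ℕ => k + N) atTop atTop := tendsto_add_atTop_nat N
  obtain ⟨μ₀, hG, hW⟩ := core (P := P) (X1 := X1) (X2 := X2) hmeas1 hmeas2 hindep hid1 hid2 h41 h42
    (ϑ := ϑ) (D := max D1 D2) hϑ
    (fun s t => (hold4 (hmeas1 0) hM10 hM14 (hHold1 0) s t).trans
      (mul_le_mul_of_nonneg_right (le_max_left _ _) (by positivity)))
    (fun s t => (hold4 (hmeas2 0) hM20 hM24 (hHold2 0) s t).trans
      (mul_le_mul_of_nonneg_right (le_max_right _ _) (by positivity)))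
    hτ (hm.comp hshift) (hn.comp hshift) (hratio.comp hshift)
    (fun k => (hN (k + N) (Nat.le_add_left _ _)).1)
    (fun k => (hN (k + N) (Nat.le_add_left _ _)).2.1) (c := c)
    (fun k => by
      obtain ⟨a, b, u, v⟩ := hN (k + N) (Nat.le_add_left _ _)
      simp only [Function.comp]
      have p1 : (0:ℝ) < m (k + N) := by exact_mod_cast a
      have p2 : (0:ℝ) < n (k + N) := by exact_mod_cast b
      rw [lt_div_iff₀ (by positivity)] at u
      have : 2 / τ * m (k + N) ≤ c * m (k + N) :=
        mul_le_mul_of_nonneg_right (le_max_left _ _) p1.le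
      refine le_trans ?_ this
      rw [div_mul_eq_mul_div, le_div_iff₀ hτ0]
      linarith)
    (fun k => by
      obtain ⟨a, b, u, v⟩ := hN (k + N) (Nat.le_add_left _ _)
      simp only [Function.comp]
      have p1 : (0:ℝ) < m (k + N) := by exact_mod_cast a
      have p2 : (0:ℝ) < n (k + N) := by exact_mod_cast b
      rw [div_lt_iff₀ (by positivity)] at v
      have : 2 / (1 - τ) * n (k + N) ≤ c * n (k + N) :=
        mul_le_mul_of_nonneg_right (le_max_right _ _) p2.le
      refine le_trans ?_ this
      rw [div_mul_eq_mul_div, le_div_iff₀ hτ1]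
      linarith)
  have iμ : IsProbabilityMeasure (μ₀ : Measure CI) := μ₀.2
  have x1 := X_int (hmeas1 0) (h41 0)
  have x2 := X_int (hmeas2 0) (h42 0)
  have hθ' : ∀ t, θ t = (∫ ω, X1 0 ω ∂P - ∫ ω, X2 0 ω ∂P : CI) t := by
    intro t
    rw [hθ, hμ1, hμ2]
    have e1 := (ContinuousMap.evalCLM ℝ t : StrongDual ℝ CI).integral_comp_comm x1
    have e2 := (ContinuousMap.evalCLM ℝ t : StrongDual ℝ CI).integral_comp_comm x2
    simp only [ContinuousMap.evalCLM_apply] at e1 e2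
    rw [e1, e2]; rfl
  have hθc : Continuous θ := by
    have : θ = (∫ ω, X1 0 ω ∂P - ∫ ω, X2 0 ω ∂P : CI) := funext hθ'
    rw [this]; exact ContinuousMap.continuous _
  have hh := hh0_cont hθc hκl hκu
  have hat : Tendsto (fun k => √((m (k + N) : ℝ) + n (k + N))) atTop atTop := by
    refine Real.tendsto_sqrt_atTop.comp ?_
    exact tendsto_atTop_mono (fun k => le_add_of_nonneg_right (Nat.cast_nonneg _))
      ((tendsto_natCast_atTop_atTop (R := ℝ)).comp (hm.comp hshift))
  have hdel := delta (fun k => WW_meas hmeas1 hmeas2 _ _) hW hh hat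
  refine ⟨CI, inferInstance, (μ₀ : Measure CI), fun w => w, iμ, measurable_id, ?_, ?_⟩
  · convert hG using 3 with s t
    simp only [hμ1, hμ2]
  intro f
  rw [← tendsto_add_atTop_iff_nat N]
  have h2 := (ProbabilityMeasure.tendsto_iff_forall_integral_tendsto.1 hdel.tendsto) f
  refine Tendsto.congr ?_ (h2.trans (le_of_eq ?_))
  · intro k
    change ∫ x, f x ∂(P.map _) = _
    rw [integral_map (hdel.forall_aemeasurable k) f.continuous.aestronglyMeasurable]
    refine integral_congr_ae (ae_of_all _ fun ω => ?_)
    simp only [DD, Function.comp]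
    congr 2
    obtain ⟨a, b, -, -⟩ := hN (k + N) (Nat.le_add_left _ _)
    have p1 : (0:ℝ) < m (k + N) := by exact_mod_cast a
    have p2 : (0:ℝ) < n (k + N) := by exact_mod_cast b
    have ps : 0 < √((m (k + N) : ℝ) + n (k + N)) := Real.sqrt_pos.2 (by positivity)
    rw [← Tmax_eq hθc hκl hκu, ← Tmax_eq0 hθc hκl hκu]
    congr 2
    ext t
    rw [hθ' t]
    simp [WW, thetaHat2]
    field_simp
    ring
  · congr 1
    change ∫ x, f x ∂((μ₀ : Measure CI).map _) = _
    rw [integral_map hdel.aemeasurable_limit f.continuous.aestronglyMeasurable]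
    refine integral_congr_ae (ae_of_all _ fun w => ?_)
    simp only
    rw [Phi_eq hθc hκl hκu]
end
end

section
/- (Negligibility of averaged individual effects) Let (η_{i,j})_{i,j≥1} be an array of i.i.d. centered C([0,1])-valued random variables satisfying: E[‖η_{1,1}‖∞^{2+ν}] < ∞ for some ν > 0, E[‖η_{1,1}‖∞^4] < ∞, and |η_{i,j}(s) − η_{i,j}(t)| ≤ M·|s−t|^ϑ almost surely for all s,t ∈ [0,1], for some ϑ > 1/4 and a nonnegative random variable M with E[M^4] < ∞. For A ∈ ℕ and group sizes n₁,…,n_A ∈ ℕ define η̃_N = A^{-1/2}·Σ_{i=1}^A n_i^{-1}·Σ_{j=1}^{n_i} η_{i,j}. Then for every ε > 0, P( sup_{t∈[0,1]} |η̃_N(t)| > ε ) → 0 as A → ∞ and min_{i≤A} n_i → ∞. -/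
open MeasureTheory ProbabilityTheory Filter Topology

noncomputable section

def dyP (L i : ℕ) : I01 := Set.projIcc (0:ℝ) 1 zero_le_one ((i:ℝ) / 2 ^ L)

lemma dyP_double (L i : ℕ) : dyP (L+1) (2*i) = dyP L i := by
  unfold dyP
  congr 1
  push_cast
  rw [pow_succ]
  field_simp

lemma dyP_dist (L i : ℕ) : |((dyP L (i+1) : I01):ℝ) - (dyP L i : I01)| ≤ 1 / 2 ^ L := by
  unfold dyP
  refine (Set.abs_projIcc_sub_projIcc (h := zero_le_one)).trans ?_
  rw [← sub_div]
  push_cast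
  rw [add_sub_cancel_left, abs_of_nonneg (by positivity)]

lemma chain_det (f : I01 → ℝ) (δ : ℝ) (d : ℕ → ℝ) (hd : ∀ k, 0 ≤ d k)
    (h0 : |f (dyP 0 0)| ≤ δ)
    (h : ∀ k, ∀ i < 2 ^ k, |f (dyP k (i+1)) - f (dyP k i)| ≤ d k) :
    ∀ L, ∀ i ≤ 2 ^ L, |f (dyP L i)| ≤ δ + ∑ k ∈ Finset.range (L+1), d k := by
  intro L
  induction L with
  | zero =>
    intro i hi
    have hi' : i = 0 ∨ i = 1 := by simp at hi; omega
    rcases hi' with rfl | rfl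
    · simp; linarith [hd 0]
    · have := h 0 0 (by simp)
      have h2 := abs_sub_abs_le_abs_sub (f (dyP 0 1)) (f (dyP 0 0))
      simp at this ⊢
      linarith
  | succ L ih =>
    intro i hi
    rw [Finset.sum_range_succ]
    rcases Nat.even_or_odd' i with ⟨j, rfl | rfl⟩
    · rw [dyP_double]
      have := ih j (by rw [pow_succ] at hi; omega)
      linarith [hd (L+1)]
    · have h1 := ih j (by rw [pow_succ] at hi; omega)
      have h2 := h (L+1) (2*j) (by omega)
      have h3 := abs_sub_abs_le_abs_sub (f (dyP (L+1) (2*j+1))) (f (dyP (L+1) (2*j)))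
      rw [← dyP_double] at h1
      linarith

lemma dyP_tendsto (t : I01) : Tendsto (fun L : ℕ => dyP L ⌊(t:ℝ) * 2 ^ L⌋₊) atTop (𝓝 t) := by
  have h1 := (tendsto_nat_floor_mul_div_atTop (R := ℝ) t.2.1).comp
    (tendsto_pow_atTop_atTop_of_one_lt (r := (2:ℝ)) (by norm_num))
  have h2 := ((continuous_projIcc (a := (0:ℝ)) (b := 1) (h := zero_le_one)).tendsto (t:ℝ)).comp h1
  rw [Set.projIcc_val] at h2
  exact h2

lemma chain_cont (f : CI) (δ r : ℝ) (hδ : 0 ≤ δ) (hr : 0 ≤ r) (hr1 : r < 1)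
    (h0 : |f (dyP 0 0)| ≤ δ)
    (h : ∀ k, ∀ i < 2 ^ k, |f (dyP k (i+1)) - f (dyP k i)| ≤ δ * r ^ k) (t : I01) :
    |f t| ≤ δ * (1 + (1 - r)⁻¹) := by
  have h1 := ((f.continuous.abs).tendsto t).comp (dyP_tendsto t)
  refine le_of_tendsto h1 (Eventually.of_forall fun L => ?_)
  have h2 := chain_det f δ (fun k => δ * r ^ k) (fun k => by positivity) h0 h L ⌊(t:ℝ) * 2 ^ L⌋₊ (by
    refine Nat.floor_le_of_le ?_
    push_cast
    have := t.2.2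
    nlinarith [pow_pos (two_pos : (0:ℝ) < 2) L])
  refine h2.trans ?_
  rw [← Finset.mul_sum, mul_add, mul_one]
  gcongr
  rw [← tsum_geometric_of_lt_one hr hr1]
  exact (summable_geometric_of_lt_one hr hr1).sum_le_tsum _ (fun i _ => by positivity)

lemma chain_prob (ϑ : ℝ) (hϑ : 1/4 < ϑ) (ε : ℝ) (hε : 0 < ε) :
    ∃ B : ℝ, ∀ {Ω : Type*} [MeasurableSpace Ω] (P : Measure Ω) (Y : Ω → CI) (a : ℝ), 0 ≤ a →
      (∀ δ > 0, P {ω | δ < |Y ω (dyP 0 0)|} ≤ ENNReal.ofReal (a / δ ^ 4)) →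
      (∀ s t : I01, ∀ δ > 0, P {ω | δ < |Y ω s - Y ω t|} ≤
        ENNReal.ofReal (a * (|(s:ℝ) - t| ^ ϑ) ^ 4 / δ ^ 4)) →
      P {ω | ε < ⨆ t : I01, |Y ω t|} ≤ ENNReal.ofReal (a * B) := by
  set x : ℝ := (2:ℝ) ^ (-ϑ) with hx
  have hx0 : 0 < x := by positivity
  set ρ : ℝ := 2 * x ^ 4 with hρ
  have hρ0 : 0 < ρ := by positivity
  have hρ1 : ρ < 1 := by
    have : ρ = (2:ℝ) ^ (1 - 4 * ϑ) := by
      rw [hρ, hx, ← Real.rpow_natCast, ← Real.rpow_mul (by norm_num), Real.rpow_sub (by norm_num),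
        Real.rpow_one, div_eq_mul_inv, ← Real.rpow_neg (by norm_num)]
      congr 2; push_cast; ring
    rw [this]
    exact Real.rpow_lt_one_of_one_lt_of_neg (by norm_num) (by linarith)
  set r : ℝ := √√√ρ with hr
  have hr0 : 0 < r := by positivity
  have hr8 : r ^ 8 = ρ := by
    rw [show 8 = 2 * 2 * 2 from rfl, pow_mul, pow_mul, Real.sq_sqrt (by positivity),
      Real.sq_sqrt (by positivity), Real.sq_sqrt (by positivity)]
  have hr1 : r < 1 := by
    by_contra hcon
    push Not at hcon
    have := one_le_pow₀ hcon (n := 8)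
    linarith
  have hr41 : r ^ 4 < 1 := pow_lt_one₀ hr0.le hr1 (by norm_num)
  have h1r : 0 < 1 - r := by linarith
  set δ : ℝ := ε / (1 + (1 - r)⁻¹) with hδ
  have hδ0 : 0 < δ := by positivity
  refine ⟨(1 + (1 - r ^ 4)⁻¹) / δ ^ 4, ?_⟩
  intro Ω _ P Y a ha h0 hst
  have hsub : {ω | ε < ⨆ t : I01, |Y ω t|} ⊆ {ω | δ < |Y ω (dyP 0 0)|} ∪
      ⋃ k : ℕ, ⋃ i ∈ Finset.range (2 ^ k), {ω | δ * r ^ k < |Y ω (dyP k (i+1)) - Y ω (dyP k i)|} := by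
    intro ω hω
    by_contra hcon
    simp only [Set.mem_union, Set.mem_iUnion, Set.mem_ofPred_eq, not_or, not_exists, not_lt,
      Finset.mem_range] at hcon
    have := chain_cont (Y ω) δ r hδ0.le hr0.le hr1 hcon.1 (fun k i hi => hcon.2 k i hi)
    have h3 : δ * (1 + (1 - r)⁻¹) = ε := by
      rw [hδ]; field_simp
    rw [h3] at this
    have : ⨆ t : I01, |Y ω t| ≤ ε := ciSup_le this
    exact absurd hω (not_lt.mpr this)
  have hk : ∀ k : ℕ, P (⋃ i ∈ Finset.range (2 ^ k),
      {ω | δ * r ^ k < |Y ω (dyP k (i+1)) - Y ω (dyP k i)|}) ≤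
      ENNReal.ofReal (a / δ ^ 4 * (r ^ 4) ^ k) := by
    intro k
    refine (measure_biUnion_finset_le _ _).trans ?_
    have : ∀ i ∈ Finset.range (2 ^ k), P {ω | δ * r ^ k < |Y ω (dyP k (i+1)) - Y ω (dyP k i)|} ≤
        ENNReal.ofReal (a * (x ^ k) ^ 4 / (δ * r ^ k) ^ 4) := by
      intro i _
      refine (hst _ _ _ (by positivity)).trans (ENNReal.ofReal_le_ofReal ?_)
      have h5 : |((dyP k (i+1) : I01):ℝ) - (dyP k i : I01)| ^ ϑ ≤ x ^ k := by
        refine (Real.rpow_le_rpow (abs_nonneg _) (dyP_dist k i) (by linarith)).trans (le_of_eq ?_)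
        rw [hx, one_div, Real.inv_rpow (by positivity), ← Real.rpow_natCast, ← Real.rpow_natCast,
          ← Real.rpow_mul (by norm_num), ← Real.rpow_mul (by norm_num), ← Real.rpow_neg (by norm_num)]
        congr 1; ring
      gcongr
    refine (Finset.sum_le_sum this).trans ?_
    rw [Finset.sum_const, Finset.card_range, nsmul_eq_mul, ← ENNReal.ofReal_natCast,
      ← ENNReal.ofReal_mul (by positivity)]
    refine ENNReal.ofReal_le_ofReal (le_of_eq ?_)
    push_cast
    have h6 : (2:ℝ) ^ k * (x ^ k) ^ 4 = (r ^ k) ^ 8 := by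
      rw [← pow_mul, ← pow_mul r, mul_comm k 8, pow_mul r, hr8, hρ, mul_pow, mul_comm k 4, pow_mul x]
    have h7 : (2:ℝ) ^ k * (a * (x ^ k) ^ 4 / (δ * r ^ k) ^ 4) = a * ((2:ℝ) ^ k * (x ^ k) ^ 4) / (δ * r ^ k) ^ 4 := by
      ring
    rw [h7, h6]
    have : r ^ k ≠ 0 := by positivity
    have h8 : (r ^ 4) ^ k = (r ^ k) ^ 4 := by rw [← pow_mul, ← pow_mul, mul_comm]
    rw [h8]
    field_simp
  have hpos4 : 0 < 1 - r ^ 4 := by linarith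
  calc P {ω | ε < ⨆ t : I01, |Y ω t|} ≤ _ := measure_mono hsub
    _ ≤ _ := measure_union_le _ _
    _ ≤ ENNReal.ofReal (a / δ ^ 4) + ∑' k : ℕ, ENNReal.ofReal (a / δ ^ 4 * (r ^ 4) ^ k) :=
        add_le_add (h0 _ hδ0) ((measure_iUnion_le _).trans (ENNReal.tsum_le_tsum hk))
    _ = ENNReal.ofReal (a / δ ^ 4) + ENNReal.ofReal (a / δ ^ 4 * (1 - r ^ 4)⁻¹) := by
        rw [← ENNReal.ofReal_tsum_of_nonneg (fun k => by positivity)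
          ((summable_geometric_of_lt_one (by positivity) hr41).mul_left _), tsum_mul_left,
          tsum_geometric_of_lt_one (by positivity) hr41]
    _ = _ := by
        rw [← ENNReal.ofReal_add (by positivity) (by positivity)]
        congr 1; ring

lemma fourth_moment {Ω ι : Type*} [MeasurableSpace Ω] (P : Measure Ω) [IsProbabilityMeasure P]
    (X : ι → Ω → ℝ) (hX : ∀ i, Measurable (X i)) (hind : iIndepFun X P)
    (hL : ∀ i, MemLp (X i) 4 P) (h0 : ∀ i, ∫ ω, X i ω ∂P = 0)
    (c : ι → ℝ) (hc0 : ∀ i, 0 ≤ c i)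
    (hc4 : ∀ i, ∫ ω, X i ω ^ 4 ∂P ≤ c i ^ 2) (s : Finset ι) :
    ∫ ω, (∑ i ∈ s, X i ω) ∂P = 0 ∧
    ∫ ω, (∑ i ∈ s, X i ω) ^ 2 ∂P ≤ ∑ i ∈ s, c i ∧
    ∫ ω, (∑ i ∈ s, X i ω) ^ 4 ∂P ≤ 3 * (∑ i ∈ s, c i) ^ 2 := by
  classical
  have hpow : ∀ (f : Ω → ℝ), MemLp f 4 P → ∀ p : ℕ, p ≤ 4 → Integrable (fun ω => f ω ^ p) P := by
    intro f hf p hp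
    have h1 : MemLp f p P := hf.mono_exponent (by exact_mod_cast hp)
    have h2 := h1.integrable_norm_pow'
    refine (integrable_norm_iff (hf.1.pow p)).mp ?_
    simpa [norm_pow] using h2
  have hc2 : ∀ i, ∫ ω, X i ω ^ 2 ∂P ≤ c i := by
    intro i
    set v := ∫ ω, X i ω ^ 2 ∂P with hv
    have h1 : 0 ≤ ∫ ω, (X i ω ^ 2 - v) ^ 2 ∂P := integral_nonneg fun ω => by positivity
    have h2 : ∀ ω, (X i ω ^ 2 - v) ^ 2 = X i ω ^ 4 - 2 * v * X i ω ^ 2 + v ^ 2 := fun ω => by ring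
    have i4 := hpow _ (hL i) 4 (by norm_num)
    have i2 := (hpow _ (hL i) 2 (by norm_num)).const_mul (2 * v)
    simp only [h2] at h1
    rw [integral_add (f := fun ω => X i ω ^ 4 - 2 * v * X i ω ^ 2) (i4.sub i2) (integrable_const _), integral_sub i4 i2, integral_const_mul,
      ← hv, integral_const] at h1
    simp at h1
    exact (sq_le_sq₀ (integral_nonneg fun ω => by positivity) (hc0 i)).mp (by nlinarith [hc4 i])
  induction s using Finset.induction_on with
  | empty => simp
  | insert a s ha ih =>
    obtain ⟨ih1, ih2, ih4⟩ := ih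
    set S : Ω → ℝ := fun ω => ∑ i ∈ s, X i ω with hS
    have hSL : MemLp S 4 P := memLp_finsetSum s (fun i _ => hL i)
    have hSX : IndepFun S (X a) P := by
      have := hind.indepFun_finsetSum_of_notMem hX ha
      convert this using 1
      ext ω; simp [hS]
    have hprod : ∀ p q : ℕ, p ≤ 4 → q ≤ 4 → Integrable (fun ω => S ω ^ p * X a ω ^ q) P ∧
        ∫ ω, S ω ^ p * X a ω ^ q ∂P = (∫ ω, S ω ^ p ∂P) * ∫ ω, X a ω ^ q ∂P := by
      intro p q hp hq
      have hi : IndepFun (fun ω => S ω ^ p) (fun ω => X a ω ^ q) P :=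
        hSX.comp (φ := fun x => x ^ p) (ψ := fun x => x ^ q) (by fun_prop) (by fun_prop)
      refine ⟨hi.integrable_mul (hpow _ hSL p hp) (hpow _ (hL a) q hq), ?_⟩
      exact hi.integral_fun_mul_eq_mul_integral (hpow _ hSL p hp).1 (hpow _ (hL a) q hq).1
    have e1 := hprod 1 1 (by norm_num) (by norm_num)
    have e31 := hprod 3 1 (by norm_num) (by norm_num)
    have e22 := hprod 2 2 (by norm_num) (by norm_num)
    have e13 := hprod 1 3 (by norm_num) (by norm_num)
    have iS1 := hpow _ hSL 1 (by norm_num)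
    have iS2 := hpow _ hSL 2 (by norm_num)
    have iS4 := hpow _ hSL 4 (by norm_num)
    have iX1 := hpow _ (hL a) 1 (by norm_num)
    have iX2 := hpow _ (hL a) 2 (by norm_num)
    have iX4 := hpow _ (hL a) 4 (by norm_num)
    simp only [pow_one, ih1, h0 a, zero_mul, mul_zero] at e1 e31 e13 iS1 iX1
    simp only [Finset.sum_insert ha]
    change ∫ ω, X a ω + S ω ∂P = 0 ∧ ∫ ω, (X a ω + S ω) ^ 2 ∂P ≤ _ ∧ ∫ ω, (X a ω + S ω) ^ 4 ∂P ≤ _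
    refine ⟨?_, ?_, ?_⟩
    · rw [integral_add iX1 iS1, h0, ih1, add_zero]
    · have : ∀ ω, (X a ω + S ω) ^ 2 = X a ω ^ 2 + (2 * (S ω * X a ω) + S ω ^ 2) := fun ω => by ring
      simp only [this]
      rw [integral_add iX2 ((e1.1.const_mul 2).fun_add iS2), integral_add (e1.1.const_mul 2) iS2,
        integral_const_mul, e1.2]
      linarith [hc2 a]
    · have : ∀ ω, (X a ω + S ω) ^ 4 = X a ω ^ 4 + (4 * (S ω * X a ω ^ 3) +
          (6 * (S ω ^ 2 * X a ω ^ 2) + (4 * (S ω ^ 3 * X a ω) + S ω ^ 4))) := fun ω => by ring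
      simp only [this]
      have j1 := (e31.1.const_mul 4).fun_add iS4
      have j2 := (e22.1.const_mul 6).fun_add j1
      have j3 := (e13.1.const_mul 4).fun_add j2
      rw [integral_add iX4 j3, integral_add (e13.1.const_mul 4) j2,
        integral_add (e22.1.const_mul 6) j1, integral_add (e31.1.const_mul 4) iS4,
        integral_const_mul, integral_const_mul, integral_const_mul, e13.2, e22.2, e31.2]
      have hT : 0 ≤ ∑ i ∈ s, c i := Finset.sum_nonneg (fun i _ => hc0 i)
      have hm : (∫ ω, S ω ^ 2 ∂P) * ∫ ω, X a ω ^ 2 ∂P ≤ (∑ i ∈ s, c i) * c a :=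
        mul_le_mul ih2 (hc2 a) (integral_nonneg fun ω => by positivity) hT
      nlinarith [hc4 a, sq_nonneg (c a)]

lemma markov4_s8 {Ω : Type*} [MeasurableSpace Ω] (P : Measure Ω) [IsProbabilityMeasure P]
    (X : Ω → ℝ) (hX : Integrable (fun ω => X ω ^ 4) P) (b : ℝ) (hb : ∫ ω, X ω ^ 4 ∂P ≤ b)
    (δ : ℝ) (hδ : 0 < δ) : P {ω | δ < |X ω|} ≤ ENNReal.ofReal (b / δ ^ 4) := by
  have h1 := mul_meas_ge_le_integral_of_nonneg (μ := P) (f := fun ω => X ω ^ 4)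
    (Eventually.of_forall fun ω => by positivity) hX (δ ^ 4)
  have h2 : P {ω | δ < |X ω|} ≤ P {ω | δ ^ 4 ≤ X ω ^ 4} := by
    refine measure_mono fun ω hω => ?_
    have : δ < |X ω| := hω
    have h3 : δ ^ 4 ≤ |X ω| ^ 4 := by gcongr
    simpa [Even.pow_abs (by decide : Even 4)] using h3
  refine h2.trans ?_
  rw [← ofReal_measureReal]
  refine ENNReal.ofReal_le_ofReal ?_
  rw [le_div_iff₀ (by positivity)]
  linarith

lemma weighted {Ω : Type*} [MeasurableSpace Ω] (P : Measure Ω) [IsProbabilityMeasure P]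
    (X : ℕ → ℕ → Ω → ℝ) (hX : ∀ i j, Measurable (X i j))
    (hind : iIndepFun (fun (p : ℕ × ℕ) ω => X p.1 p.2 ω) P)
    (h0 : ∀ i j, ∫ ω, X i j ω ∂P = 0) (κ : ℝ) (hκ : 0 ≤ κ)
    (h4 : ∀ i j, ∫⁻ ω, ENNReal.ofReal (X i j ω ^ 4) ∂P ≤ ENNReal.ofReal (κ ^ 2))
    (A : ℕ) (hA : 0 < A) (n : ℕ → ℕ) (m : ℕ) (hm : 0 < m) (hn : ∀ i < A, m ≤ n i)
    (δ : ℝ) (hδ : 0 < δ) :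
    P {ω | δ < |(Real.sqrt A)⁻¹ * ∑ i ∈ Finset.range A,
          (n i : ℝ)⁻¹ * ∑ j ∈ Finset.range (n i), X i j ω|} ≤
      ENNReal.ofReal (3 * (κ / m) ^ 2 / δ ^ 4) := by
  have hint : ∀ i j, Integrable (fun ω => X i j ω ^ 4) P := by
    intro i j
    refine ⟨((hX i j).pow_const 4).aestronglyMeasurable, ?_⟩
    rw [hasFiniteIntegral_iff_ofReal (Eventually.of_forall fun ω => by positivity)]
    exact (h4 i j).trans_lt ENNReal.ofReal_lt_top
  have hint4 : ∀ i j, ∫ ω, X i j ω ^ 4 ∂P ≤ κ ^ 2 := by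
    intro i j
    rw [integral_eq_lintegral_of_nonneg_ae (Eventually.of_forall fun ω => by positivity) (hint i j).1]
    exact ENNReal.toReal_le_of_le_ofReal (by positivity) (h4 i j)
  have hL : ∀ i j, MemLp (X i j) 4 P := by
    intro i j
    rw [← integrable_norm_rpow_iff (hX i j).aestronglyMeasurable (by norm_num) (by norm_num)]
    convert hint i j using 2 with ω
    rw [show (ENNReal.toReal 4) = ((4:ℕ):ℝ) by norm_num, Real.rpow_natCast, Real.norm_eq_abs,
      Even.pow_abs (by decide)]
  set w : ℕ → ℝ := fun i => (Real.sqrt A)⁻¹ * (n i : ℝ)⁻¹ with hw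
  set Z : (Σ _ : ℕ, ℕ) → Ω → ℝ := fun p ω => w p.1 * X p.1 p.2 ω with hZ
  set c : (Σ _ : ℕ, ℕ) → ℝ := fun p => w p.1 ^ 2 * κ with hc
  set s : Finset (Σ _ : ℕ, ℕ) := (Finset.range A).sigma (fun i => Finset.range (n i)) with hs
  have hZm : ∀ p, Measurable (Z p) := fun p => (hX _ _).const_mul _
  have hZind : iIndepFun Z P := by
    have h1 := hind.precomp (g := fun p : (Σ _ : ℕ, ℕ) => (p.1, p.2)) (by
      rintro ⟨a, b⟩ ⟨c, d⟩ h; simpa using h)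
    exact h1.comp (fun p x => w p.1 * x) (fun p => by fun_prop)
  have hZL : ∀ p, MemLp (Z p) 4 P := fun p => (hL _ _).const_mul _
  have key := (fourth_moment P Z hZm hZind hZL
    (fun p => by simp only [hZ]; rw [integral_const_mul, h0, mul_zero]) c
    (fun p => by positivity) (fun p => by
      simp only [hZ, hc, mul_pow]
      rw [integral_const_mul, ← pow_mul]
      exact mul_le_mul_of_nonneg_left (hint4 _ _) (by positivity)) s).2.2
  have hsum : ∀ ω, ∑ p ∈ s, Z p ω = (Real.sqrt A)⁻¹ * ∑ i ∈ Finset.range A,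
          (n i : ℝ)⁻¹ * ∑ j ∈ Finset.range (n i), X i j ω := by
    intro ω
    rw [hs, Finset.sum_sigma, Finset.mul_sum]
    refine Finset.sum_congr rfl fun i _ => ?_
    simp only [hZ, hw]
    rw [← Finset.mul_sum, mul_assoc]
  have hA' : (0:ℝ) < A := by exact_mod_cast hA
  have hm' : (0:ℝ) < m := by exact_mod_cast hm
  have hcs : ∑ p ∈ s, c p ≤ κ / m := by
    rw [hs, Finset.sum_sigma]
    have : ∀ i ∈ Finset.range A, ∑ j ∈ Finset.range (n i), c ⟨i, j⟩ ≤ (A:ℝ)⁻¹ * (κ / m) := by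
      intro i hi
      have hni : (m:ℝ) ≤ n i := by exact_mod_cast hn i (Finset.mem_range.mp hi)
      have hni0 : (0:ℝ) < n i := lt_of_lt_of_le hm' hni
      simp only [hc, hw, Finset.sum_const, Finset.card_range, nsmul_eq_mul]
      rw [mul_pow, inv_pow, Real.sq_sqrt hA'.le]
      have : (n i:ℝ) * ((A:ℝ)⁻¹ * (n i:ℝ)⁻¹ ^ 2 * κ) = (A:ℝ)⁻¹ * (κ / n i) := by
        field_simp
      rw [this]
      gcongr
    refine (Finset.sum_le_sum this).trans (le_of_eq ?_)
    rw [Finset.sum_const, Finset.card_range, nsmul_eq_mul]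
    field_simp
  have hc0 : 0 ≤ ∑ p ∈ s, c p := Finset.sum_nonneg fun p _ => by positivity
  have hSL : MemLp (fun ω => ∑ p ∈ s, Z p ω) 4 P := memLp_finsetSum s (fun i _ => hZL i)
  have hSi : Integrable (fun ω => (∑ p ∈ s, Z p ω) ^ 4) P := by
    have h2 := hSL.integrable_norm_pow (by norm_num : (4:ℕ) ≠ 0)
    refine (integrable_norm_iff (hSL.1.pow 4)).mp ?_
    simpa [norm_pow] using h2
  have := markov4_s8 P (fun ω => ∑ p ∈ s, Z p ω) hSi (3 * (κ / m) ^ 2)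
    (key.trans (by gcongr)) δ hδ
  simpa only [hsum] using this

/-- **Negligibility of averaged individual effects.**
Let `(η_{i,j})` be an i.i.d. array of centered `C([0,1])`-valued random variables with
`E[‖η‖^{2+ν}] < ∞` for some `ν > 0`, `E[‖η‖⁴] < ∞`, and an a.s. Hölder condition
`|η_{i,j}(s)−η_{i,j}(t)| ≤ M·|s−t|^ϑ` with `ϑ > 1/4`, `E[M⁴] < ∞`. Then
`η̃_N = A^{-1/2} Σ_{i<A} n_i^{-1} Σ_{j<n_i} η_{i,j}` satisfies
`P(sup_t |η̃_N(t)| > ε) → 0` as `A → ∞` and `min_i n_i → ∞` (along any such sequences). -/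
theorem statement8 {Ω : Type*} [MeasurableSpace Ω] (P : Measure Ω) [IsProbabilityMeasure P]
    [MeasurableSpace CI] [BorelSpace CI]
    (η : ℕ → ℕ → Ω → CI) (hmeas : ∀ i j, Measurable (η i j))
    (hindep : iIndepFun (m := fun _ : ℕ × ℕ => (inferInstance : MeasurableSpace CI))
      (fun p ω => η p.1 p.2 ω) P)
    (hid : ∀ i j, Measure.map (η i j) P = Measure.map (η 0 0) P)
    (hcent : ∀ i j (t : I01), ∫ ω, η i j ω t ∂P = 0)
    (ν : ℝ) (hν : 0 < ν)
    (hmom1 : ∫⁻ ω, ENNReal.ofReal (‖η 0 0 ω‖ ^ ((2:ℝ) + ν)) ∂P < ⊤)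
    (hmom2 : ∫⁻ ω, ENNReal.ofReal (‖η 0 0 ω‖ ^ ((4:ℝ))) ∂P < ⊤)
    (ϑ : ℝ) (hϑ : 1/4 < ϑ) (M : Ω → ℝ) (hM0 : ∀ ω, 0 ≤ M ω)
    (hM4 : ∫⁻ ω, ENNReal.ofReal (M ω ^ ((4:ℝ))) ∂P < ⊤)
    (hHold : ∀ i j, ∀ᵐ ω ∂P, ∀ s t : I01,
      |η i j ω s - η i j ω t| ≤ M ω * |(s : ℝ) - (t : ℝ)| ^ ϑ)
    -- sequences `A k → ∞` and group sizes `n k i` with `min_{i < A k} n k i → ∞`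
    (A : ℕ → ℕ) (hApos : ∀ k, 0 < A k) (hA : Tendsto A atTop atTop)
    (n : ℕ → ℕ → ℕ)
    (hmin : Tendsto (fun k => (Finset.range (A k)).inf'
      (Finset.nonempty_range_iff.mpr (hApos k).ne') (n k)) atTop atTop) :
    ∀ ε > (0:ℝ),
      Tendsto (fun k => (P {ω | ε < ⨆ t : I01,
        |(Real.sqrt (A k))⁻¹ * ∑ i ∈ Finset.range (A k),
          (n k i : ℝ)⁻¹ * ∑ j ∈ Finset.range (n k i), η i j ω t|}).toReal)
        atTop (𝓝 0) := by
  intro ε hε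
  obtain ⟨B, hB⟩ := chain_prob ϑ hϑ ε hε
  set K : ℝ := (∫⁻ ω, ENNReal.ofReal (‖η 0 0 ω‖ ^ ((4:ℝ))) ∂P).toReal +
    (∫⁻ ω, ENNReal.ofReal (M ω ^ ((4:ℝ))) ∂P).toReal with hK
  have hK0 : 0 ≤ K := by positivity
  have hK1 : ∫⁻ ω, ENNReal.ofReal (‖η 0 0 ω‖ ^ ((4:ℝ))) ∂P ≤ ENNReal.ofReal K := by
    rw [← ENNReal.ofReal_toReal hmom2.ne]
    exact ENNReal.ofReal_le_ofReal (by rw [hK]; exact le_add_of_nonneg_right (by positivity))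
  have hK2 : ∫⁻ ω, ENNReal.ofReal (M ω ^ ((4:ℝ))) ∂P ≤ ENNReal.ofReal K := by
    rw [← ENNReal.ofReal_toReal hM4.ne]
    exact ENNReal.ofReal_le_ofReal (by rw [hK]; exact le_add_of_nonneg_left (by positivity))
  have hev : ∀ t : I01, Measurable (fun f : CI => f t) :=
    fun t => (continuous_eval_const t).measurable
  have hηn : ∀ i j, ∫⁻ ω, ENNReal.ofReal (‖η i j ω‖ ^ ((4:ℝ))) ∂P ≤ ENNReal.ofReal K := by
    intro i j
    have hg : Measurable (fun f : CI => ENNReal.ofReal (‖f‖ ^ (4:ℝ))) :=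
      ((continuous_norm (E := CI)).measurable.pow_const _).ennreal_ofReal
    rw [← lintegral_map hg (hmeas i j), hid i j, lintegral_map hg (hmeas 0 0)]
    exact hK1
  have hη4 : ∀ (t : I01) i j, ∫⁻ ω, ENNReal.ofReal (η i j ω t ^ 4) ∂P ≤ ENNReal.ofReal K := by
    intro t i j
    refine (lintegral_mono fun ω => ENNReal.ofReal_le_ofReal ?_).trans (hηn i j)
    have h1 : |η i j ω t| ≤ ‖η i j ω‖ := (η i j ω).norm_coe_le_norm t
    rw [show ((4:ℝ)) = ((4:ℕ):ℝ) by norm_num, Real.rpow_natCast,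
      ← Even.pow_abs (by decide : Even 4)]
    gcongr
  have hint : ∀ (t : I01) i j, Integrable (fun ω => η i j ω t) P := by
    intro t i j
    have hm := (hev t).comp (hmeas i j)
    have h4 : Integrable (fun ω => η i j ω t ^ 4) P := by
      refine ⟨(hm.pow_const 4).aestronglyMeasurable, ?_⟩
      rw [hasFiniteIntegral_iff_ofReal (Eventually.of_forall fun ω => by positivity)]
      exact (hη4 t i j).trans_lt ENNReal.ofReal_lt_top
    refine ((integrable_const (1:ℝ)).add h4).mono' hm.aestronglyMeasurable
      (Eventually.of_forall fun ω => ?_)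
    simp only [Function.comp, Real.norm_eq_abs, Pi.add_apply]
    rw [← Even.pow_abs (by decide : Even 4)]
    have := abs_nonneg (η i j ω t)
    nlinarith [sq_nonneg (|η i j ω t| ^ 2 - 1), sq_nonneg (|η i j ω t| - 1), sq_nonneg (|η i j ω t|)]
  set m : ℕ → ℕ := fun k => (Finset.range (A k)).inf'
      (Finset.nonempty_range_iff.mpr (hApos k).ne') (n k) with hmdef
  have hbound : ∀ k, 0 < m k → P {ω | ε < ⨆ t : I01,
        |(Real.sqrt (A k))⁻¹ * ∑ i ∈ Finset.range (A k),
          (n k i : ℝ)⁻¹ * ∑ j ∈ Finset.range (n k i), η i j ω t|} ≤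
        ENNReal.ofReal (3 * K / (m k : ℝ) ^ 2 * B) := by
    intro k hmk
    have hn : ∀ i < A k, m k ≤ n k i := fun i hi => Finset.inf'_le _ (Finset.mem_range.mpr hi)
    have hYt : ∀ ω (t : I01), ((Real.sqrt (A k))⁻¹ • ∑ i ∈ Finset.range (A k),
          (n k i : ℝ)⁻¹ • ∑ j ∈ Finset.range (n k i), η i j ω : CI) t =
          (Real.sqrt (A k))⁻¹ * ∑ i ∈ Finset.range (A k),
          (n k i : ℝ)⁻¹ * ∑ j ∈ Finset.range (n k i), η i j ω t := by
      intro ω t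
      simp [ContinuousMap.sum_apply]
    have := hB P (fun ω => (Real.sqrt (A k))⁻¹ • ∑ i ∈ Finset.range (A k),
          (n k i : ℝ)⁻¹ • ∑ j ∈ Finset.range (n k i), η i j ω) (3 * K / (m k : ℝ) ^ 2)
          (by positivity) ?_ ?_
    · simpa only [hYt] using this
    · intro δ hδ
      simp only [hYt]
      have h1 := weighted P (fun i j ω => η i j ω (dyP 0 0)) (fun i j => (hev _).comp (hmeas i j))
        (hindep.comp (fun _ f => f (dyP 0 0)) (fun _ => hev _)) (fun i j => hcent i j _)
        (√K) (by positivity) (fun i j => by rw [Real.sq_sqrt hK0]; exact hη4 _ i j)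
        (A k) (hApos k) (n k) (m k) hmk hn δ hδ
      rw [div_pow, Real.sq_sqrt hK0, ← mul_div_assoc] at h1
      exact h1
    · intro s t δ hδ
      simp only [hYt]
      have h1 := weighted P (fun i j ω => η i j ω s - η i j ω t)
        (fun i j => ((hev s).comp (hmeas i j)).sub ((hev t).comp (hmeas i j)))
        (hindep.comp (fun _ f => f s - f t) (fun _ => (hev s).sub (hev t)))
        (fun i j => by rw [integral_sub (hint s i j) (hint t i j), hcent, hcent, sub_zero])
        (√K * (|(s:ℝ) - t| ^ ϑ) ^ 2) (by positivity) (fun i j => by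
          rw [mul_pow, Real.sq_sqrt hK0, ← pow_mul]
          set x := |(s:ℝ) - t| ^ ϑ with hx
          have hx0 : 0 ≤ x := by positivity
          calc ∫⁻ ω, ENNReal.ofReal ((η i j ω s - η i j ω t) ^ 4) ∂P
              ≤ ∫⁻ ω, ENNReal.ofReal (x ^ 4) * ENNReal.ofReal (M ω ^ (4:ℝ)) ∂P := by
                refine lintegral_mono_ae ?_
                filter_upwards [hHold i j] with ω hω
                rw [← ENNReal.ofReal_mul (by positivity)]
                refine ENNReal.ofReal_le_ofReal ?_
                rw [show ((4:ℝ)) = ((4:ℕ):ℝ) by norm_num, Real.rpow_natCast,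
                  ← Even.pow_abs (by decide : Even 4) (η i j ω s - η i j ω t), ← mul_pow, mul_comm x]
                have := hω s t
                gcongr
            _ = ENNReal.ofReal (x ^ 4) * ∫⁻ ω, ENNReal.ofReal (M ω ^ (4:ℝ)) ∂P :=
                lintegral_const_mul' _ _ ENNReal.ofReal_ne_top
            _ ≤ ENNReal.ofReal (x ^ 4) * ENNReal.ofReal K := by gcongr
            _ = ENNReal.ofReal (K * x ^ (2 * 2)) := by
                rw [← ENNReal.ofReal_mul (by positivity), mul_comm])
        (A k) (hApos k) (n k) (m k) hmk hn δ hδ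
      have h2 : 3 * (√K * (|(s:ℝ) - t| ^ ϑ) ^ 2 / m k) ^ 2 =
          3 * K / (m k : ℝ) ^ 2 * (|(s:ℝ) - t| ^ ϑ) ^ 4 := by
        rw [div_pow, mul_pow, Real.sq_sqrt hK0]; ring
      rw [h2] at h1
      convert h1 using 6
      simp only [mul_sub, Finset.sum_sub_distrib]
  have hlim : Tendsto (fun k => (ENNReal.ofReal (3 * K / (m k : ℝ) ^ 2 * B)).toReal) atTop (𝓝 0) := by
    have h1 : Tendsto (fun k => ((m k : ℕ) : ℝ) ^ 2) atTop atTop :=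
      (tendsto_pow_atTop (by norm_num)).comp (tendsto_natCast_atTop_atTop.comp hmin)
    have h2 := (h1.const_div_atTop (3 * K)).mul_const B
    rw [zero_mul] at h2
    have h3 := (ENNReal.continuous_ofReal.tendsto 0).comp h2
    rw [ENNReal.ofReal_zero] at h3
    have h4 := (ENNReal.tendsto_toReal ENNReal.zero_ne_top).comp h3
    exact h4
  refine tendsto_of_tendsto_of_tendsto_of_le_of_le' tendsto_const_nhds hlim
    (Eventually.of_forall fun k => ENNReal.toReal_nonneg) ?_
  filter_upwards [hmin.eventually_gt_atTop 0] with k hk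
  exact ENNReal.toReal_mono ENNReal.ofReal_ne_top (hbound k hk)
end
end

section
/- (Variance estimator expansion) In the functional random effects model under Assumption D, assume A → ∞, min_{i≤A} n_i → ∞ and A/√N → 0. Then for l = 1,2: √N · sup_{t∈[0,1]} | σ̂_l²(t) − (1/(N−A))·Σ_{i=1}^A Σ_{j=1}^{n_i} η_{l,i,j}(t)² | → 0 in probability, where σ̂_l²(t) = (1/(N−A))·Σ_{i=1}^A Σ_{j=1}^{n_i} ( X_{l,i,j}(t) − X̄_{l,i,·}(t) )². -/
open MeasureTheory ProbabilityTheory Filter Topology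

noncomputable section

/-- The combined family of group-effect pairs and individual-effect pairs, used to state
joint independence in the functional random effects model. -/
def effFam {Ω : Type*} (ε1 ε2 : ℕ → Ω → CI) (η1 η2 : ℕ → ℕ → Ω → CI) :
    (ℕ ⊕ ℕ × ℕ) → Ω → CI × CI
  | Sum.inl i => fun ω => (ε1 i ω, ε2 i ω)
  | Sum.inr p => fun ω => (η1 p.1 p.2 ω, η2 p.1 p.2 ω)

/-- Observation `X_{l,i,j}(t) = μ_l(t) + ε_{l,i}(t) + η_{l,i,j}(t)` evaluated at `t`. -/
noncomputable def Xre {Ω : Type*} (μ : CI) (ε : ℕ → Ω → CI) (η : ℕ → ℕ → Ω → CI)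
    (i j : ℕ) (ω : Ω) (t : I01) : ℝ :=
  μ t + ε i ω t + η i j ω t

/-- Group mean `X̄_{l,i,·}(t)` of the `i`-th group with `ni` observations. -/
noncomputable def XbarRe {Ω : Type*} (μ : CI) (ε : ℕ → Ω → CI) (η : ℕ → ℕ → Ω → CI)
    (ni i : ℕ) (ω : Ω) (t : I01) : ℝ :=
  (ni : ℝ)⁻¹ * ∑ j ∈ Finset.range ni, Xre μ ε η i j ω t

/-- Pooled variance estimator `σ̂²(t) = (N−A)^{-1} Σ_i Σ_j (X_{i,j}(t) − X̄_{i,·}(t))²`. -/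
noncomputable def sigmaHatSq {Ω : Type*} (μ : CI) (ε : ℕ → Ω → CI) (η : ℕ → ℕ → Ω → CI)
    (A : ℕ) (n : ℕ → ℕ) (ω : Ω) (t : I01) : ℝ :=
  ((∑ i ∈ Finset.range A, (n i : ℝ)) - (A : ℝ))⁻¹ *
    ∑ i ∈ Finset.range A, ∑ j ∈ Finset.range (n i),
      (Xre μ ε η i j ω t - XbarRe μ ε η (n i) i ω t) ^ 2

lemma pow_int_of4 {Ω : Type*} [MeasurableSpace Ω] {P : Measure Ω} [IsProbabilityMeasure P]
    {Y : Ω → ℝ} (hm : Measurable Y) (h4 : Integrable (fun ω => Y ω ^ 4) P) (a : ℕ) (ha : a ≤ 4) :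
    Integrable (fun ω => Y ω ^ a) P := by
  refine Integrable.mono' ((integrable_const (1:ℝ)).add h4) (hm.pow_const a).aestronglyMeasurable ?_
  refine ae_of_all _ fun ω => ?_
  have h : Y ω ^ 4 = |Y ω| ^ 4 := by rw [Even.pow_abs (by decide)]
  simp only [Real.norm_eq_abs, abs_pow, Pi.add_apply, h]
  rcases le_total (|Y ω|) 1 with h1 | h1
  · have := pow_le_one₀ (n := a) (abs_nonneg (Y ω)) h1
    have : 0 ≤ |Y ω| ^ 4 := by positivity
    linarith
  · have := pow_le_pow_right₀ h1 ha
    linarith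

lemma fourth_sum {Ω : Type*} [MeasurableSpace Ω] {P : Measure Ω} [IsProbabilityMeasure P]
    (Y : ℕ → Ω → ℝ) (hm : ∀ j, Measurable (Y j)) (hi : iIndepFun Y P)
    (h4 : ∀ j, Integrable (fun ω => Y j ω ^ 4) P) (h0 : ∀ j, ∫ ω, Y j ω ∂P = 0)
    (c : ℝ) (hc : ∀ j, ∫ ω, Y j ω ^ 4 ∂P ≤ c ^ 2) (hc0 : 0 ≤ c) (n : ℕ) :
    Integrable (fun ω => (∑ j ∈ Finset.range n, Y j ω) ^ 4) P ∧
    ∫ ω, (∑ j ∈ Finset.range n, Y j ω) ∂P = 0 ∧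
    ∫ ω, (∑ j ∈ Finset.range n, Y j ω) ^ 2 ∂P ≤ n * c ∧
    ∫ ω, (∑ j ∈ Finset.range n, Y j ω) ^ 4 ∂P ≤ 3 * n ^ 2 * c ^ 2 := by
  have h2 : ∀ j, ∫ ω, Y j ω ^ 2 ∂P ≤ c := by
    intro j
    have hv : 0 ≤ ∫ ω, (Y j ω ^ 2 - ∫ ω, Y j ω ^ 2 ∂P) ^ 2 ∂P := integral_nonneg fun ω => sq_nonneg _
    set m := ∫ ω, Y j ω ^ 2 ∂P with hmdef
    have i2 := pow_int_of4 (hm j) (h4 j) 2 (by norm_num)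
    have e : ∫ ω, (Y j ω ^ 2 - m) ^ 2 ∂P = ∫ ω, Y j ω ^ 4 ∂P - m ^ 2 := by
      have : (fun ω => (Y j ω ^ 2 - m) ^ 2) = fun ω => Y j ω ^ 4 - 2 * m * Y j ω ^ 2 + m ^ 2 := by
        funext ω; ring
      have t1 : Integrable (fun ω => Y j ω ^ 4 - 2 * m * Y j ω ^ 2) P := (h4 j).sub (i2.const_mul _)
      rw [this, integral_add t1 (integrable_const _),
        integral_sub (h4 j) (i2.const_mul _), integral_const_mul, ← hmdef]
      simp; ring
    have := hc j
    exact abs_le_of_sq_le_sq' (by linarith) hc0 |>.2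
  induction n with
  | zero => simp
  | succ n ih =>
    obtain ⟨iS4, eS, eS2, eS4⟩ := ih
    set S : Ω → ℝ := fun ω => ∑ j ∈ Finset.range n, Y j ω with hS
    have hmS : Measurable S := Finset.measurable_sum _ fun j _ => hm j
    have hind : IndepFun S (Y n) P := by
      have := hi.indepFun_finsetSum_of_notMem hm (s := Finset.range n) (i := n) (by simp)
      convert this using 1
      funext ω; simp [hS]
    have iS := pow_int_of4 hmS iS4
    have iY := pow_int_of4 (hm n) (h4 n)
    have hp : ∀ a b : ℕ, IndepFun (fun ω => S ω ^ a) (fun ω => Y n ω ^ b) P := fun a b =>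
      hind.comp (φ := fun x => x ^ a) (ψ := fun x => x ^ b)
        (measurable_id.pow_const a) (measurable_id.pow_const b)
    have ip : ∀ a b : ℕ, a ≤ 4 → b ≤ 4 → Integrable (fun ω => S ω ^ a * Y n ω ^ b) P :=
      fun a b ha hb => (hp a b).integrable_mul (iS a ha) (iY b hb)
    have ep : ∀ a b : ℕ, ∫ ω, S ω ^ a * Y n ω ^ b ∂P = (∫ ω, S ω ^ a ∂P) * ∫ ω, Y n ω ^ b ∂P :=
      fun a b => (hp a b).integral_fun_mul_eq_mul_integral
        (hmS.pow_const a).aestronglyMeasurable ((hm n).pow_const b).aestronglyMeasurable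
    have hsum : ∀ ω, ∑ j ∈ Finset.range (n+1), Y j ω = S ω + Y n ω := fun ω => by
      rw [Finset.sum_range_succ]
    simp only [hsum]
    have x4 : (fun ω => (S ω + Y n ω) ^ 4) = fun ω => S ω ^ 4 + 4 * (S ω ^ 3 * Y n ω ^ 1)
        + 6 * (S ω ^ 2 * Y n ω ^ 2) + 4 * (S ω ^ 1 * Y n ω ^ 3) + Y n ω ^ 4 := by
      funext ω; ring
    have x2 : (fun ω => (S ω + Y n ω) ^ 2) = fun ω => S ω ^ 2 + 2 * (S ω ^ 1 * Y n ω ^ 1)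
        + Y n ω ^ 2 := by
      funext ω; ring
    have j1 := (ip 3 1 (by norm_num) (by norm_num)).const_mul 4
    have j2 := (ip 2 2 (by norm_num) (by norm_num)).const_mul 6
    have j3 := (ip 1 3 (by norm_num) (by norm_num)).const_mul 4
    have j4 := (ip 1 1 (by norm_num) (by norm_num)).const_mul 2
    have n2 := h2 n
    have p2 : 0 ≤ ∫ ω, Y n ω ^ 2 ∂P := integral_nonneg fun ω => sq_nonneg _
    have q2 : 0 ≤ ∫ ω, S ω ^ 2 ∂P := integral_nonneg fun ω => sq_nonneg _
    have hS1 : ∫ ω, S ω ^ 1 ∂P = 0 := by simpa using eS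
    have hY1 : ∫ ω, Y n ω ^ 1 ∂P = 0 := by simpa using h0 n
    have I1 : Integrable S P := by simpa using iS 1 (by norm_num)
    have I2 : Integrable (Y n) P := by simpa using iY 1 (by norm_num)
    have t0 : Integrable (fun ω => S ω ^ 2 + 2 * (S ω ^ 1 * Y n ω ^ 1)) P :=
      (iS 2 (by norm_num)).add j4
    have t1 : Integrable (fun ω => S ω ^ 4 + 4 * (S ω ^ 3 * Y n ω ^ 1)) P := iS4.add j1
    have t2 : Integrable (fun ω => S ω ^ 4 + 4 * (S ω ^ 3 * Y n ω ^ 1)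
        + 6 * (S ω ^ 2 * Y n ω ^ 2)) P := t1.add j2
    have t3 : Integrable (fun ω => S ω ^ 4 + 4 * (S ω ^ 3 * Y n ω ^ 1)
        + 6 * (S ω ^ 2 * Y n ω ^ 2) + 4 * (S ω ^ 1 * Y n ω ^ 3)) P := t2.add j3
    refine ⟨?_, ?_, ?_, ?_⟩
    · rw [x4]; exact (((iS4.add j1).add j2).add j3).add (h4 n)
    · rw [integral_add I1 I2, eS, h0]; simp
    · rw [x2, integral_add t0 (iY 2 (by norm_num)),
        integral_add (iS 2 (by norm_num)) j4, integral_const_mul, ep, hS1]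
      push_cast; linarith
    · rw [x4, integral_add t3 (h4 n),
        integral_add t2 j3, integral_add t1 j2,
        integral_add (iS 4 le_rfl) j1, integral_const_mul, integral_const_mul, integral_const_mul,
        ep, ep, ep, hS1, hY1]
      have := mul_le_mul eS2 n2 p2 (by positivity)
      have := hc n
      push_cast; nlinarith [sq_nonneg c]

/-- dyadic points -/
def dpt (m k : ℕ) : I01 := Set.projIcc (0:ℝ) 1 zero_le_one ((k:ℝ) / 2 ^ m)

lemma dpt_zero (m : ℕ) : dpt m 0 = ⟨0, by simp⟩ := by
  simp [dpt]

lemma chain_aux (f : CI) (s ρ : ℝ) (hs : 0 ≤ s) (h0 : 0 ≤ ρ)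
    (h : ∀ m, ∀ k < 2 ^ m, |f (dpt m (k+1)) - f (dpt m k)| ≤ s * ρ ^ m) (m : ℕ) :
    ∀ k ≤ 2 ^ m, |f (dpt m k) - f (dpt 0 0)| ≤ s * ∑ i ∈ Finset.range (m+1), ρ ^ i := by
  induction m with
  | zero =>
    intro k hk
    have : k = 0 ∨ k = 1 := by simp at hk; omega
    rcases this with rfl | rfl
    · simp [hs]
    · simpa using h 0 0 (by simp)
  | succ m ih =>
    intro k hk
    have key : ∀ q, dpt (m+1) (2*q) = dpt m q := by
      intro q; unfold dpt; congr 1; push_cast; rw [pow_succ]; field_simp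
    have pk : 0 ≤ s * ρ ^ (m+1) := by positivity
    rw [Finset.sum_range_succ, mul_add]
    rw [pow_succ] at hk
    rcases Nat.even_or_odd' k with ⟨q, rfl | rfl⟩
    · rw [key]
      have := ih q (by omega)
      linarith
    · have h1 := ih q (by omega)
      have h2 := h (m+1) (2*q) (by rw [pow_succ]; omega)
      rw [key] at h2
      have := abs_sub_le (f (dpt (m+1) (2*q+1))) (f (dpt m q)) (f (dpt 0 0))
      linarith

lemma chain_det_s12 (f : CI) (s ρ : ℝ) (hs : 0 ≤ s) (h0 : 0 ≤ ρ) (h1 : ρ < 1)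
    (h : ∀ m, ∀ k < 2 ^ m, |f (dpt m (k+1)) - f (dpt m k)| ≤ s * ρ ^ m) (t : I01) :
    |f t| ≤ |f (dpt 0 0)| + s * (1 - ρ)⁻¹ := by
  have hb : ∀ m, |f (dpt m ⌊(t:ℝ) * 2 ^ m⌋₊) - f (dpt 0 0)| ≤ s * (1 - ρ)⁻¹ := by
    intro m
    have hk : ⌊(t:ℝ) * 2 ^ m⌋₊ ≤ 2 ^ m := by
      apply Nat.floor_le_of_le
      push_cast
      have := t.2.2
      have h2 : (0:ℝ) < 2 ^ m := by positivity
      nlinarith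
    refine (chain_aux f s ρ hs h0 h m _ hk).trans ?_
    gcongr
    rw [← tsum_geometric_of_lt_one h0 h1]
    exact (summable_geometric_of_lt_one h0 h1).sum_le_tsum _ (fun i _ => by positivity)
  have hlim : Tendsto (fun m : ℕ => dpt m ⌊(t:ℝ) * 2 ^ m⌋₊) atTop (𝓝 t) := by
    have l1 := (tendsto_nat_floor_mul_div_atTop (R := ℝ) t.2.1).comp
      (tendsto_pow_atTop_atTop_of_one_lt (r := (2:ℝ)) (by norm_num))
    have l2 := (continuous_projIcc (h := (zero_le_one : (0:ℝ) ≤ 1))).tendsto (t:ℝ) |>.comp l1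
    rw [Set.projIcc_val] at l2
    exact l2
  have l3 : Tendsto (fun m : ℕ => |f (dpt m ⌊(t:ℝ) * 2 ^ m⌋₊) - f (dpt 0 0)|) atTop
      (𝓝 |f t - f (dpt 0 0)|) :=
    (((f.continuous.tendsto t).comp hlim).sub_const _).abs
  have := le_of_tendsto' l3 hb
  have := abs_sub_abs_le_abs_sub (f t) (f (dpt 0 0))
  linarith

def chainS (q : ℝ) (f : I01 → ℝ) : ENNReal :=
  ∑' m : ℕ, ∑ k ∈ Finset.range (2 ^ m),
    ENNReal.ofReal ((q ^ m)⁻¹ * (f (dpt m (k+1)) - f (dpt m k)) ^ 4)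

lemma chain_enn (ρ : ℝ) (h0 : 0 < ρ) (h1 : ρ < 1) (f : CI) (t : I01) :
    ENNReal.ofReal ((f t) ^ 2) ≤ ENNReal.ofReal (2 * (1 + f (dpt 0 0) ^ 4))
      + ENNReal.ofReal (2 * ((1 - ρ)⁻¹) ^ 2) * (1 + chainS (ρ ^ 4) f) := by
  have hρ : 0 < (1 - ρ)⁻¹ := by rw [inv_pos]; linarith
  rcases eq_or_ne (chainS (ρ ^ 4) f) ⊤ with hS | hS
  · rw [hS, add_top, ENNReal.mul_top (by simp; positivity), add_top]; exact le_top
  set S := (chainS (ρ ^ 4) f).toReal with hSdef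
  have hS0 : 0 ≤ S := ENNReal.toReal_nonneg
  set s := √√S with hs
  have hs0 : 0 ≤ s := Real.sqrt_nonneg _
  have hs2 : s ^ 2 = √S := Real.sq_sqrt (Real.sqrt_nonneg _)
  have hs4 : s ^ 4 = S := by
    rw [show s ^ 4 = (s ^ 2) ^ 2 by ring, hs2, Real.sq_sqrt hS0]
  have hinc : ∀ m, ∀ k < 2 ^ m, |f (dpt m (k+1)) - f (dpt m k)| ≤ s * ρ ^ m := by
    intro m k hk
    have e1 : ENNReal.ofReal (((ρ ^ 4) ^ m)⁻¹ * (f (dpt m (k+1)) - f (dpt m k)) ^ 4)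
        ≤ chainS (ρ ^ 4) f := by
      refine le_trans ?_ (ENNReal.le_tsum m)
      exact Finset.single_le_sum (f := fun k =>
        ENNReal.ofReal (((ρ ^ 4) ^ m)⁻¹ * (f (dpt m (k+1)) - f (dpt m k)) ^ 4))
        (fun _ _ => zero_le) (Finset.mem_range.2 hk)
    have e2 := (ENNReal.ofReal_le_iff_le_toReal hS).1 e1
    rw [← hSdef, inv_mul_le_iff₀ (by positivity), ← hs4] at e2
    refine le_of_pow_le_pow_left₀ (n := 4) (by norm_num) (by positivity) ?_
    rw [Even.pow_abs (by decide)]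
    calc _ ≤ _ := e2
      _ = _ := by ring
  have hb := chain_det_s12 f s ρ hs0 h0.le h1 hinc t
  have hreal : f t ^ 2 ≤ 2 * (1 + f (dpt 0 0) ^ 4) + 2 * ((1 - ρ)⁻¹) ^ 2 * (1 + S) := by
    have a1 : f t ^ 2 ≤ (|f (dpt 0 0)| + s * (1 - ρ)⁻¹) ^ 2 := by
      rw [← sq_abs]; gcongr
    have a2 : (|f (dpt 0 0)| + s * (1 - ρ)⁻¹) ^ 2 ≤ 2 * |f (dpt 0 0)| ^ 2 + 2 * (s * (1 - ρ)⁻¹) ^ 2 := by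
      nlinarith [sq_nonneg (|f (dpt 0 0)| - s * (1 - ρ)⁻¹)]
    have a3 : s ^ 2 ≤ 1 + S := by nlinarith [sq_nonneg (s^2 - 1)]
    have a4 : |f (dpt 0 0)| ^ 2 ≤ 1 + f (dpt 0 0) ^ 4 := by
      rw [sq_abs]; nlinarith [sq_nonneg (f (dpt 0 0) ^ 2 - 1)]
    have a5 : s ^ 2 * ((1 - ρ)⁻¹) ^ 2 ≤ (1 + S) * ((1 - ρ)⁻¹) ^ 2 := by gcongr
    nlinarith
  calc _ ≤ _ := ENNReal.ofReal_le_ofReal hreal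
    _ = _ := by
      rw [ENNReal.ofReal_add (by positivity) (by positivity), ENNReal.ofReal_mul (by positivity) (q := 1 + S),
        ENNReal.ofReal_add (by norm_num) hS0, ENNReal.ofReal_one, hSdef, ENNReal.ofReal_toReal hS]

lemma inc_moment {Ω : Type*} [MeasurableSpace Ω] (P : Measure Ω) [IsProbabilityMeasure P]
    [MeasurableSpace CI] [BorelSpace CI] (η : ℕ → ℕ → Ω → CI)
    (hm : ∀ i j, Measurable (η i j))
    (hi : iIndepFun (fun p : ℕ × ℕ => η p.1 p.2) P)
    (hid : ∀ i j, Measure.map (η i j) P = Measure.map (η 0 0) P)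
    (h8 : ∀ i j, ∫⁻ ω, ENNReal.ofReal (‖η i j ω‖ ^ ((8:ℝ))) ∂P < ⊤)
    (ϑ K : ℝ) (M : Ω → ℝ) (hM0 : ∀ ω, 0 ≤ M ω)
    (hM : ∀ i j, ∫⁻ ω, ENNReal.ofReal (‖η i j ω‖ ^ ((4:ℝ)) * M ω ^ ((4:ℝ))) ∂P
      ≤ ENNReal.ofReal K)
    (hH : ∀ i j, ∀ᵐ ω ∂P, ∀ s t : I01,
      |η i j ω s - η i j ω t| ≤ M ω * |(s : ℝ) - (t : ℝ)| ^ ϑ) :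
    ∃ c : ℝ, 0 ≤ c ∧ (∀ i j, Integrable (fun ω => ‖η i j ω‖ ^ 4) P) ∧
      (∀ i j t, ∫ ω, (η i j ω t) ^ 4 ∂P ≤ c ^ 2) ∧
      (∀ i j s t, ∫ ω, (η i j ω s - η i j ω t) ^ 4 ∂P
        ≤ (c * (|(s : ℝ) - (t : ℝ)| ^ ϑ) ^ 2) ^ 2) := by
  have mn : ∀ i j, Measurable (fun ω => ‖η i j ω‖) := fun i j =>
    continuous_norm.measurable.comp (hm i j)
  have me : ∀ i j (t : I01), Measurable (fun ω => η i j ω t) := fun i j t =>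
    (continuous_eval_const t).measurable.comp (hm i j)
  have i8 : ∀ i j, Integrable (fun ω => ‖η i j ω‖ ^ 8) P := by
    intro i j
    refine ⟨((mn i j).pow_const 8).aestronglyMeasurable, ?_⟩
    rw [hasFiniteIntegral_iff_ofReal (ae_of_all _ fun ω => by positivity)]
    convert h8 i j using 5 with ω
    norm_cast
  have i4 : ∀ i j, Integrable (fun ω => ‖η i j ω‖ ^ 4) P := by
    intro i j
    refine Integrable.mono' ((integrable_const (1:ℝ)).add (i8 i j))
      ((mn i j).pow_const 4).aestronglyMeasurable (ae_of_all _ fun ω => ?_)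
    simp only [norm_pow, norm_norm, Pi.add_apply]
    nlinarith [sq_nonneg (‖η i j ω‖ ^ 4 - 1)]
  have bd : ∀ i j ω (t : I01), |η i j ω t| ≤ ‖η i j ω‖ := fun i j ω t =>
    (η i j ω).norm_coe_le_norm t
  have e4 : ∀ i j, ∫ ω, ‖η i j ω‖ ^ 4 ∂P = ∫ ω, ‖η 0 0 ω‖ ^ 4 ∂P := by
    intro i j
    have mf : ∀ ν : Measure CI, AEStronglyMeasurable (fun x : CI => ‖x‖ ^ 4) ν := fun ν =>
      (by fun_prop : Continuous (fun x : CI => ‖x‖ ^ 4)).measurable.aestronglyMeasurable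
    rw [← integral_map (hm i j).aemeasurable (mf _), hid,
      integral_map (hm 0 0).aemeasurable (mf _)]
  set m4 := ∫ ω, ‖η 0 0 ω‖ ^ 4 ∂P with hm4
  have m40 : 0 ≤ m4 := integral_nonneg fun ω => by positivity
  have hbd4 : ∀ i j (s t : I01) ω, (η i j ω s - η i j ω t) ^ 4 ≤ 16 * ‖η i j ω‖ ^ 4 := by
    intro i j s t ω
    rw [show (16:ℝ) = 2 ^ 4 by norm_num, ← mul_pow, ← Even.pow_abs (by decide)]
    gcongr
    have := abs_sub (η i j ω s) (η i j ω t)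
    linarith [bd i j ω s, bd i j ω t]
  have iD : ∀ i j (s t : I01), Integrable (fun ω => (η i j ω s - η i j ω t) ^ 4) P := by
    intro i j s t
    refine Integrable.mono' ((i4 i j).const_mul 16)
      ((((me i j s).sub (me i j t))).pow_const 4).aestronglyMeasurable (ae_of_all _ fun ω => ?_)
    rw [Real.norm_eq_abs, abs_of_nonneg (by positivity)]
    exact hbd4 i j s t ω
  have key : ∀ i j (s t : I01), m4 * ∫ ω, (η i j ω s - η i j ω t) ^ 4 ∂P
      ≤ max K 0 * (|(s : ℝ) - (t : ℝ)| ^ ϑ) ^ 4 := by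
    intro i j s t
    set D := |(s : ℝ) - (t : ℝ)| ^ ϑ with hD
    have D0 : 0 ≤ D := by positivity
    have hind : IndepFun (fun ω => ‖η i (j+1) ω‖ ^ 4) (fun ω => (η i j ω s - η i j ω t) ^ 4) P := by
      have h := hi.indepFun (i := (i, j+1)) (j := (i, j)) (by simp)
      exact h.comp (φ := fun x : CI => ‖x‖ ^ 4) (ψ := fun x : CI => (x s - x t) ^ 4)
        (by fun_prop : Continuous (fun x : CI => ‖x‖ ^ 4)).measurable
        (((continuous_eval_const s).sub
          (continuous_eval_const t)).pow 4).measurable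
    have hint : Integrable (fun ω => ‖η i (j+1) ω‖ ^ 4 * (η i j ω s - η i j ω t) ^ 4) P :=
      hind.integrable_mul (i4 _ _) (iD _ _ _ _)
    rw [← e4 i (j+1), ← hind.integral_fun_mul_eq_mul_integral
      (i4 _ _).aestronglyMeasurable (iD _ _ _ _).aestronglyMeasurable]
    rw [← ENNReal.ofReal_le_ofReal_iff (by positivity),
      ofReal_integral_eq_lintegral_ofReal hint (ae_of_all _ fun ω => by positivity)]
    calc _ ≤ ∫⁻ ω, ENNReal.ofReal (‖η i (j+1) ω‖ ^ ((4:ℝ)) * M ω ^ ((4:ℝ)))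
          * ENNReal.ofReal (D ^ 4) ∂P := by
          refine lintegral_mono_ae ?_
          filter_upwards [hH i j] with ω hω
          rw [← ENNReal.ofReal_mul (mul_nonneg (by positivity) (Real.rpow_nonneg (hM0 ω) _))]
          apply ENNReal.ofReal_le_ofReal
          have h1 : (η i j ω s - η i j ω t) ^ 4 ≤ (M ω * D) ^ 4 := by
            rw [← Even.pow_abs (by decide)]
            gcongr
            exact hω s t
          have h2 : ‖η i (j+1) ω‖ ^ ((4:ℝ)) = ‖η i (j+1) ω‖ ^ 4 := by norm_cast
          have h3 : M ω ^ ((4:ℝ)) = M ω ^ 4 := by norm_cast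
          rw [mul_pow] at h1
          rw [h2, h3, mul_assoc]
          exact mul_le_mul_of_nonneg_left h1 (by positivity)
      _ = (∫⁻ ω, ENNReal.ofReal (‖η i (j+1) ω‖ ^ ((4:ℝ)) * M ω ^ ((4:ℝ))) ∂P)
          * ENNReal.ofReal (D ^ 4) := lintegral_mul_const' _ _ ENNReal.ofReal_ne_top
      _ ≤ ENNReal.ofReal (max K 0) * ENNReal.ofReal (D ^ 4) := by
          gcongr
          exact (hM _ _).trans (ENNReal.ofReal_le_ofReal (le_max_left _ _))
      _ = _ := by rw [ENNReal.ofReal_mul (le_max_right _ _)]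
  have c0 : 0 ≤ m4 + max K 0 / m4 := add_nonneg m40 (div_nonneg (le_max_right _ _) m40)
  have k0 : 0 ≤ max K 0 / m4 := div_nonneg (le_max_right _ _) m40
  refine ⟨√(m4 + max K 0 / m4), Real.sqrt_nonneg _, i4, ?_, ?_⟩
  · intro i j t
    rw [Real.sq_sqrt c0]
    have : ∫ ω, (η i j ω t) ^ 4 ∂P ≤ m4 := by
      rw [← e4 i j]
      refine integral_mono_of_nonneg (ae_of_all _ fun ω => by positivity) (i4 i j)
        (ae_of_all _ fun ω => ?_)
      simp only
      rw [← Even.pow_abs (by decide)]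
      gcongr
      exact bd i j ω t
    linarith
  · intro i j s t
    rw [mul_pow, Real.sq_sqrt c0, ← pow_mul]
    norm_num
    have D0 : 0 ≤ (|(s : ℝ) - (t : ℝ)| ^ ϑ) ^ 4 := by positivity
    rcases m40.eq_or_lt with h | h
    · have : ∫ ω, (η i j ω s - η i j ω t) ^ 4 ∂P ≤ 16 * m4 := by
        rw [← e4 i j, ← integral_const_mul]
        exact integral_mono_of_nonneg (ae_of_all _ fun ω => by positivity) ((i4 i j).const_mul _)
          (ae_of_all _ fun ω => hbd4 i j s t ω)
      rw [← h] at this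
      refine this.trans ?_
      simpa using mul_nonneg c0 D0
    · have h1 := key i j s t
      rw [← le_div_iff₀' h] at h1
      refine h1.trans ?_
      rw [mul_div_right_comm]
      gcongr
      linarith

lemma sum_fourth_enn {Ω : Type*} [MeasurableSpace Ω] (P : Measure Ω) [IsProbabilityMeasure P]
    [MeasurableSpace CI] [BorelSpace CI] (η : ℕ → ℕ → Ω → CI)
    (hm : ∀ i j, Measurable (η i j))
    (hi : iIndepFun (fun p : ℕ × ℕ => η p.1 p.2) P)
    (h4 : ∀ i j, Integrable (fun ω => ‖η i j ω‖ ^ 4) P)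
    (i n : ℕ) (hn : 0 < n)
    (g : CI → ℝ) (hg : Measurable g) (hb : ∀ x, |g x| ≤ 2 * ‖x‖)
    (h0 : ∀ j, ∫ ω, g (η i j ω) ∂P = 0) (d : ℝ) (hd0 : 0 ≤ d)
    (hd : ∀ j, ∫ ω, g (η i j ω) ^ 4 ∂P ≤ d ^ 2) :
    ∫⁻ ω, ENNReal.ofReal (((√n)⁻¹ * ∑ j ∈ Finset.range n, g (η i j ω)) ^ 4) ∂P
      ≤ ENNReal.ofReal (3 * d ^ 2) := by
  have hind : iIndepFun (fun j ω => g (η i j ω)) P := by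
    have h1 := hi.precomp (g := fun j : ℕ => (i, j)) (fun a b h => by simpa using h)
    exact h1.comp (fun _ => g) (fun _ => hg)
  have hI : ∀ j, Integrable (fun ω => g (η i j ω) ^ 4) P := by
    intro j
    refine Integrable.mono' ((h4 i j).const_mul 16)
      ((hg.comp (hm i j)).pow_const 4).aestronglyMeasurable (ae_of_all _ fun ω => ?_)
    rw [norm_pow, Real.norm_eq_abs, show (16:ℝ) = 2 ^ 4 by norm_num, ← mul_pow]
    gcongr
    exact hb _
  obtain ⟨r1, -, -, r4⟩ := fourth_sum (fun j ω => g (η i j ω)) (fun j => hg.comp (hm i j)) hind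
    hI h0 d hd hd0 n
  have hn' : (0:ℝ) < n := by exact_mod_cast hn
  have e : ∀ ω, ((√n)⁻¹ * ∑ j ∈ Finset.range n, g (η i j ω)) ^ 4
      = ((n:ℝ) ^ 2)⁻¹ * (∑ j ∈ Finset.range n, g (η i j ω)) ^ 4 := by
    intro ω
    rw [mul_pow, inv_pow, show (√n) ^ 4 = ((√(n:ℝ)) ^ 2) ^ 2 by ring, Real.sq_sqrt hn'.le]
  simp only [e]
  rw [← ofReal_integral_eq_lintegral_ofReal (r1.const_mul _) (ae_of_all _ fun ω => by positivity),
    integral_const_mul]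
  apply ENNReal.ofReal_le_ofReal
  rw [inv_mul_le_iff₀ (by positivity)]
  linarith

lemma dpt_diff (m k : ℕ) (hk : k < 2 ^ m) :
    |((dpt m (k+1) : I01) : ℝ) - (dpt m k : I01)| = (2 ^ m)⁻¹ := by
  have h : ∀ k ≤ 2 ^ m, ((dpt m k : I01) : ℝ) = k / 2 ^ m := by
    intro k hk
    unfold dpt
    rw [Set.projIcc_of_mem]
    refine ⟨by positivity, ?_⟩
    rw [div_le_one (by positivity)]
    exact_mod_cast hk
  rw [h _ hk, h _ hk.le, ← sub_div]
  push_cast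
  rw [add_sub_cancel_left, abs_of_nonneg (by positivity), one_div]

lemma group_bound {Ω : Type*} [MeasurableSpace Ω] (P : Measure Ω) [IsProbabilityMeasure P]
    [MeasurableSpace CI] [BorelSpace CI] (η : ℕ → ℕ → Ω → CI)
    (hm : ∀ i j, Measurable (η i j))
    (hi : iIndepFun (fun p : ℕ × ℕ => η p.1 p.2) P)
    (hid : ∀ i j, Measure.map (η i j) P = Measure.map (η 0 0) P)
    (hc : ∀ i j (t : I01), ∫ ω, η i j ω t ∂P = 0)
    (h8 : ∀ i j, ∫⁻ ω, ENNReal.ofReal (‖η i j ω‖ ^ ((8:ℝ))) ∂P < ⊤)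
    (ϑ K : ℝ) (hϑ : 1/4 < ϑ) (M : Ω → ℝ) (hM0 : ∀ ω, 0 ≤ M ω)
    (hM : ∀ i j, ∫⁻ ω, ENNReal.ofReal (‖η i j ω‖ ^ ((4:ℝ)) * M ω ^ ((4:ℝ))) ∂P
      ≤ ENNReal.ofReal K)
    (hH : ∀ i j, ∀ᵐ ω ∂P, ∀ s t : I01,
      |η i j ω s - η i j ω t| ≤ M ω * |(s : ℝ) - (t : ℝ)| ^ ϑ) :
    ∃ C : ENNReal, C ≠ ⊤ ∧ ∀ i n : ℕ, 0 < n → ∃ B : Ω → ENNReal, Measurable B ∧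
      ∫⁻ ω, B ω ∂P ≤ C ∧ ∀ ω t,
        ENNReal.ofReal ((n:ℝ)⁻¹ * (∑ j ∈ Finset.range n, η i j ω t) ^ 2) ≤ B ω := by
  obtain ⟨c, hc0, i4, hp, hD⟩ := inc_moment P η hm hi hid h8 ϑ K M hM0 hM hH
  have me : ∀ i j (t : I01), Measurable (fun ω => η i j ω t) := fun i j t =>
    (continuous_eval_const t).measurable.comp (hm i j)
  have ie : ∀ i j (t : I01), Integrable (fun ω => η i j ω t) P := by
    intro i j t
    refine Integrable.mono' ((integrable_const (1:ℝ)).add (i4 i j)) (me i j t).aestronglyMeasurable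
      (ae_of_all _ fun ω => ?_)
    have := (η i j ω).norm_coe_le_norm t
    simp only [Pi.add_apply]
    nlinarith [sq_nonneg (‖η i j ω‖ ^ 2 - 1), sq_nonneg (‖η i j ω‖ - 1)]
  set ρ : ℝ := 2 ^ ((1/4 - ϑ) / 2) with hρ
  have ρ0 : 0 < ρ := by positivity
  have ρ1 : ρ < 1 := Real.rpow_lt_one_of_one_lt_of_neg (by norm_num) (by linarith)
  set a : ℝ := 2 ^ (-ϑ) with ha
  have a0 : 0 < a := by positivity
  have haρ : 2 * a ^ 4 = (ρ ^ 4) ^ 2 := by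
    rw [← pow_mul, hρ, ha, ← Real.rpow_mul_natCast (by norm_num), ← Real.rpow_mul_natCast (by norm_num)]
    nth_rewrite 1 [← Real.rpow_one 2]
    rw [← Real.rpow_add (by norm_num)]
    congr 1
    push_cast; ring
  have q1 : ρ ^ 4 < 1 := pow_lt_one₀ ρ0.le ρ1 (by norm_num)
  have ham : ∀ m : ℕ, (((2:ℝ) ^ m)⁻¹) ^ ϑ = a ^ m := by
    intro m
    rw [Real.inv_rpow (by positivity), ← Real.rpow_natCast, ← Real.rpow_mul (by norm_num),
      ha, ← Real.rpow_mul_natCast (by norm_num), ← Real.rpow_neg (by norm_num)]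
    congr 1; ring
  refine ⟨(ENNReal.ofReal 2 + 2 * ENNReal.ofReal (3 * c ^ 2))
      + ENNReal.ofReal (2 * ((1 - ρ)⁻¹) ^ 2) * (1 + ∑' m : ℕ, ENNReal.ofReal (3 * c ^ 2 * (ρ ^ 4) ^ m)),
      ?_, ?_⟩
  · have : ∑' m : ℕ, ENNReal.ofReal (3 * c ^ 2 * (ρ ^ 4) ^ m) ≠ ⊤ := by
      rw [← ENNReal.ofReal_tsum_of_nonneg (fun m => by positivity)
        ((summable_geometric_of_lt_one (by positivity) q1).mul_left _)]
      exact ENNReal.ofReal_ne_top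
    finiteness
  intro i n hn
  have hn' : (0:ℝ) < n := by exact_mod_cast hn
  set f : Ω → CI := fun ω => (√n)⁻¹ • ∑ j ∈ Finset.range n, η i j ω with hf
  have fe : ∀ ω t, f ω t = (√n)⁻¹ * ∑ j ∈ Finset.range n, η i j ω t := by
    intro ω t; simp [hf, ContinuousMap.sum_apply]
  have mf : ∀ t, Measurable (fun ω => f ω t) := by
    intro t
    simp only [fe]
    exact (Finset.measurable_sum _ fun j _ => me i j t).const_mul _
  have F0 : ∫⁻ ω, ENNReal.ofReal (f ω (dpt 0 0) ^ 4) ∂P ≤ ENNReal.ofReal (3 * c ^ 2) := by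
    simp only [fe]
    refine sum_fourth_enn P η hm hi i4 i n hn (fun x => x (dpt 0 0))
      (continuous_eval_const _).measurable ?_ (fun j => hc i j _) c hc0
      (fun j => hp i j _)
    intro x
    have := x.norm_coe_le_norm (dpt 0 0)
    rw [Real.norm_eq_abs] at this
    linarith [norm_nonneg x]
  have FD : ∀ s t : I01, ∫⁻ ω, ENNReal.ofReal ((f ω s - f ω t) ^ 4) ∂P
      ≤ ENNReal.ofReal (3 * (c * (|(s : ℝ) - (t : ℝ)| ^ ϑ) ^ 2) ^ 2) := by
    intro s t
    simp only [fe, ← mul_sub, ← Finset.sum_sub_distrib]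
    refine sum_fourth_enn P η hm hi i4 i n hn (fun x => x s - x t)
      ((continuous_eval_const _).sub
        (continuous_eval_const _)).measurable ?_ (fun j => ?_) _ (by positivity)
      (fun j => hD i j s t)
    · intro x
      have h1 := x.norm_coe_le_norm s
      have h2 := x.norm_coe_le_norm t
      rw [Real.norm_eq_abs] at h1 h2
      have := abs_sub (x s) (x t)
      linarith
    · rw [integral_sub (ie _ _ _) (ie _ _ _), hc, hc, sub_zero]
  have mS : Measurable (fun ω => chainS (ρ ^ 4) (f ω)) := by
    unfold chainS
    refine Measurable.tsum fun m => Finset.measurable_sum _ fun k _ => ?_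
    exact ((((mf _).sub (mf _)).pow_const 4).const_mul _).ennreal_ofReal
  have IS : ∫⁻ ω, chainS (ρ ^ 4) (f ω) ∂P ≤ ∑' m : ℕ, ENNReal.ofReal (3 * c ^ 2 * (ρ ^ 4) ^ m) := by
    unfold chainS
    have mk : ∀ m k, Measurable (fun ω =>
        ENNReal.ofReal (((ρ ^ 4) ^ m)⁻¹ * (f ω (dpt m (k+1)) - f ω (dpt m k)) ^ 4)) := fun m k =>
      ((((mf _).sub (mf _)).pow_const 4).const_mul _).ennreal_ofReal
    rw [lintegral_tsum fun m => (Finset.measurable_sum _ fun k _ => mk m k).aemeasurable]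
    refine ENNReal.tsum_le_tsum fun m => ?_
    rw [lintegral_finsetSum _ fun k _ => mk m k]
    have hk : ∀ k ∈ Finset.range (2 ^ m), ∫⁻ ω,
        ENNReal.ofReal (((ρ ^ 4) ^ m)⁻¹ * (f ω (dpt m (k+1)) - f ω (dpt m k)) ^ 4) ∂P
        ≤ ENNReal.ofReal (((ρ ^ 4) ^ m)⁻¹ * (3 * (c * (a ^ m) ^ 2) ^ 2)) := by
      intro k hk
      have h1 := FD (dpt m (k+1)) (dpt m k)
      rw [dpt_diff m k (Finset.mem_range.1 hk), ham] at h1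
      have e : ∀ x : ℝ, ENNReal.ofReal (((ρ ^ 4) ^ m)⁻¹ * x)
          = ENNReal.ofReal (((ρ ^ 4) ^ m)⁻¹) * ENNReal.ofReal x := fun x =>
        ENNReal.ofReal_mul (by positivity)
      simp only [e]
      rw [lintegral_const_mul' _ _ ENNReal.ofReal_ne_top]
      gcongr
    refine (Finset.sum_le_sum hk).trans (le_of_eq ?_)
    rw [Finset.sum_const, Finset.card_range, nsmul_eq_mul, ← ENNReal.ofReal_natCast,
      ← ENNReal.ofReal_mul (by positivity)]
    congr 1
    have e : (2:ℝ) ^ m * (a ^ m) ^ 4 = ((ρ ^ 4) ^ m) ^ 2 := by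
      rw [← pow_mul, mul_comm m 4, pow_mul, ← mul_pow, haρ, ← pow_mul, ← pow_mul, ← pow_mul,
        ← pow_mul]
      congr 1; ring
    have hne : (ρ ^ 4) ^ m ≠ 0 := by positivity
    push_cast
    calc _ = 3 * c ^ 2 * ((2:ℝ) ^ m * (a ^ m) ^ 4) * ((ρ ^ 4) ^ m)⁻¹ := by ring
      _ = _ := by rw [e]; field_simp
  refine ⟨fun ω => ENNReal.ofReal (2 * (1 + f ω (dpt 0 0) ^ 4))
      + ENNReal.ofReal (2 * ((1 - ρ)⁻¹) ^ 2) * (1 + chainS (ρ ^ 4) (f ω)), ?_, ?_, ?_⟩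
  · exact (((((mf _).pow_const 4).const_add _).const_mul _).ennreal_ofReal).add
      ((mS.const_add _).const_mul _)
  · rw [lintegral_add_left ((((mf _).pow_const 4).const_add _).const_mul _).ennreal_ofReal,
      lintegral_const_mul' _ _ ENNReal.ofReal_ne_top, lintegral_add_left measurable_const]
    have e : ∀ ω, ENNReal.ofReal (2 * (1 + f ω (dpt 0 0) ^ 4))
        = ENNReal.ofReal 2 + 2 * ENNReal.ofReal (f ω (dpt 0 0) ^ 4) := by
      intro ω
      rw [mul_add, ENNReal.ofReal_add (by norm_num) (by positivity),
        ENNReal.ofReal_mul (p := 2) (q := f ω (dpt 0 0) ^ 4) (by norm_num)]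
      simp
    simp only [e]
    rw [lintegral_add_left measurable_const, lintegral_const_mul' _ _ (by simp)]
    simp only [lintegral_const, measure_univ, mul_one]
    gcongr
  · intro ω t
    refine le_trans (le_of_eq ?_) (chain_enn ρ ρ0 ρ1 (f ω) t)
    congr 1
    rw [fe, mul_pow, inv_pow, Real.sq_sqrt hn'.le]

lemma alg_group (x : ℝ) (y : ℕ → ℝ) (n : ℕ) (hn : 0 < n) :
    ∑ j ∈ Finset.range n, (x + y j - (n:ℝ)⁻¹ * ∑ j ∈ Finset.range n, (x + y j)) ^ 2
      = ∑ j ∈ Finset.range n, y j ^ 2 - (n:ℝ)⁻¹ * (∑ j ∈ Finset.range n, y j) ^ 2 := by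
  have hn' : (n:ℝ) ≠ 0 := by exact_mod_cast hn.ne'
  have e : ∀ j, (x + y j - (n:ℝ)⁻¹ * ∑ j ∈ Finset.range n, (x + y j)) ^ 2
      = y j ^ 2 - 2 * ((n:ℝ)⁻¹ * ∑ j ∈ Finset.range n, y j) * y j
        + ((n:ℝ)⁻¹ * ∑ j ∈ Finset.range n, y j) ^ 2 := by
    intro j
    rw [Finset.sum_add_distrib, Finset.sum_const, Finset.card_range, nsmul_eq_mul, mul_add,
      inv_mul_cancel_left₀ hn']
    ring
  simp only [e]
  rw [Finset.sum_add_distrib, Finset.sum_sub_distrib, ← Finset.mul_sum, Finset.sum_const,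
    Finset.card_range, nsmul_eq_mul]
  field_simp
  ring

lemma main_one {Ω : Type*} [MeasurableSpace Ω] (P : Measure Ω) [IsProbabilityMeasure P]
    [MeasurableSpace CI] [BorelSpace CI] (μ : CI) (ε : ℕ → Ω → CI) (η : ℕ → ℕ → Ω → CI)
    (hm : ∀ i j, Measurable (η i j))
    (hi : iIndepFun (fun p : ℕ × ℕ => η p.1 p.2) P)
    (hid : ∀ i j, Measure.map (η i j) P = Measure.map (η 0 0) P)
    (hc : ∀ i j (t : I01), ∫ ω, η i j ω t ∂P = 0)
    (h8 : ∀ i j, ∫⁻ ω, ENNReal.ofReal (‖η i j ω‖ ^ ((8:ℝ))) ∂P < ⊤)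
    (ϑ K : ℝ) (hϑ : 1/4 < ϑ) (M : Ω → ℝ) (hM0 : ∀ ω, 0 ≤ M ω)
    (hM : ∀ i j, ∫⁻ ω, ENNReal.ofReal (‖η i j ω‖ ^ ((4:ℝ)) * M ω ^ ((4:ℝ))) ∂P
      ≤ ENNReal.ofReal K)
    (hH : ∀ i j, ∀ᵐ ω ∂P, ∀ s t : I01,
      |η i j ω s - η i j ω t| ≤ M ω * |(s : ℝ) - (t : ℝ)| ^ ϑ)
    (A : ℕ → ℕ) (hApos : ∀ k, 0 < A k)
    (n : ℕ → ℕ → ℕ) (hnpos : ∀ k i, 0 < n k i)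
    (hAN : Tendsto (fun k => (A k : ℝ) /
      Real.sqrt (∑ i ∈ Finset.range (A k), (n k i : ℝ))) atTop (𝓝 0)) (δ : ℝ) (hδ : 0 < δ) :
    Tendsto (fun k => (P {ω | δ <
        Real.sqrt (∑ i ∈ Finset.range (A k), (n k i : ℝ)) * ⨆ t : I01,
          |sigmaHatSq μ ε η (A k) (n k) ω t
            - ((∑ i ∈ Finset.range (A k), (n k i : ℝ)) - (A k : ℝ))⁻¹ *
              ∑ i ∈ Finset.range (A k), ∑ j ∈ Finset.range (n k i),
                (η i j ω t) ^ 2|}).toReal) atTop (𝓝 0) := by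
  obtain ⟨C, hC, hB⟩ := group_bound P η hm hi hid hc h8 ϑ K hϑ M hM0 hM hH
  have hbound : ∀ᶠ k in atTop, (P {ω | δ <
        Real.sqrt (∑ i ∈ Finset.range (A k), (n k i : ℝ)) * ⨆ t : I01,
          |sigmaHatSq μ ε η (A k) (n k) ω t
            - ((∑ i ∈ Finset.range (A k), (n k i : ℝ)) - (A k : ℝ))⁻¹ *
              ∑ i ∈ Finset.range (A k), ∑ j ∈ Finset.range (n k i),
                (η i j ω t) ^ 2|}).toReal ≤
      (2 * C.toReal / δ) * ((A k : ℝ) / Real.sqrt (∑ i ∈ Finset.range (A k), (n k i : ℝ))) := by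
    filter_upwards [hAN.eventually_le_const (show (0:ℝ) < 1/2 by norm_num)] with k hk
    set N := ∑ i ∈ Finset.range (A k), (n k i : ℝ) with hN
    have hA1 : (1:ℝ) ≤ A k := by exact_mod_cast hApos k
    have hNA : (A k : ℝ) ≤ N := by
      have : ∑ i ∈ Finset.range (A k), (1:ℝ) ≤ N :=
        Finset.sum_le_sum fun i _ => by exact_mod_cast hnpos k i
      simpa using this
    have hN1 : 1 ≤ N := hA1.trans hNA
    have hs0 : 0 < √N := Real.sqrt_pos.2 (by linarith)
    have hs1 : 1 ≤ √N := Real.one_le_sqrt.2 hN1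
    have hsN : √N * √N = N := Real.mul_self_sqrt (by linarith)
    rw [div_le_iff₀ hs0] at hk
    have hNA2 : N / 2 ≤ N - A k := by nlinarith
    have hpos : 0 < N - A k := by linarith
    choose B mB IB bB using fun i => hB i (n k i) (hnpos k i)
    have hdiff : ∀ ω t, sigmaHatSq μ ε η (A k) (n k) ω t - (N - (A k : ℝ))⁻¹ *
              ∑ i ∈ Finset.range (A k), ∑ j ∈ Finset.range (n k i), (η i j ω t) ^ 2
        = - ((N - (A k : ℝ))⁻¹ * ∑ i ∈ Finset.range (A k),
          ((n k i : ℝ)⁻¹ * (∑ j ∈ Finset.range (n k i), η i j ω t) ^ 2)) := by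
      intro ω t
      unfold sigmaHatSq XbarRe Xre
      rw [← hN, ← mul_sub, ← mul_neg, ← Finset.sum_sub_distrib, ← Finset.sum_neg_distrib]
      congr 1
      refine Finset.sum_congr rfl fun i _ => ?_
      rw [alg_group (μ t + ε i ω t) (fun j => η i j ω t) (n k i) (hnpos k i)]
      ring
    set r := √N * (N - (A k : ℝ))⁻¹ with hr
    have hr0 : 0 ≤ r := by positivity
    have hsub : {ω | δ < √N * ⨆ t : I01, |sigmaHatSq μ ε η (A k) (n k) ω t - (N - (A k : ℝ))⁻¹ *
              ∑ i ∈ Finset.range (A k), ∑ j ∈ Finset.range (n k i), (η i j ω t) ^ 2|}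
        ⊆ {ω | ENNReal.ofReal δ ≤ ENNReal.ofReal r * ∑ i ∈ Finset.range (A k), B i ω} := by
      intro ω hω
      simp only [Set.mem_setOf_eq] at hω ⊢
      by_contra hcon
      rw [not_le] at hcon
      refine absurd hω (not_lt.2 ?_)
      rw [← le_div_iff₀' hs0]
      haveI : Nonempty I01 := ⟨⟨0, by simp⟩⟩
      refine ciSup_le fun t => ?_
      rw [le_div_iff₀' hs0, hdiff, abs_neg, abs_of_nonneg (by positivity), ← mul_assoc, ← hr]
      rw [← ENNReal.ofReal_le_ofReal_iff hδ.le]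
      refine le_trans ?_ hcon.le
      rw [ENNReal.ofReal_mul hr0, ENNReal.ofReal_sum_of_nonneg (fun i _ => by positivity)]
      gcongr with i _
      exact bB i ω t
    have mS : Measurable (fun ω => ENNReal.ofReal r * ∑ i ∈ Finset.range (A k), B i ω) :=
      (Finset.measurable_sum _ fun i _ => mB i).const_mul _
    have hP := (measure_mono hsub).trans (meas_ge_le_lintegral_div (μ := P) mS.aemeasurable
      (ε := ENNReal.ofReal δ) (by simpa using hδ) ENNReal.ofReal_ne_top)
    have hI : ∫⁻ ω, ENNReal.ofReal r * ∑ i ∈ Finset.range (A k), B i ω ∂P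
        ≤ ENNReal.ofReal r * (A k * C) := by
      rw [lintegral_const_mul' _ _ ENNReal.ofReal_ne_top, lintegral_finsetSum _ fun i _ => mB i]
      gcongr
      refine (Finset.sum_le_sum fun i _ => IB i).trans ?_
      simp
    have hP2 := hP.trans (ENNReal.div_le_div_right hI _)
    have hδ' : ENNReal.ofReal δ ≠ 0 := by simpa using hδ
    have hP3 := ENNReal.toReal_mono (ENNReal.div_ne_top (by finiteness) hδ') hP2
    refine hP3.trans ?_
    rw [ENNReal.toReal_div, ENNReal.toReal_mul, ENNReal.toReal_mul, ENNReal.toReal_ofReal hr0,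
      ENNReal.toReal_ofReal hδ.le, ENNReal.toReal_natCast]
    have hr2 : r ≤ 2 / √N := by
      rw [hr, ← div_eq_mul_inv, div_le_div_iff₀ hpos hs0, hsN]
      linarith
    calc r * (A k * C.toReal) / δ ≤ (2 / √N) * (A k * C.toReal) / δ := by gcongr
      _ = _ := by ring
  refine squeeze_zero' (Eventually.of_forall fun k => ENNReal.toReal_nonneg) hbound ?_
  simpa using hAN.const_mul (2 * C.toReal / δ)

/-- **Variance estimator expansion.**
In the functional random effects model under Assumption D, with `A → ∞`, `min_i n_i → ∞`
and `A/√N → 0`, for `l = 1,2`: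
`√N · sup_t |σ̂_l²(t) − (N−A)^{-1} Σ_i Σ_j η_{l,i,j}(t)²| → 0` in probability. -/
theorem statement12 {Ω : Type*} [MeasurableSpace Ω] (P : Measure Ω) [IsProbabilityMeasure P]
    [MeasurableSpace CI] [BorelSpace CI]
    (μ1 μ2 : CI) (ε1 ε2 : ℕ → Ω → CI) (η1 η2 : ℕ → ℕ → Ω → CI)
    (hmeasε : ∀ i, Measurable (ε1 i) ∧ Measurable (ε2 i))
    (hmeasη : ∀ i j, Measurable (η1 i j) ∧ Measurable (η2 i j))
    (hindep : iIndepFun (m := fun _ : ℕ ⊕ ℕ × ℕ => (inferInstance : MeasurableSpace (CI × CI)))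
      (effFam ε1 ε2 η1 η2) P)
    (hidε : ∀ i, Measure.map (fun ω => (ε1 i ω, ε2 i ω)) P
      = Measure.map (fun ω => (ε1 0 ω, ε2 0 ω)) P)
    (hidη : ∀ i j, Measure.map (fun ω => (η1 i j ω, η2 i j ω)) P
      = Measure.map (fun ω => (η1 0 0 ω, η2 0 0 ω)) P)
    (hcentε : ∀ i (t : I01), (∫ ω, ε1 i ω t ∂P = 0) ∧ (∫ ω, ε2 i ω t ∂P = 0))
    (hcentη : ∀ i j (t : I01), (∫ ω, η1 i j ω t ∂P = 0) ∧ (∫ ω, η2 i j ω t ∂P = 0))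
    -- Assumption D, (D1): moment bounds for the individual errors
    (ν1 ν2 K : ℝ) (hν1 : 0 < ν1) (hν2 : 0 < ν2)
    (hmom1 : ∀ i j, ∫⁻ ω, ENNReal.ofReal (‖η1 i j ω‖ ^ ((4:ℝ) + ν1)) ∂P ≤ ENNReal.ofReal K)
    (hmom2 : ∀ i j, ∫⁻ ω, ENNReal.ofReal (‖η2 i j ω‖ ^ ((4:ℝ) + ν2)) ∂P ≤ ENNReal.ofReal K)
    (hmom18 : ∀ i j, ∫⁻ ω, ENNReal.ofReal (‖η1 i j ω‖ ^ ((8:ℝ))) ∂P < ⊤)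
    (hmom28 : ∀ i j, ∫⁻ ω, ENNReal.ofReal (‖η2 i j ω‖ ^ ((8:ℝ))) ∂P < ⊤)
    -- Assumption D, (D2): Hölder condition
    (ϑ Ktilde : ℝ) (hϑ : 1/4 < ϑ)
    (M1 M2 : Ω → ℝ) (hM10 : ∀ ω, 0 ≤ M1 ω) (hM20 : ∀ ω, 0 ≤ M2 ω)
    (hM14 : ∀ i j, ∫⁻ ω, ENNReal.ofReal (‖η1 i j ω‖ ^ ((4:ℝ)) * M1 ω ^ ((4:ℝ))) ∂P
      ≤ ENNReal.ofReal Ktilde)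
    (hM24 : ∀ i j, ∫⁻ ω, ENNReal.ofReal (‖η2 i j ω‖ ^ ((4:ℝ)) * M2 ω ^ ((4:ℝ))) ∂P
      ≤ ENNReal.ofReal Ktilde)
    (hHold1 : ∀ i j, ∀ᵐ ω ∂P, ∀ s t : I01,
      |η1 i j ω s - η1 i j ω t| ≤ M1 ω * |(s : ℝ) - (t : ℝ)| ^ ϑ)
    (hHold2 : ∀ i j, ∀ᵐ ω ∂P, ∀ s t : I01,
      |η2 i j ω s - η2 i j ω t| ≤ M2 ω * |(s : ℝ) - (t : ℝ)| ^ ϑ)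
    -- sequences `A k → ∞`, `min_{i<A k} n k i → ∞`, `A/√N → 0`
    (A : ℕ → ℕ) (hApos : ∀ k, 0 < A k) (hA : Tendsto A atTop atTop)
    (n : ℕ → ℕ → ℕ) (hnpos : ∀ k i, 0 < n k i)
    (hmin : Tendsto (fun k => (Finset.range (A k)).inf'
      (Finset.nonempty_range_iff.mpr (hApos k).ne') (n k)) atTop atTop)
    (hAN : Tendsto (fun k => (A k : ℝ) /
      Real.sqrt (∑ i ∈ Finset.range (A k), (n k i : ℝ))) atTop (𝓝 0)) :
    ∀ δ > (0:ℝ),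
      (Tendsto (fun k => (P {ω | δ <
        Real.sqrt (∑ i ∈ Finset.range (A k), (n k i : ℝ)) * ⨆ t : I01,
          |sigmaHatSq μ1 ε1 η1 (A k) (n k) ω t
            - ((∑ i ∈ Finset.range (A k), (n k i : ℝ)) - (A k : ℝ))⁻¹ *
              ∑ i ∈ Finset.range (A k), ∑ j ∈ Finset.range (n k i),
                (η1 i j ω t) ^ 2|}).toReal) atTop (𝓝 0)) ∧
      (Tendsto (fun k => (P {ω | δ <
        Real.sqrt (∑ i ∈ Finset.range (A k), (n k i : ℝ)) * ⨆ t : I01,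
          |sigmaHatSq μ2 ε2 η2 (A k) (n k) ω t
            - ((∑ i ∈ Finset.range (A k), (n k i : ℝ)) - (A k : ℝ))⁻¹ *
              ∑ i ∈ Finset.range (A k), ∑ j ∈ Finset.range (n k i),
                (η2 i j ω t) ^ 2|}).toReal) atTop (𝓝 0)) := by
  have hinr := hindep.precomp (g := fun p : ℕ × ℕ => (Sum.inr p : ℕ ⊕ ℕ × ℕ)) Sum.inr_injective
  have mp : ∀ i j, Measurable (fun ω => (η1 i j ω, η2 i j ω)) := fun i j =>
    (hmeasη i j).1.prodMk (hmeasη i j).2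
  intro δ hδ
  refine ⟨main_one P μ1 ε1 η1 (fun i j => (hmeasη i j).1) ?_ ?_ (fun i j t => (hcentη i j t).1)
      hmom18 ϑ Ktilde hϑ M1 hM10 hM14 hHold1 A hApos n hnpos hAN δ hδ,
    main_one P μ2 ε2 η2 (fun i j => (hmeasη i j).2) ?_ ?_ (fun i j t => (hcentη i j t).2)
      hmom28 ϑ Ktilde hϑ M2 hM20 hM24 hHold2 A hApos n hnpos hAN δ hδ⟩
  · exact hinr.comp (fun _ => Prod.fst) (fun _ => measurable_fst)
  · intro i j
    have := congrArg (Measure.map Prod.fst) (hidη i j)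
    rwa [Measure.map_map measurable_fst (mp _ _), Measure.map_map measurable_fst (mp _ _)] at this
  · exact hinr.comp (fun _ => Prod.snd) (fun _ => measurable_snd)
  · intro i j
    have := congrArg (Measure.map Prod.snd) (hidη i j)
    rwa [Measure.map_map measurable_snd (mp _ _), Measure.map_map measurable_snd (mp _ _)] at this
end
end
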